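/- Let T be large, set δ = 50 (log log T)/(log T), and let x > 1 satisfy δ log x < 1. Then the sum of x^{iγ}(1 − x^{β−1/2}) over the nontrivial zeros ρ = β + iγ of the Riemann zeta function with 0 < γ ≤ T and |β − 1/2| < δ, counted with multiplicity, is ≪ T log²x / log T, with an absolute implied constant. -/

import Mathlib

open Filter MeasureTheory Real Complex Set

open Classical in
/-- Multiplicity of a point as a zero of the Riemann zeta function. -/
noncomputable def zetaZeroMult (ρ : ℂ) : ℕ :=
  if h : AnalyticAt ℂ riemannZeta ρ then (analyticOrderAt riemannZeta ρ).toNat else 0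

/-- Nontrivial zeros with imaginary part in `(0, T]`. -/
def zetaZerosUpTo (T : ℝ) : Set ℂ :=
  {ρ : ℂ | riemannZeta ρ = 0 ∧ 0 < ρ.re ∧ ρ.re < 1 ∧ 0 < ρ.im ∧ ρ.im ≤ T}

/-- `N(T)`: number of nontrivial zeros with `0 < γ ≤ T`, counted with multiplicity. -/
noncomputable def zetaN (T : ℝ) : ℕ := ∑ᶠ ρ ∈ zetaZerosUpTo T, zetaZeroMult ρ

/-- Explicit density `g` when `α = a log p / (2 π q)`. -/
noncomputable def gPAQ (p a q : ℕ) (t : ℝ) : ℝ :=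
  -(((p : ℝ) ^ ((a : ℝ) / 2) * Real.cos (2 * π * q * t) - 1) * Real.log p) /
    (π * ((p : ℝ) ^ (a : ℝ) - 2 * (p : ℝ) ^ ((a : ℝ) / 2) * Real.cos (2 * π * q * t) + 1))

/-- `α` has the special form `a log p / (2 π q)` with `p` prime, `a, q` coprime positive. -/
def IsSpecialForm (α : ℝ) (p a q : ℕ) : Prop :=
  p.Prime ∧ 0 < a ∧ 0 < q ∧ Nat.Coprime a q ∧ α = a * Real.log p / (2 * π * q)

/-- `g` is the density `g_α` associated with `α`. -/
def IsDensityOf (α : ℝ) (g : ℝ → ℝ) : Prop :=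
  (∀ p a q : ℕ, IsSpecialForm α p a q → g = gPAQ p a q) ∧
    ((¬ ∃ p a q : ℕ, IsSpecialForm α p a q) → g = 0)

/-- Sum of `h(αγ)` over zeros with `0 < γ ≤ T`, with multiplicity; `h` is `1`-periodic so this
equals the sum of `h({αγ})`. -/
noncomputable def zetaZeroSum (α : ℝ) (h : ℝ → ℂ) (T : ℝ) : ℂ :=
  ∑ᶠ ρ ∈ zetaZerosUpTo T, (zetaZeroMult ρ : ℂ) * h (α * ρ.im)

/-- `h` is (a lift of) an absolutely continuous function on `𝕋 = ℝ/ℤ`, with derivative `h'`. -/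
def IsAbsContTorus (h h' : ℝ → ℂ) : Prop :=
  Function.Periodic h 1 ∧ Function.Periodic h' 1 ∧
    (∀ a b : ℝ, IntervalIntegrable h' volume a b) ∧
    ∀ y : ℝ, h y = h 0 + ∫ t in (0:ℝ)..y, h' t

/-- `L¹` modulus of continuity on the torus. -/
noncomputable def modCont (f : ℝ → ℂ) (δ : ℝ) : ℝ :=
  sSup ((fun u => ∫ t in (0:ℝ)..1, ‖f (t + u) - f t‖) '' Set.Icc (-δ) δ)

/-- `M_α(y;T)`. -/
noncomputable def Mfun (α y T : ℝ) : ℝ :=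
  (1 / T) * (∑ᶠ ρ ∈ {ρ : ℂ | riemannZeta ρ = 0 ∧ 0 < ρ.re ∧ ρ.re < 1 ∧ 0 < ρ.im ∧ ρ.im ≤ T ∧
      Int.fract (α * ρ.im) < y}, (zetaZeroMult ρ : ℝ)) - y * (zetaN T) / T

/-- Normalized discrepancy `D*_α(T)`. -/
noncomputable def Dstar (α T : ℝ) : ℝ :=
  sSup ((fun y => (T / (zetaN T)) * |Mfun α y T|) '' Set.Icc (0:ℝ) 1)

namespace FZ

lemma sum_moebius_floor (N : ℕ) (hN : 1 ≤ N) :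
    ∑ n ∈ Finset.Ioc 0 N, (ArithmeticFunction.moebius n : ℝ) * ((N / n : ℕ) : ℝ) = 1 := by
  have h := ArithmeticFunction.sum_Ioc_mul_zeta_eq_sum ArithmeticFunction.moebius N
  rw [ArithmeticFunction.moebius_mul_coe_zeta] at h
  have h2 : ∑ n ∈ Finset.Ioc 0 N, (1 : ArithmeticFunction ℤ) n = 1 := by
    rw [Finset.sum_eq_single 1]
    · simp
    · intro b _ hb; simp [hb]
    · intro h; simp at h; omega
  rw [h2] at h
  have h3 := congrArg (Int.cast : ℤ → ℝ) h.symm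
  rw [Int.cast_sum] at h3
  simpa only [Int.cast_mul, Int.cast_natCast, Int.cast_one] using h3

lemma abs_moebius_real_le (n : ℕ) : |(ArithmeticFunction.moebius n : ℝ)| ≤ 1 := by
  exact_mod_cast (ArithmeticFunction.abs_moebius_le_one (n := n))

lemma abs_sum_mu_div (N : ℕ) :
    |∑ n ∈ Finset.Ioc 0 N, (ArithmeticFunction.moebius n : ℝ) / n| ≤ 1 := by
  rcases Nat.eq_zero_or_pos N with rfl | hN
  · simp
  have h1 := sum_moebius_floor N hN
  have hNr : (0 : ℝ) < N := by exact_mod_cast hN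
  have key : (N : ℝ) * ∑ n ∈ Finset.Ioc 0 N, (ArithmeticFunction.moebius n : ℝ) / n
      = 1 + ∑ n ∈ Finset.Ioc 0 N, (ArithmeticFunction.moebius n : ℝ) * ((N : ℝ) / n - ((N / n : ℕ) : ℝ)) := by
    rw [← h1, ← Finset.sum_add_distrib, Finset.mul_sum]
    refine Finset.sum_congr rfl fun n _ => by ring
  have hb : |∑ n ∈ Finset.Ioc 0 N, (ArithmeticFunction.moebius n : ℝ) * ((N : ℝ) / n - ((N / n : ℕ) : ℝ))|
      ≤ N - 1 := by
    have hsplit : Finset.Ioc 0 N = insert N (Finset.Ioc 0 (N-1)) := by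
      ext x; simp; omega
    rw [hsplit, Finset.sum_insert (by simp; try omega)]
    have h0 : (ArithmeticFunction.moebius N : ℝ) * ((N : ℝ) / N - ((N / N : ℕ) : ℝ)) = 0 := by
      rw [Nat.div_self hN, div_self hNr.ne']; simp
    rw [h0, zero_add]
    refine (Finset.abs_sum_le_sum_abs _ _).trans ?_
    calc _ ≤ ∑ n ∈ Finset.Ioc 0 (N-1), (1 : ℝ) := by
          refine Finset.sum_le_sum fun n hn => ?_
          rw [abs_mul]
          have hn1 : 0 < n := (Finset.mem_Ioc.mp hn).1
          have hnr : (0 : ℝ) < n := by exact_mod_cast hn1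
          have e : ((N / n : ℕ) : ℝ) = (⌊(N : ℝ) / n⌋₊ : ℝ) := by
            rw [Nat.floor_div_natCast, Nat.floor_natCast]
          have f1 := Nat.floor_le (a := (N : ℝ) / n) (by positivity)
          have f2 := Nat.lt_floor_add_one ((N : ℝ) / n)
          have : |(N : ℝ) / n - ((N / n : ℕ) : ℝ)| ≤ 1 := by
            rw [e, abs_le]; constructor <;> linarith
          calc _ ≤ (1 : ℝ) * 1 := mul_le_mul (abs_moebius_real_le n) this (abs_nonneg _) zero_le_one
            _ = 1 := one_mul 1
      _ = N - 1 := by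
        simp; push_cast [Nat.cast_sub hN]; ring
  have : |(N : ℝ) * ∑ n ∈ Finset.Ioc 0 N, (ArithmeticFunction.moebius n : ℝ) / n| ≤ N := by
    rw [key]; refine (abs_add_le _ _).trans ?_
    rw [abs_one]; linarith
  rw [abs_mul, abs_of_pos hNr] at this
  nlinarith

lemma harm_bound (w : ℝ) (hw : 1 ≤ w) :
    |((harmonic ⌊w⌋₊ : ℚ) : ℝ) - Real.log w - Real.eulerMascheroniConstant| ≤ 2 / w := by
  set k := ⌊w⌋₊ with hk
  have hk1 : 1 ≤ k := Nat.le_floor (by simpa using hw)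
  have hkr : (1 : ℝ) ≤ k := by exact_mod_cast hk1
  have f1 : (k : ℝ) ≤ w := Nat.floor_le (by linarith)
  have f2 : w < k + 1 := Nat.lt_floor_add_one w
  have g1 := Real.eulerMascheroniSeq_lt_eulerMascheroniConstant k
  have g2 := Real.eulerMascheroniConstant_lt_eulerMascheroniSeq' k
  rw [Real.eulerMascheroniSeq] at g1
  rw [Real.eulerMascheroniSeq', if_neg (by omega)] at g2
  have l1 : Real.log k ≤ Real.log w := Real.log_le_log (by linarith) f1
  have l2 : Real.log w ≤ Real.log (k + 1) := Real.log_le_log (by linarith) f2.le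
  have l3 : Real.log (k + 1) - Real.log k ≤ 1 / k := by
    rw [← Real.log_div (by linarith) (by linarith)]
    have := Real.log_le_sub_one_of_pos (x := ((k : ℝ) + 1) / k) (by positivity)
    have e : ((k : ℝ) + 1) / k - 1 = 1 / k := by field_simp; ring
    linarith
  have l4 : 1 / (k : ℝ) ≤ 2 / w := by
    rw [div_le_div_iff₀ (by linarith) (by linarith)]; linarith
  rw [abs_le]; constructor <;> linarith

noncomputable def fmu : ArithmeticFunction ℝ := ⟨fun n => (ArithmeticFunction.moebius n : ℝ) / n, by simp⟩
noncomputable def finv : ArithmeticFunction ℝ := ⟨fun n => 1 / (n : ℝ), by simp⟩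

lemma fmu_mul_finv (n : ℕ) : (fmu * finv) n = if n = 1 then 1 else 0 := by
  rw [ArithmeticFunction.mul_apply]
  have h : ∑ x ∈ n.divisorsAntidiagonal, fmu x.1 * finv x.2
      = ∑ x ∈ n.divisorsAntidiagonal, (ArithmeticFunction.moebius x.1 : ℝ) * (1 / (n:ℝ)) := by
    refine Finset.sum_congr rfl fun x hx => ?_
    have := (Nat.mem_divisorsAntidiagonal.mp hx).1
    simp only [fmu, finv, ArithmeticFunction.coe_mk]
    rw [← this]; push_cast
    rw [div_mul_div_comm, mul_one, mul_one_div]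
  rw [h, ← Finset.sum_mul]
  rw [Nat.sum_divisorsAntidiagonal (fun i _ => (ArithmeticFunction.moebius i : ℝ))]
  have h2 := congrArg (fun f : ArithmeticFunction ℤ => f n) ArithmeticFunction.moebius_mul_coe_zeta
  simp only [ArithmeticFunction.coe_mul_zeta_apply] at h2
  have h3 : ∑ i ∈ n.divisors, (ArithmeticFunction.moebius i : ℝ) = (((1 : ArithmeticFunction ℤ) n : ℤ) : ℝ) := by
    rw [← h2]; push_cast; rfl
  rw [h3]
  split_ifs with hn
  · subst hn; simp
  · simp [hn]

/-- `S1 z = ∑_{j ≤ z} μ(j)/j log(z/j)` is bounded. -/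
lemma S1_bound (z : ℝ) (hz : 0 < z) :
    |∑ j ∈ Finset.Ioc 0 ⌊z⌋₊, (ArithmeticFunction.moebius j : ℝ) / j * Real.log (z / j)| ≤ 4 := by
  rcases lt_or_ge z 1 with h1 | h1
  · rw [Nat.floor_eq_zero.mpr h1]; simp
  set N := ⌊z⌋₊ with hN
  have hN1 : 1 ≤ N := Nat.le_floor (by simpa using h1)
  have h := ArithmeticFunction.sum_Ioc_mul_eq_sum_sum fmu finv N
  have hl : ∑ n ∈ Finset.Ioc 0 N, (fmu * finv) n = 1 := by
    simp_rw [fmu_mul_finv]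
    rw [Finset.sum_ite_eq' (Finset.Ioc 0 N) 1]
    simp; omega
  rw [hl] at h
  have hr : ∀ j ∈ Finset.Ioc 0 N, fmu j * ∑ m ∈ Finset.Ioc 0 (N / j), finv m
      = (ArithmeticFunction.moebius j : ℝ) / j * ((harmonic ⌊z / j⌋₊ : ℚ) : ℝ) := by
    intro j hj
    rw [Nat.floor_div_natCast, ← hN]
    simp only [fmu, finv, ArithmeticFunction.coe_mk]
    rw [harmonic_eq_sum_Icc]
    push_cast
    congr 1
    refine Finset.sum_congr (by ext; simp; omega) fun m _ => by simp
  rw [Finset.sum_congr rfl hr] at h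
  have key : ∑ j ∈ Finset.Ioc 0 N, (ArithmeticFunction.moebius j : ℝ) / j * Real.log (z / j)
     = 1 - Real.eulerMascheroniConstant * ∑ j ∈ Finset.Ioc 0 N, (ArithmeticFunction.moebius j : ℝ) / j
       - ∑ j ∈ Finset.Ioc 0 N, (ArithmeticFunction.moebius j : ℝ) / j *
        (((harmonic ⌊z / j⌋₊ : ℚ) : ℝ) - Real.log (z / j) - Real.eulerMascheroniConstant) := by
    rw [h, Finset.mul_sum, ← Finset.sum_sub_distrib, ← Finset.sum_sub_distrib]
    refine Finset.sum_congr rfl fun n _ => by ring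
  have e : |∑ j ∈ Finset.Ioc 0 N, (ArithmeticFunction.moebius j : ℝ) / j *
        (((harmonic ⌊z / j⌋₊ : ℚ) : ℝ) - Real.log (z / j) - Real.eulerMascheroniConstant)| ≤ 2 := by
    refine (Finset.abs_sum_le_sum_abs _ _).trans ?_
    calc _ ≤ ∑ n ∈ Finset.Ioc 0 N, 2 / z := by
          refine Finset.sum_le_sum fun n hn => ?_
          obtain ⟨hn1, hn2⟩ := Finset.mem_Ioc.mp hn
          have hnr : (0 : ℝ) < n := by exact_mod_cast hn1
          have hnz : (n : ℝ) ≤ z := (Nat.le_floor_iff hz.le).mp hn2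
          rw [abs_mul, abs_div, abs_of_pos hnr]
          have h1 := harm_bound (z / n) (by rw [le_div_iff₀ hnr]; linarith)
          calc _ ≤ 1 / (n : ℝ) * (2 / (z / n)) := by
                gcongr
                exact abs_moebius_real_le n
            _ = 2 / z := by field_simp
      _ ≤ 2 := by
        simp
        have : (N : ℝ) ≤ z := Nat.floor_le hz.le
        rw [mul_div_assoc', div_le_iff₀ hz]; linarith
  have g0 : |Real.eulerMascheroniConstant * ∑ j ∈ Finset.Ioc 0 N, (ArithmeticFunction.moebius j : ℝ) / j| ≤ 1 := by
    rw [abs_mul]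
    have a := Real.one_half_lt_eulerMascheroniConstant
    have b := Real.eulerMascheroniConstant_lt_two_thirds
    have c := abs_sum_mu_div N
    rw [abs_of_pos (by linarith)]
    nlinarith [abs_nonneg (∑ j ∈ Finset.Ioc 0 N, (ArithmeticFunction.moebius j : ℝ) / j)]
  rw [key]
  rw [abs_le] at *
  constructor <;> linarith [e.1, e.2, g0.1, g0.2]

end FZ

namespace FZ

/-- truncated twisted Moebius sums -/
noncomputable def Smu (ε : ℝ) (b N : ℕ) (z : ℝ) : ℝ :=
  ∑ j ∈ (Finset.Ioc 0 N).filter (fun j => Nat.Coprime b j),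
    (ArithmeticFunction.moebius j : ℝ) * (j : ℝ) ^ (-1 - ε) * Real.posLog (z / j)

lemma posLog_eq_zero_of_floor_lt {z : ℝ} {j : ℕ} (hz : 0 < z) (h : ⌊z⌋₊ < j) :
    Real.posLog (z / j) = 0 := by
  have hj : z < j := (Nat.floor_lt hz.le).mp h
  have hj0 : (0:ℝ) < j := hz.trans hj
  rw [Real.posLog_eq_zero_iff, abs_of_pos (by positivity), div_le_one hj0]
  exact hj.le

lemma posLog_eq_log_of_le {z : ℝ} {j : ℕ} (hz : 0 < z) (hj : 0 < j) (h : j ≤ ⌊z⌋₊) :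
    Real.posLog (z / j) = Real.log (z / j) := by
  have hj' : (j:ℝ) ≤ z := (Nat.le_floor_iff hz.le).mp h
  have hj0 : (0:ℝ) < j := by exact_mod_cast hj
  apply Real.posLog_eq_log
  rw [abs_of_pos (by positivity), one_le_div hj0]
  exact hj'

/-- Untwisted sums with `posLog` and arbitrary long range. -/
lemma S1_posLog (z : ℝ) (hz : 0 < z) (N : ℕ) (hN : ⌊z⌋₊ ≤ N) :
    |∑ j ∈ Finset.Ioc 0 N, (ArithmeticFunction.moebius j : ℝ) / j * Real.posLog (z / j)| ≤ 4 := by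
  have h := S1_bound z hz
  have e : ∑ j ∈ Finset.Ioc 0 N, (ArithmeticFunction.moebius j : ℝ) / j * Real.posLog (z / j)
      = ∑ j ∈ Finset.Ioc 0 ⌊z⌋₊, (ArithmeticFunction.moebius j : ℝ) / j * Real.log (z / j) := by
    symm
    rw [← Finset.sum_subset (Finset.Ioc_subset_Ioc_right hN)]
    · refine Finset.sum_congr rfl fun j hj => ?_
      obtain ⟨h1, h2⟩ := Finset.mem_Ioc.mp hj
      rw [posLog_eq_log_of_le hz h1 h2]
    · intro j hj hj2
      rw [posLog_eq_zero_of_floor_lt hz, mul_zero]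
      simp only [Finset.mem_Ioc] at hj hj2
      omega
  rw [e]; exact h

lemma taylor_exp (ε l v : ℝ) :
    (l - v) * Real.exp (-ε * v) = Real.exp (-ε * l) * (l - v)
      + ∫ r in v..l, (2 * ε * Real.exp (-ε * r) + ε ^ 2 * (l - r) * Real.exp (-ε * r)) * (r - v) := by
  have hd : ∀ r ∈ Set.uIcc v l, HasDerivAt
      (fun r => (r - v) * (-Real.exp (-ε * r) - ε * (l - r) * Real.exp (-ε * r)) - (l - r) * Real.exp (-ε * r))
      ((2 * ε * Real.exp (-ε * r) + ε ^ 2 * (l - r) * Real.exp (-ε * r)) * (r - v)) r := by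
    intro r _
    have h1 : HasDerivAt (fun r : ℝ => Real.exp (-ε * r)) (Real.exp (-ε * r) * (-ε)) r := by
      have := ((hasDerivAt_id r).const_mul (-ε)).exp
      simpa using this
    have h2 : HasDerivAt (fun r : ℝ => r - v) 1 r := (hasDerivAt_id r).sub_const v
    have h3 : HasDerivAt (fun r : ℝ => l - r) (-1) r := (hasDerivAt_id r).const_sub l
    have := (h2.mul ((h1.neg).sub ((h3.const_mul ε).mul h1))).sub (h3.mul h1)
    refine this.congr_deriv ?_
    simp only [Pi.neg_apply, Pi.sub_apply, Pi.mul_apply]; ring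
  rw [intervalIntegral.integral_eq_sub_of_hasDerivAt hd
    (Continuous.intervalIntegrable (by fun_prop) _ _)]
  ring

lemma S_twist (ε z : ℝ) (hε : 0 ≤ ε) (hz : 0 < z) (h2 : ε * Real.log z ≤ 2) (N : ℕ) (hN : ⌊z⌋₊ ≤ N) :
    |Smu ε 1 N z| ≤ 36 := by
  rcases lt_or_ge z 1 with h1 | h1
  · have : Smu ε 1 N z = 0 := by
      refine Finset.sum_eq_zero fun j hj => ?_
      rw [posLog_eq_zero_of_floor_lt hz, mul_zero]
      rw [Nat.floor_eq_zero.mpr h1]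
      simp at hj; exact hj.1
    rw [this]; norm_num
  set l := Real.log z with hl
  have hl0 : 0 ≤ l := Real.log_nonneg h1
  set D : ℝ → ℝ := fun r => ∑ j ∈ Finset.Ioc 0 N, (ArithmeticFunction.moebius j : ℝ) / j * max 0 (r - Real.log j) with hD
  have hDb : ∀ r, r ≤ l → |D r| ≤ 4 := by
    intro r hr
    have hzr : Real.exp r ≤ z := by
      rw [← Real.exp_log hz]; exact Real.exp_le_exp.mpr hr
    have := S1_posLog (Real.exp r) (Real.exp_pos r) N ((Nat.floor_mono hzr).trans hN)
    convert this using 2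
    refine Finset.sum_congr rfl fun j hj => ?_
    have hj0 : (0:ℝ) < j := by exact_mod_cast (Finset.mem_Ioc.mp hj).1
    rw [Real.posLog, Real.log_div (Real.exp_pos r).ne' hj0.ne', Real.log_exp]
  have hDc : Continuous D := by fun_prop
  set W : ℝ → ℝ := fun r => 2 * ε * Real.exp (-ε * r) + ε ^ 2 * (l - r) * Real.exp (-ε * r) with hW
  have hWc : Continuous W := by fun_prop
  have key : Smu ε 1 N z = Real.exp (-ε * l) * D l + ∫ r in (0:ℝ)..l, W r * D r := by
    have : ∫ r in (0:ℝ)..l, W r * D r = ∑ j ∈ Finset.Ioc 0 N, (ArithmeticFunction.moebius j : ℝ) / j *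
        ∫ r in (0:ℝ)..l, W r * max 0 (r - Real.log j) := by
      simp_rw [hD, Finset.mul_sum]
      rw [intervalIntegral.integral_finsetSum]
      · refine Finset.sum_congr rfl fun j _ => ?_
        rw [← intervalIntegral.integral_const_mul]
        congr 1; ext r; ring
      · intro j _
        exact Continuous.intervalIntegrable (by fun_prop) _ _
    rw [this, hD]
    simp only
    rw [Finset.mul_sum, ← Finset.sum_add_distrib, Smu]
    rw [Finset.filter_true_of_mem (fun j _ => Nat.coprime_one_left j)]
    refine Finset.sum_congr rfl fun j hj => ?_
    have hj1 : (1:ℝ) ≤ j := by exact_mod_cast (Finset.mem_Ioc.mp hj).1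
    have hj0 : (0:ℝ) < j := by linarith
    set v := Real.log j with hv
    have hv0 : 0 ≤ v := Real.log_nonneg hj1
    have hp : (j:ℝ) ^ (-1 - ε) = 1 / j * Real.exp (-ε * v) := by
      rw [sub_eq_add_neg, Real.rpow_add hj0, Real.rpow_neg_one, Real.rpow_def_of_pos hj0, one_div, mul_comm v]
    rw [hp, Real.posLog, Real.log_div hz.ne' hj0.ne', ← hl, ← hv]
    rcases le_total v l with hvl | hvl
    · have hI : ∫ r in (0:ℝ)..l, W r * max 0 (r - v) = ∫ r in v..l, W r * (r - v) := by
        rw [← intervalIntegral.integral_add_adjacent_intervals (b := v)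
          (Continuous.intervalIntegrable (by fun_prop) _ _) (Continuous.intervalIntegrable (by fun_prop) _ _)]
        have e1 : ∫ r in (0:ℝ)..v, W r * max 0 (r - v) = 0 := by
          rw [intervalIntegral.integral_congr (g := fun _ => 0)]
          · simp
          · intro r hr
            rw [Set.uIcc_of_le hv0] at hr
            simp only
            rw [max_eq_left (by linarith [hr.2]), mul_zero]
        rw [e1, zero_add]
        apply intervalIntegral.integral_congr
        intro r hr
        rw [Set.uIcc_of_le hvl] at hr
        simp only
        rw [max_eq_right (by linarith [hr.1])]
      rw [hI, max_eq_right (by linarith)]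
      have := taylor_exp ε l v
      have e3 : (∫ r in v..l, W r * (r - v)) = (l - v) * Real.exp (-ε * v) - Real.exp (-ε * l) * (l - v) := by
        rw [this]; simp only [hW]; ring
      rw [e3]; ring
    · have hI : ∫ r in (0:ℝ)..l, W r * max 0 (r - v) = 0 := by
        rw [intervalIntegral.integral_congr (g := fun _ => 0)]
        · simp
        · intro r hr
          rw [Set.uIcc_of_le hl0] at hr
          simp only
          rw [max_eq_left (by linarith [hr.2]), mul_zero]
      rw [hI, max_eq_left (by linarith)]; ring
  have hintg : ‖∫ r in (0:ℝ)..l, W r * D r‖ ≤ (2 * ε + ε ^ 2 * l) * 4 * |l - 0| := by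
    apply intervalIntegral.norm_integral_le_of_norm_le_const
    intro r hr
    rw [Set.uIoc_of_le hl0] at hr
    rw [norm_mul]
    have hx : Real.exp (-ε * r) ≤ 1 := by
      rw [Real.exp_le_one_iff]; nlinarith [hr.1]
    have hx0 := Real.exp_pos (-ε * r)
    have hWb : ‖W r‖ ≤ 2 * ε + ε ^ 2 * l := by
      have e0 : 0 ≤ W r := by
        simp only [hW]
        have : 0 ≤ l - r := by linarith [hr.2]
        positivity
      rw [Real.norm_of_nonneg e0]
      simp only [hW]
      have a1 : 2 * ε * Real.exp (-ε * r) ≤ 2 * ε * 1 := by gcongr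
      have a2 : ε ^ 2 * (l - r) * Real.exp (-ε * r) ≤ ε ^ 2 * l * 1 := by
        have : l - r ≤ l := by linarith [hr.1]
        gcongr
      linarith
    exact mul_le_mul hWb (hDb r hr.2) (norm_nonneg _) (by positivity)
  rw [sub_zero, abs_of_nonneg hl0, Real.norm_eq_abs] at hintg
  rw [key]
  refine (abs_add_le _ _).trans ?_
  have hx : Real.exp (-ε * l) ≤ 1 := by
    rw [Real.exp_le_one_iff]; nlinarith
  rw [abs_mul, abs_of_pos (Real.exp_pos _)]
  have h5 := hDb l le_rfl
  have h6 : Real.exp (-ε * l) * |D l| ≤ 1 * 4 := by gcongr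
  have h7 : 0 ≤ ε * l := by positivity
  nlinarith

lemma Smu_rec (ε z : ℝ) (b p N : ℕ) (hp : p.Prime) (hb : Nat.Coprime p b) :
    Smu ε (p * b) N z = Smu ε b N z + (p:ℝ) ^ (-1 - ε) * Smu ε (p * b) (N / p) (z / p) := by
  have hp0 : (0:ℝ) < p := by exact_mod_cast hp.pos
  have h1 : Smu ε b N z = Smu ε (p * b) N z +
     ∑ j ∈ (Finset.Ioc 0 N).filter (fun j => Nat.Coprime b j ∧ p ∣ j),
    (ArithmeticFunction.moebius j : ℝ) * (j : ℝ) ^ (-1 - ε) * Real.posLog (z / j) := by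
    rw [Smu, Smu, ← Finset.sum_filter_add_sum_filter_not _ (fun j => ¬ p ∣ j), Finset.filter_filter, Finset.filter_filter]
    congr 1
    · refine Finset.sum_congr ?_ fun _ _ => rfl
      ext j
      simp only [Finset.mem_filter, Nat.coprime_mul_iff_left, hp.coprime_iff_not_dvd]
      tauto
    · simp only [not_not]
  have h2 : ∑ j ∈ (Finset.Ioc 0 N).filter (fun j => Nat.Coprime b j ∧ p ∣ j),
    (ArithmeticFunction.moebius j : ℝ) * (j : ℝ) ^ (-1 - ε) * Real.posLog (z / j)
     = ∑ m ∈ (Finset.Ioc 0 (N / p)).filter (fun m => Nat.Coprime b m),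
    (ArithmeticFunction.moebius (p * m) : ℝ) * ((p * m : ℕ) : ℝ) ^ (-1 - ε) * Real.posLog (z / (p * m : ℕ)) := by
    symm
    apply Finset.sum_bij (fun m _ => p * m)
    · intro m hm
      simp only [Finset.mem_filter, Finset.mem_Ioc] at hm ⊢
      refine ⟨⟨Nat.mul_pos hp.pos hm.1.1, ?_⟩, hb.symm.mul_right hm.2, dvd_mul_right _ _⟩
      have := (Nat.le_div_iff_mul_le hp.pos).mp hm.1.2
      linarith
    · intro a _ c _ h
      exact Nat.eq_of_mul_eq_mul_left hp.pos h
    · intro j hj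
      simp only [Finset.mem_filter, Finset.mem_Ioc] at hj
      obtain ⟨⟨h1, h2⟩, h3, m, rfl⟩ := hj
      refine ⟨m, ?_, rfl⟩
      simp only [Finset.mem_filter, Finset.mem_Ioc]
      refine ⟨⟨Nat.pos_of_mul_pos_left h1, ?_⟩, Nat.Coprime.coprime_mul_left_right h3⟩
      rw [Nat.le_div_iff_mul_le hp.pos]; linarith
    · intro m _; rfl
  have h3 : ∑ m ∈ (Finset.Ioc 0 (N / p)).filter (fun m => Nat.Coprime b m),
    (ArithmeticFunction.moebius (p * m) : ℝ) * ((p * m : ℕ) : ℝ) ^ (-1 - ε) * Real.posLog (z / (p * m : ℕ))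
     = - ((p:ℝ) ^ (-1 - ε) * Smu ε (p * b) (N / p) (z / p)) := by
    rw [Smu, ← Finset.sum_filter_add_sum_filter_not _ (fun j => ¬ p ∣ j), Finset.filter_filter, Finset.filter_filter]
    have z2 : ∑ m ∈ (Finset.Ioc 0 (N / p)).filter (fun m => Nat.Coprime b m ∧ ¬ ¬ p ∣ m),
      (ArithmeticFunction.moebius (p * m) : ℝ) * ((p * m : ℕ) : ℝ) ^ (-1 - ε) * Real.posLog (z / (p * m : ℕ)) = 0 := by
      refine Finset.sum_eq_zero fun m hm => ?_
      simp only [Finset.mem_filter, not_not] at hm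
      rw [ArithmeticFunction.moebius_eq_zero_of_not_squarefree]
      · simp
      · intro hs
        have := Nat.coprime_of_squarefree_mul hs
        rw [hp.coprime_iff_not_dvd] at this
        exact this hm.2.2
    rw [z2, add_zero, Finset.mul_sum, ← Finset.sum_neg_distrib]
    refine Finset.sum_congr ?_ fun m hm => ?_
    · ext j
      simp only [Finset.mem_filter, Nat.coprime_mul_iff_left, hp.coprime_iff_not_dvd]
      tauto
    · simp only [Finset.mem_filter, Nat.coprime_mul_iff_left] at hm
      rw [ArithmeticFunction.isMultiplicative_moebius.map_mul_of_coprime hm.2.1,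
        ArithmeticFunction.moebius_apply_prime hp]
      push_cast
      rw [Real.mul_rpow hp0.le (by positivity), div_div]
      ring
  rw [h2, h3] at h1
  linarith

lemma Smu_bound (ε : ℝ) (hε : 0 ≤ ε) (b : ℕ) : Squarefree b → ∀ (z : ℝ), 0 < z →
    ε * Real.log z ≤ 2 → ∀ N : ℕ, ⌊z⌋₊ ≤ N → |Smu ε b N z| ≤ 36 * (b / Nat.totient b) := by
  induction b using induction_on_primes with
  | zero => intro h; simp at h
  | one => intro _ z hz h2 N hN; simpa using S_twist ε z hε hz h2 N hN
  | prime_mul p b hp ih =>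
    intro hs
    have hc : Nat.Coprime p b := Nat.coprime_of_squarefree_mul hs
    have hsb : Squarefree b := hs.squarefree_of_dvd (dvd_mul_left _ _)
    have hb0 : 0 < b := Nat.pos_of_ne_zero hsb.ne_zero
    have ihb := ih hsb
    have hp2 : (2:ℝ) ≤ p := by exact_mod_cast hp.two_le
    have hφ : (0:ℝ) < Nat.totient b := by exact_mod_cast Nat.totient_pos.mpr hb0
    have hφe : ((Nat.totient (p * b) : ℕ) : ℝ) = (p - 1) * Nat.totient b := by
      rw [Nat.totient_mul hc, Nat.totient_prime hp]; push_cast [hp.one_le]; ring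
    set K : ℝ := 36 * (b / Nat.totient b) with hK
    have hK0 : 0 ≤ K := by positivity
    have hgoal : (36:ℝ) * (((p * b : ℕ) : ℝ) / Nat.totient (p * b)) = K * (p / (p - 1)) := by
      rw [hφe, hK]; push_cast
      have : (p:ℝ) - 1 ≠ 0 := by linarith
      field_simp
    rw [hgoal]
    have main : ∀ n : ℕ, ∀ z : ℝ, 0 < z → z < 2 ^ n → ε * Real.log z ≤ 2 → ∀ N : ℕ, ⌊z⌋₊ ≤ N →
        |Smu ε (p * b) N z| ≤ K * (p / (p - 1)) := by
      intro n
      induction n with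
      | zero =>
        intro z hz h1 _ N _
        have : Smu ε (p * b) N z = 0 := by
          refine Finset.sum_eq_zero fun j hj => ?_
          rw [posLog_eq_zero_of_floor_lt hz, mul_zero]
          rw [Nat.floor_eq_zero.mpr (by simpa using h1)]
          simp at hj; exact hj.1.1
        rw [this, abs_zero]
        have : (0:ℝ) ≤ p / (p - 1) := div_nonneg (by linarith) (by linarith)
        positivity
      | succ n ihn =>
        intro z hz h1 h2 N hN
        rw [Smu_rec ε z b p N hp hc]
        have hz1 : z / p < 2 ^ n := by
          rw [div_lt_iff₀ (by linarith)]
          calc z < 2 ^ n * 2 := by rw [← pow_succ]; exact h1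
            _ ≤ 2 ^ n * p := by gcongr
        have hlog : ε * Real.log (z / p) ≤ 2 := by
          refine le_trans ?_ h2
          gcongr
          exact div_le_self hz.le (by linarith)
        have hb1 := ihn (z / p) (by positivity) hz1 hlog (N / p) (by
          rw [Nat.floor_div_natCast]; exact Nat.div_le_div_right hN)
        have hb2 := ihb z hz h2 N hN
        refine (abs_add_le _ _).trans ?_
        have hpp : (p:ℝ) ^ (-1 - ε) ≤ 1 / p := by
          rw [one_div, ← Real.rpow_neg_one]
          exact Real.rpow_le_rpow_of_exponent_le (by linarith) (by linarith)
        rw [abs_mul, abs_of_nonneg (Real.rpow_nonneg (by linarith) _)]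
        calc _ ≤ K + 1 / p * (K * (p / (p - 1))) := by gcongr
          _ = K * (p / (p - 1)) := by
            have : (p:ℝ) - 1 ≠ 0 := by linarith
            field_simp; ring
    intro z hz h2 N hN
    obtain ⟨n, hn⟩ := pow_unbounded_of_one_lt z (one_lt_two)
    exact main n z hz hn h2 N hN

end FZ

namespace FZ

/-- Selberg type mollifier coefficients. -/
noncomputable def lam (Y : ℝ) (h : ℕ) : ℝ :=
  (ArithmeticFunction.moebius h : ℝ) * ((Real.posLog (Y ^ 2 / h) - Real.posLog (Y / h)) / Real.log Y)

noncomputable def HY (Y : ℝ) : ℕ := ⌊Y ^ 2⌋₊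

lemma lam_weight {Y : ℝ} (hY : 1 < Y) {h : ℕ} (hh : 0 < h) :
    0 ≤ (Real.posLog (Y ^ 2 / h) - Real.posLog (Y / h)) / Real.log Y ∧
    (Real.posLog (Y ^ 2 / h) - Real.posLog (Y / h)) / Real.log Y ≤ 1 := by
  have hh0 : (0:ℝ) < h := by exact_mod_cast hh
  have hL : 0 < Real.log Y := Real.log_pos hY
  have hY0 : 0 < Y := by linarith
  have e1 : Real.log (Y ^ 2 / h) = 2 * Real.log Y - Real.log h := by
    rw [Real.log_div (by positivity) hh0.ne', Real.log_pow]; push_cast; ring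
  have e2 : Real.log (Y / h) = Real.log Y - Real.log h := by
    rw [Real.log_div (by positivity) hh0.ne']
  rw [Real.posLog, Real.posLog, e1, e2]
  constructor
  · apply div_nonneg _ hL.le
    have : max 0 (Real.log Y - Real.log h) ≤ max 0 (2 * Real.log Y - Real.log h) :=
      max_le_max le_rfl (by linarith)
    linarith
  · rw [div_le_one hL]
    have : max 0 (2 * Real.log Y - Real.log h) ≤ max 0 (Real.log Y - Real.log h) + Real.log Y := by
      apply max_le
      · have := le_max_left 0 (Real.log Y - Real.log h); linarith
      · have := le_max_right 0 (Real.log Y - Real.log h); linarith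
    linarith

lemma abs_lam_le {Y : ℝ} (hY : 1 < Y) {h : ℕ} (hh : 0 < h) : |lam Y h| ≤ 1 := by
  obtain ⟨h1, h2⟩ := lam_weight hY hh
  rw [lam, abs_mul, abs_of_nonneg h1]
  calc _ ≤ (1:ℝ) * 1 := mul_le_mul (abs_moebius_real_le h) h2 h1 zero_le_one
    _ = 1 := one_mul 1

lemma lam_eq_mu {Y : ℝ} (hY : 1 < Y) {h : ℕ} (hh : 0 < h) (hhY : (h:ℝ) ≤ Y) :
    lam Y h = (ArithmeticFunction.moebius h : ℝ) := by
  have hh0 : (0:ℝ) < h := by exact_mod_cast hh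
  have hL : 0 < Real.log Y := Real.log_pos hY
  have hY0 : 0 < Y := by linarith
  have e1 : Real.log (Y ^ 2 / h) = 2 * Real.log Y - Real.log h := by
    rw [Real.log_div (by positivity) hh0.ne', Real.log_pow]; push_cast; ring
  have e2 : Real.log (Y / h) = Real.log Y - Real.log h := by
    rw [Real.log_div (by positivity) hh0.ne']
  have h3 : Real.log h ≤ Real.log Y := Real.log_le_log hh0 hhY
  rw [lam, Real.posLog, Real.posLog, e1, e2, max_eq_right (by linarith), max_eq_right (by linarith)]
  have : (2 * Real.log Y - Real.log h - (Real.log Y - Real.log h)) / Real.log Y = 1 := by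
    rw [div_eq_one_iff_eq hL.ne']; ring
  rw [this, mul_one]

lemma lam_eq_zero {Y : ℝ} (hY : 1 < Y) {h : ℕ} (hh : HY Y < h) : lam Y h = 0 := by
  have hY0 : 0 < Y := by linarith
  rw [lam, posLog_eq_zero_of_floor_lt (by positivity) hh, posLog_eq_zero_of_floor_lt hY0]
  · simp
  · refine lt_of_le_of_lt (Nat.floor_mono ?_) hh
    nlinarith

/-- coefficients of `ζ M` -/
noncomputable def an (Y : ℝ) (n : ℕ) : ℝ := ∑ h ∈ (Finset.Ioc 0 (HY Y)).filter (fun h => h ∣ n), lam Y h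

lemma an_eq_divisors {Y : ℝ} (hY : 1 < Y) {n : ℕ} (hn : 0 < n) :
    an Y n = ∑ h ∈ n.divisors, lam Y h := by
  rw [an]
  apply Finset.sum_subset_zero_on_sdiff
  · intro h hh
    simp only [Finset.mem_filter, Finset.mem_Ioc] at hh
    exact Nat.mem_divisors.mpr ⟨hh.2, hn.ne'⟩
  · intro h hh
    simp only [Finset.mem_sdiff, Nat.mem_divisors, Finset.mem_filter, Finset.mem_Ioc] at hh
    apply lam_eq_zero hY
    have : 0 < h := Nat.pos_of_dvd_of_pos hh.1.1 hn
    by_contra hc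
    exact hh.2 ⟨⟨this, by omega⟩, hh.1.1⟩
  · intro h _; rfl

lemma an_one {Y : ℝ} (hY : 1 < Y) : an Y 1 = 1 := by
  rw [an_eq_divisors hY one_pos]; simp [lam_eq_mu hY one_pos (by simpa using hY.le)]

lemma an_eq_zero {Y : ℝ} (hY : 1 < Y) {n : ℕ} (hn : 1 < n) (hnY : (n:ℝ) ≤ Y) : an Y n = 0 := by
  rw [an_eq_divisors hY (by omega)]
  have h2 := congrArg (fun f : ArithmeticFunction ℤ => f n) ArithmeticFunction.moebius_mul_coe_zeta
  simp only [ArithmeticFunction.coe_mul_zeta_apply] at h2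
  have h3 : ∑ i ∈ n.divisors, (ArithmeticFunction.moebius i : ℝ) = (((1 : ArithmeticFunction ℤ) n : ℤ) : ℝ) := by
    rw [← h2]; push_cast; rfl
  rw [ArithmeticFunction.one_apply_ne (by omega)] at h3
  rw [← Int.cast_zero, ← h3]
  refine Finset.sum_congr rfl fun h hh => ?_
  have h1 : h ≤ n := Nat.divisor_le hh
  apply lam_eq_mu hY (Nat.pos_of_mem_divisors hh)
  exact le_trans (by exact_mod_cast h1) hnY

lemma abs_an_le {Y : ℝ} (hY : 1 < Y) {n : ℕ} (hn : 0 < n) : |an Y n| ≤ n := by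
  rw [an_eq_divisors hY hn]
  refine (Finset.abs_sum_le_sum_abs _ _).trans ?_
  calc _ ≤ ∑ h ∈ n.divisors, (1:ℝ) := Finset.sum_le_sum fun h hh => abs_lam_le hY (Nat.pos_of_mem_divisors hh)
    _ = (n.divisors.card : ℝ) := by simp
    _ ≤ n := by exact_mod_cast Nat.card_divisors_le_self n

lemma abs_an_le_HY {Y : ℝ} (hY : 1 < Y) (n : ℕ) : |an Y n| ≤ Y ^ 2 := by
  rw [an]
  refine (Finset.abs_sum_le_sum_abs _ _).trans ?_
  calc _ ≤ ∑ h ∈ (Finset.Ioc 0 (HY Y)).filter (fun h => h ∣ n), (1:ℝ) := Finset.sum_le_sum fun h hh => by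
          simp only [Finset.mem_filter, Finset.mem_Ioc] at hh
          exact abs_lam_le hY hh.1.1
    _ = (((Finset.Ioc 0 (HY Y)).filter (fun h => h ∣ n)).card : ℝ) := by simp
    _ ≤ ((Finset.Ioc 0 (HY Y)).card : ℝ) := by exact_mod_cast Finset.card_filter_le _ _
    _ = (HY Y : ℝ) := by simp
    _ ≤ Y ^ 2 := Nat.floor_le (by positivity)

noncomputable def Cb (Y ε : ℝ) (b : ℕ) : ℝ :=
  ∑ h ∈ (Finset.Ioc 0 (HY Y)).filter (fun h => b ∣ h), lam Y h * (h:ℝ) ^ (-1 - ε)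

lemma Cb_not_sqfree (Y ε : ℝ) (b : ℕ) (hb : ¬ Squarefree b) : Cb Y ε b = 0 := by
  refine Finset.sum_eq_zero fun h hh => ?_
  simp only [Finset.mem_filter] at hh
  rw [lam, ArithmeticFunction.moebius_eq_zero_of_not_squarefree]
  · simp
  · intro hs; exact hb (hs.squarefree_of_dvd hh.2)

lemma Cb_eq {Y : ℝ} (ε : ℝ) (b : ℕ) (hb : 0 < b) :
    Cb Y ε b = (ArithmeticFunction.moebius b : ℝ) * (b:ℝ) ^ (-1 - ε) / Real.log Y *
      (Smu ε b (HY Y / b) (Y ^ 2 / b) - Smu ε b (HY Y / b) (Y / b)) := by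
  have hb0 : (0:ℝ) < b := by exact_mod_cast hb
  have h2 : Cb Y ε b = ∑ m ∈ Finset.Ioc 0 (HY Y / b), lam Y (b * m) * ((b * m : ℕ):ℝ) ^ (-1 - ε) := by
    rw [Cb]
    symm
    apply Finset.sum_bij (fun m _ => b * m)
    · intro m hm
      simp only [Finset.mem_filter, Finset.mem_Ioc] at hm ⊢
      refine ⟨⟨Nat.mul_pos hb hm.1, ?_⟩, dvd_mul_right _ _⟩
      have := (Nat.le_div_iff_mul_le hb).mp hm.2
      linarith
    · intro a _ c _ h
      exact Nat.eq_of_mul_eq_mul_left hb h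
    · intro j hj
      simp only [Finset.mem_filter, Finset.mem_Ioc] at hj
      obtain ⟨⟨h1, h2⟩, m, rfl⟩ := hj
      refine ⟨m, ?_, rfl⟩
      simp only [Finset.mem_Ioc]
      refine ⟨Nat.pos_of_mul_pos_left h1, ?_⟩
      rw [Nat.le_div_iff_mul_le hb]; linarith
    · intro m _; rfl
  rw [h2, Smu, Smu, ← Finset.sum_sub_distrib, Finset.mul_sum, Finset.sum_filter]
  refine Finset.sum_congr rfl fun m hm => ?_
  split_ifs with hc
  · rw [lam, ArithmeticFunction.isMultiplicative_moebius.map_mul_of_coprime hc]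
    push_cast
    rw [Real.mul_rpow hb0.le (by positivity), div_div, div_div]
    ring
  · rw [lam, ArithmeticFunction.moebius_eq_zero_of_not_squarefree]
    · simp
    · intro hs; exact hc (Nat.coprime_of_squarefree_mul hs)

lemma Cb_bound {Y : ℝ} (hY : 1 < Y) {ε : ℝ} (hε : 0 ≤ ε) (hε2 : ε * Real.log Y ≤ 1) (b : ℕ)
    (hs : Squarefree b) : |Cb Y ε b| ≤ 72 / (Nat.totient b * Real.log Y) := by
  have hb : 0 < b := Nat.pos_of_ne_zero hs.ne_zero
  have hb1 : (1:ℝ) ≤ b := by exact_mod_cast hb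
  have hb0 : (0:ℝ) < b := by linarith
  have hY0 : 0 < Y := by linarith
  have hL : 0 < Real.log Y := Real.log_pos hY
  have hφ : (0:ℝ) < Nat.totient b := by exact_mod_cast Nat.totient_pos.mpr hb
  rw [Cb_eq ε b hb]
  have hf : ∀ z : ℝ, z ≤ Y ^ 2 → ⌊z / b⌋₊ ≤ HY Y / b := by
    intro z hz
    rw [Nat.floor_div_natCast]
    exact Nat.div_le_div_right (Nat.floor_mono hz)
  have hYY : Y ≤ Y ^ 2 := by nlinarith
  have hl : ∀ z : ℝ, 0 < z → z ≤ Y ^ 2 → ε * Real.log (z / b) ≤ 2 := by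
    intro z hz0 hz
    have h1 : Real.log (z / b) ≤ Real.log (Y ^ 2) :=
      Real.log_le_log (by positivity) ((div_le_self hz0.le hb1).trans hz)
    rw [Real.log_pow] at h1
    push_cast at h1
    nlinarith
  have h1 := Smu_bound ε hε b hs (Y ^ 2 / b) (by positivity) (hl _ (by positivity) le_rfl) (HY Y / b) (hf _ le_rfl)
  have h2 := Smu_bound ε hε b hs (Y / b) (by positivity) (hl _ hY0 hYY) (HY Y / b) (hf _ hYY)
  have h3 : |Smu ε b (HY Y / b) (Y ^ 2 / b) - Smu ε b (HY Y / b) (Y / b)| ≤ 72 * (b / Nat.totient b) := by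
    refine (abs_sub _ _).trans ?_
    linarith
  rw [abs_mul, abs_div, abs_mul, abs_of_pos hL]
  have hpp : |(b:ℝ) ^ (-1 - ε)| ≤ 1 / b := by
    rw [abs_of_nonneg (Real.rpow_nonneg hb0.le _), one_div, ← Real.rpow_neg_one]
    exact Real.rpow_le_rpow_of_exponent_le hb1 (by linarith)
  calc _ ≤ 1 * (1 / (b:ℝ)) / Real.log Y * (72 * (b / Nat.totient b)) := by
        gcongr
        exact abs_moebius_real_le b
    _ = _ := by field_simp

end FZ

namespace FZ

noncomputable def fsq : ArithmeticFunction ℝ := ⟨fun n => (n:ℝ) ^ (-(1/2) : ℝ), by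
  simp⟩

lemma fsq_apply (n : ℕ) : fsq n = (n:ℝ) ^ (-(1/2) : ℝ) := rfl

lemma fsq_mult : fsq.IsMultiplicative := by
  refine ⟨by simp [fsq_apply], ?_⟩
  intro m n _
  rw [fsq_apply, fsq_apply, fsq_apply]; push_cast
  rw [Real.mul_rpow (by positivity) (by positivity)]

noncomputable def Gsq : ArithmeticFunction ℝ := fsq * (ArithmeticFunction.zeta : ArithmeticFunction ℝ)

lemma Gsq_mult : Gsq.IsMultiplicative := fsq_mult.mul ArithmeticFunction.isMultiplicative_zeta.natCast

lemma Gsq_prime {p : ℕ} (hp : p.Prime) : Gsq p = 1 + (p:ℝ) ^ (-(1/2) : ℝ) := by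
  rw [Gsq, ArithmeticFunction.coe_mul_zeta_apply, hp.sum_divisors]
  simp [fsq_apply]; ring

lemma Gsq_nonneg (n : ℕ) : 0 ≤ Gsq n := by
  rw [Gsq, ArithmeticFunction.coe_mul_zeta_apply]
  exact Finset.sum_nonneg fun i _ => Real.rpow_nonneg (by positivity) _

lemma Fp_small {p : ℕ} (hp : p.Prime) : (p:ℝ) * (p + 1) / (p - 1) ^ 2 ≤ 6 := by
  have hp2 : (2:ℝ) ≤ p := by exact_mod_cast hp.two_le
  rw [div_le_iff₀ (by nlinarith)]
  nlinarith

lemma Fp_large {p : ℕ} (hp : 16 ≤ p) : (p:ℝ) * (p + 1) / (p - 1) ^ 2 ≤ 1 + (p:ℝ) ^ (-(1/2) : ℝ) := by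
  have hp2 : (16:ℝ) ≤ p := by exact_mod_cast hp
  have h0 : (0:ℝ) ≤ p := by linarith
  rw [Real.rpow_neg h0, ← Real.sqrt_eq_rpow]
  set s := Real.sqrt p with hs
  have hs2 : s ^ 2 = p := Real.sq_sqrt h0
  have hs4 : 4 ≤ s := by
    rw [hs]; apply Real.le_sqrt_of_sq_le; linarith
  rw [← hs2, div_le_iff₀ (by nlinarith)]
  have : 1 + s⁻¹ = (s + 1) / s := by field_simp
  rw [this, div_mul_eq_mul_div, le_div_iff₀ (by linarith)]
  have h1 : 0 ≤ s ^ 2 * ((s - 4) * (s + 1) + 2) := by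
    have : 0 ≤ (s - 4) * (s + 1) := mul_nonneg (by linarith) (by linarith)
    positivity
  nlinarith [h1]

lemma F_le (b : ℕ) : Squarefree b → (b:ℝ) * (ArithmeticFunction.sigma 1 b : ℕ) / (Nat.totient b) ^ 2
    ≤ 6 ^ ((b.primeFactors.filter (fun p => p < 16)).card) * Gsq b := by
  induction b using induction_on_primes with
  | zero => intro h; simp at h
  | one => intro _; rw [Gsq_mult.map_one]; simp
  | prime_mul p b hp ih =>
    intro hs
    have hc : Nat.Coprime p b := Nat.coprime_of_squarefree_mul hs
    have hsb : Squarefree b := hs.squarefree_of_dvd (dvd_mul_left _ _)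
    have hb0 : 0 < b := Nat.pos_of_ne_zero hsb.ne_zero
    have ihb := ih hsb
    have hp2 : (2:ℝ) ≤ p := by exact_mod_cast hp.two_le
    have hφ : (0:ℝ) < Nat.totient b := by exact_mod_cast Nat.totient_pos.mpr hb0
    have hφe : ((Nat.totient (p * b) : ℕ) : ℝ) = (p - 1) * Nat.totient b := by
      rw [Nat.totient_mul hc, Nat.totient_prime hp]; push_cast [hp.one_le]; ring
    have hσ : ((ArithmeticFunction.sigma 1 (p * b) : ℕ) : ℝ) = (p + 1) * (ArithmeticFunction.sigma 1 b : ℕ) := by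
      rw [ArithmeticFunction.isMultiplicative_sigma.map_mul_of_coprime hc]
      have : ArithmeticFunction.sigma 1 p = p + 1 := by
        rw [ArithmeticFunction.sigma_one_apply, hp.sum_divisors]; 
      rw [this]; push_cast; ring
    have e : ((p * b : ℕ) : ℝ) * (ArithmeticFunction.sigma 1 (p * b) : ℕ) / (Nat.totient (p * b)) ^ 2
       = ((p:ℝ) * (p + 1) / (p - 1) ^ 2) * ((b:ℝ) * (ArithmeticFunction.sigma 1 b : ℕ) / (Nat.totient b) ^ 2) := by
      rw [hφe, hσ]; push_cast
      have : (p:ℝ) - 1 ≠ 0 := by linarith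
      field_simp
    have hnot : p ∉ b.primeFactors := by
      intro h
      exact (hp.coprime_iff_not_dvd.mp hc) (Nat.dvd_of_mem_primeFactors h)
    have hpf : (p * b).primeFactors = insert p b.primeFactors := by
      rw [Nat.primeFactors_mul hp.ne_zero hb0.ne', hp.primeFactors]; rfl
    rw [e, hpf, Finset.filter_insert, Gsq_mult.map_mul_of_coprime hc, Gsq_prime hp]
    have hG := Gsq_nonneg b
    have hpr : (0:ℝ) ≤ (p:ℝ) ^ (-(1/2) : ℝ) := Real.rpow_nonneg (by linarith) _
    have hF0 : (0:ℝ) ≤ (b:ℝ) * (ArithmeticFunction.sigma 1 b : ℕ) / (Nat.totient b) ^ 2 := by positivity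
    split_ifs with h16
    · rw [Finset.card_insert_of_notMem (by simp [hnot]), pow_succ (6:ℝ)]
      calc _ ≤ 6 * (6 ^ ((b.primeFactors.filter (fun p => p < 16)).card) * Gsq b) :=
            mul_le_mul (Fp_small hp) ihb hF0 (by norm_num)
        _ = (6 ^ ((b.primeFactors.filter (fun p => p < 16)).card) * 6 * (1 * Gsq b)) := by ring
        _ ≤ _ := by gcongr; linarith
    · calc _ ≤ (1 + (p:ℝ) ^ (-(1/2) : ℝ)) * (6 ^ ((b.primeFactors.filter (fun p => p < 16)).card) * Gsq b) :=
            mul_le_mul (Fp_large (by omega)) ihb hF0 (by linarith)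
        _ = _ := by ring

lemma F_le' (b : ℕ) (hs : Squarefree b) :
    (b:ℝ) * (ArithmeticFunction.sigma 1 b : ℕ) / (Nat.totient b) ^ 2 ≤ 6 ^ 16 * Gsq b := by
  refine (F_le b hs).trans ?_
  have : (b.primeFactors.filter (fun p => p < 16)).card ≤ 16 := by
    calc _ ≤ (Finset.range 16).card := Finset.card_le_card (by
            intro p hp; simp only [Finset.mem_filter] at hp; simp [hp.2])
      _ = 16 := by simp
  have hG := Gsq_nonneg b
  gcongr
  norm_num

noncomputable def f32 : ArithmeticFunction ℝ := ⟨fun n => (n:ℝ) ^ (-(3/2) : ℝ), by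
  simp⟩

lemma f32_apply (n : ℕ) : f32 n = (n:ℝ) ^ (-(3/2) : ℝ) := rfl

lemma sum_sigma_phi : ∃ K : ℝ, 0 < K ∧ ∀ N : ℕ, 1 ≤ N →
    ∑ b ∈ (Finset.Ioc 0 N).filter Squarefree, ((ArithmeticFunction.sigma 1 b : ℕ) : ℝ) / (Nat.totient b) ^ 2
      ≤ K * (1 + Real.log N) := by
  have hsum : Summable (fun n : ℕ => (n:ℝ) ^ (-(3/2) : ℝ)) := Real.summable_nat_rpow.mpr (by norm_num)
  set Z := ∑' n : ℕ, (n:ℝ) ^ (-(3/2) : ℝ) with hZ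
  have hZ0 : 0 ≤ Z := tsum_nonneg fun n => Real.rpow_nonneg (by positivity) _
  refine ⟨6 ^ 16 * (Z + 1), by positivity, fun N hN => ?_⟩
  have hlN : 0 ≤ Real.log N := Real.log_natCast_nonneg N
  have h1 : ∀ b ∈ (Finset.Ioc 0 N).filter Squarefree,
      ((ArithmeticFunction.sigma 1 b : ℕ) : ℝ) / (Nat.totient b) ^ 2 ≤ 6 ^ 16 * (f32 * finv) b := by
    intro b hb
    simp only [Finset.mem_filter, Finset.mem_Ioc] at hb
    have hb0 : (0:ℝ) < b := by exact_mod_cast hb.1.1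
    have e : (f32 * finv) b = Gsq b / b := by
      rw [ArithmeticFunction.mul_apply, Gsq, ArithmeticFunction.coe_mul_zeta_apply,
        ← Nat.sum_divisorsAntidiagonal (fun i _ => fsq i), Finset.sum_div]
      refine Finset.sum_congr rfl fun x hx => ?_
      have hx2 := (Nat.mem_divisorsAntidiagonal.mp hx).1
      have hx1 : (0:ℝ) < x.1 := by
        have : 0 < x.1 := Nat.pos_of_ne_zero (by rintro h0; rw [h0] at hx2; simp at hx2; omega)
        exact_mod_cast this
      have hb' : (b:ℝ) = x.1 * x.2 := by rw [← hx2]; push_cast; ring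
      rw [f32_apply, fsq_apply]
      have : (x.1:ℝ) ^ (-(3/2) : ℝ) = (x.1:ℝ) ^ (-(1/2) : ℝ) / x.1 := by
        rw [show (-(3/2) : ℝ) = -(1/2) - 1 by norm_num, Real.rpow_sub hx1, Real.rpow_one]
      rw [this, hb']
      simp only [finv, ArithmeticFunction.coe_mk]
      rw [div_mul_div_comm, mul_one]
    rw [e, ← mul_div_assoc, le_div_iff₀ hb0]
    have := F_le' b hb.2
    calc _ = (b:ℝ) * (ArithmeticFunction.sigma 1 b : ℕ) / (Nat.totient b) ^ 2 := by ring
      _ ≤ _ := this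
  have hnn : ∀ b, 0 ≤ (f32 * finv) b := by
    intro b; rw [ArithmeticFunction.mul_apply]
    refine Finset.sum_nonneg fun x _ => mul_nonneg (Real.rpow_nonneg (by positivity) _) ?_
    simp only [finv, ArithmeticFunction.coe_mk]; positivity
  calc _ ≤ ∑ b ∈ (Finset.Ioc 0 N).filter Squarefree, 6 ^ 16 * (f32 * finv) b := Finset.sum_le_sum h1
    _ ≤ ∑ b ∈ Finset.Ioc 0 N, 6 ^ 16 * (f32 * finv) b :=
        Finset.sum_le_sum_of_subset_of_nonneg (Finset.filter_subset _ _) fun b _ _ => mul_nonneg (by norm_num) (hnn b)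
    _ = 6 ^ 16 * ∑ d ∈ Finset.Ioc 0 N, f32 d * ∑ m ∈ Finset.Ioc 0 (N / d), finv m := by
        rw [← Finset.mul_sum, ArithmeticFunction.sum_Ioc_mul_eq_sum_sum]
    _ ≤ 6 ^ 16 * ∑ d ∈ Finset.Ioc 0 N, f32 d * (1 + Real.log N) := by
        gcongr with d hd
        · exact Real.rpow_nonneg (by positivity) _
        · have hh : ∑ m ∈ Finset.Ioc 0 N, finv m = ((harmonic N : ℚ) : ℝ) := by
            rw [harmonic_eq_sum_Icc]; push_cast
            refine Finset.sum_congr (by ext; simp; omega) fun m _ => by simp [finv]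
          refine le_trans ?_ (harmonic_le_one_add_log N)
          rw [← hh]
          refine Finset.sum_le_sum_of_subset_of_nonneg (Finset.Ioc_subset_Ioc_right (Nat.div_le_self _ _)) ?_
          intro m _ _
          simp only [finv, ArithmeticFunction.coe_mk]; positivity
    _ = 6 ^ 16 * ((∑ d ∈ Finset.Ioc 0 N, f32 d) * (1 + Real.log N)) := by rw [Finset.sum_mul]
    _ ≤ 6 ^ 16 * ((Z + 1) * (1 + Real.log N)) := by
        gcongr
        have : ∑ d ∈ Finset.Ioc 0 N, f32 d ≤ Z :=
          hsum.sum_le_tsum _ fun d _ => Real.rpow_nonneg (by positivity) _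
        linarith
    _ = _ := by ring

/-- Quadratic form bound. -/
lemma QF_bound : ∃ K : ℝ, 0 < K ∧ ∀ Y : ℝ, Real.exp 1 ≤ Y → ∀ ε : ℝ, 0 ≤ ε → ε * Real.log Y ≤ 1 →
    ∀ (q : ℕ → ℝ) (Kq : ℝ), 0 ≤ Kq → (∀ d : ℕ, 0 < d → d ≤ HY Y → |q d| ≤ Kq * d) →
    |∑ h ∈ Finset.Ioc 0 (HY Y), ∑ k ∈ Finset.Ioc 0 (HY Y),
      lam Y h * lam Y k * (h:ℝ) ^ (-1 - ε) * (k:ℝ) ^ (-1 - ε) * q (Nat.gcd h k)| ≤ K * Kq / Real.log Y := by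
  obtain ⟨K, hK, hK2⟩ := sum_sigma_phi
  refine ⟨72 ^ 2 * (K * 3), by positivity, ?_⟩
  intro Y hYe ε hε hε2 q Kq hKq hq
  have hY : 1 < Y := lt_of_lt_of_le (by simp) hYe
  have hL1 : 1 ≤ Real.log Y := by
    rw [Real.le_log_iff_exp_le (by linarith)]; exact hYe
  set L := Real.log Y with hL
  set qf : ArithmeticFunction ℝ := ⟨fun n => if n = 0 then 0 else q n, by simp⟩ with hqf
  set r : ArithmeticFunction ℝ := qf * (ArithmeticFunction.moebius : ArithmeticFunction ℝ) with hr
  have hrz : r * (ArithmeticFunction.zeta : ArithmeticFunction ℝ) = qf := by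
    rw [hr, mul_assoc, ArithmeticFunction.coe_moebius_mul_coe_zeta, mul_one]
  have hqr : ∀ g : ℕ, 0 < g → q g = ∑ b ∈ g.divisors, r b := by
    intro g hg
    rw [← ArithmeticFunction.coe_mul_zeta_apply, hrz, hqf]
    simp [hg.ne']
  have hrb : ∀ b : ℕ, 0 < b → b ≤ HY Y → |r b| ≤ Kq * (ArithmeticFunction.sigma 1 b : ℕ) := by
    intro b hb hbY
    rw [hr, ArithmeticFunction.mul_apply, ArithmeticFunction.sigma_one_apply,
      ← Nat.sum_divisorsAntidiagonal (fun i _ => i)]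
    push_cast
    rw [Finset.mul_sum]
    refine (Finset.abs_sum_le_sum_abs _ _).trans (Finset.sum_le_sum fun x hx => ?_)
    have hx2 := Nat.mem_divisorsAntidiagonal.mp hx
    have hx1 : 0 < x.1 := Nat.pos_of_ne_zero (by rintro h0; rw [h0] at hx2; simp at hx2; omega)
    have hxb : x.1 ≤ b := Nat.le_of_dvd hb ⟨x.2, hx2.1.symm⟩
    rw [abs_mul]
    have h1 : qf x.1 = q x.1 := by simp [hqf, hx1.ne']
    rw [h1]
    calc _ ≤ Kq * (x.1:ℝ) * 1 := mul_le_mul (hq _ hx1 (hxb.trans hbY))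
            (by rw [ArithmeticFunction.intCoe_apply]; exact abs_moebius_real_le x.2) (abs_nonneg _) (by positivity)
      _ = _ := mul_one _
  have hmain : ∑ h ∈ Finset.Ioc 0 (HY Y), ∑ k ∈ Finset.Ioc 0 (HY Y),
      lam Y h * lam Y k * (h:ℝ) ^ (-1 - ε) * (k:ℝ) ^ (-1 - ε) * q (Nat.gcd h k)
      = ∑ b ∈ Finset.Ioc 0 (HY Y), r b * (Cb Y ε b) ^ 2 := by
    have e1 : ∀ h ∈ Finset.Ioc 0 (HY Y), ∀ k ∈ Finset.Ioc 0 (HY Y),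
        lam Y h * lam Y k * (h:ℝ) ^ (-1 - ε) * (k:ℝ) ^ (-1 - ε) * q (Nat.gcd h k)
        = ∑ b ∈ Finset.Ioc 0 (HY Y), r b * ((if b ∣ h then lam Y h * (h:ℝ) ^ (-1 - ε) else 0) *
          (if b ∣ k then lam Y k * (k:ℝ) ^ (-1 - ε) else 0)) := by
      intro h hh k hk
      obtain ⟨hh1, hh2⟩ := Finset.mem_Ioc.mp hh
      have hg : 0 < Nat.gcd h k := Nat.gcd_pos_of_pos_left _ hh1
      have hd : (Nat.gcd h k).divisors = (Finset.Ioc 0 (HY Y)).filter (fun b => b ∣ h ∧ b ∣ k) := by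
        ext b
        simp only [Nat.mem_divisors, Finset.mem_filter, Finset.mem_Ioc, Nat.dvd_gcd_iff]
        constructor
        · rintro ⟨⟨h1, h2⟩, _⟩
          exact ⟨⟨Nat.pos_of_dvd_of_pos h1 hh1, (Nat.le_of_dvd hh1 h1).trans hh2⟩, h1, h2⟩
        · rintro ⟨_, h1, h2⟩
          exact ⟨⟨h1, h2⟩, hg.ne'⟩
      rw [hqr _ hg, hd, Finset.sum_filter, Finset.mul_sum]
      refine Finset.sum_congr rfl fun b _ => ?_
      by_cases h1 : b ∣ h <;> by_cases h2 : b ∣ k <;> simp [h1, h2]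
      ring
    rw [Finset.sum_congr rfl fun h hh => Finset.sum_congr rfl fun k hk => e1 h hh k hk]
    rw [Finset.sum_congr rfl fun h _ => Finset.sum_comm, Finset.sum_comm]
    refine Finset.sum_congr rfl fun b _ => ?_
    simp_rw [← Finset.mul_sum]
    rw [← Finset.sum_mul, Cb, Finset.sum_filter, sq]
  rw [hmain]
  refine (Finset.abs_sum_le_sum_abs _ _).trans ?_
  have hH1 : 1 ≤ HY Y := Nat.le_floor (by push_cast; nlinarith)
  have hlogH : Real.log (HY Y) ≤ 2 * L := by
    have : (HY Y : ℝ) ≤ Y ^ 2 := Nat.floor_le (by positivity)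
    calc Real.log (HY Y) ≤ Real.log (Y ^ 2) := Real.log_le_log (by exact_mod_cast hH1) this
      _ = 2 * L := by rw [Real.log_pow]; push_cast; ring
  calc _ ≤ ∑ b ∈ Finset.Ioc 0 (HY Y), (if Squarefree b then
          Kq * (72 / L) ^ 2 * (((ArithmeticFunction.sigma 1 b : ℕ) : ℝ) / (Nat.totient b) ^ 2) else 0) := by
        refine Finset.sum_le_sum fun b hb => ?_
        obtain ⟨hb1, hb2⟩ := Finset.mem_Ioc.mp hb
        split_ifs with hs
        · have h1 := Cb_bound hY hε hε2 b hs
          have h2 := hrb b hb1 hb2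
          have hφ : (0:ℝ) < Nat.totient b := by exact_mod_cast Nat.totient_pos.mpr hb1
          rw [abs_mul, abs_pow]
          calc _ ≤ (Kq * (ArithmeticFunction.sigma 1 b : ℕ)) * (72 / (Nat.totient b * L)) ^ 2 := by
                gcongr
            _ = _ := by field_simp
        · rw [Cb_not_sqfree _ _ _ hs]; simp
    _ = Kq * (72 / L) ^ 2 * ∑ b ∈ (Finset.Ioc 0 (HY Y)).filter Squarefree, (((ArithmeticFunction.sigma 1 b : ℕ) : ℝ) / (Nat.totient b) ^ 2) := by
        rw [← Finset.sum_filter, Finset.mul_sum]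
    _ ≤ Kq * (72 / L) ^ 2 * (K * (1 + Real.log (HY Y))) := by
        gcongr; exact hK2 _ hH1
    _ ≤ Kq * (72 / L) ^ 2 * (K * (3 * L)) := by
        gcongr; linarith
    _ = _ := by field_simp

end FZ

namespace FZ

lemma zeta_tele (ε : ℝ) (hε : 0 < ε) (n : ℕ) :
    ((n:ℝ) + 2) ^ (-1 - ε) ≤ (1 / ε) * (((n:ℝ) + 1) ^ (-ε) - ((n:ℝ) + 2) ^ (-ε)) := by
  set x : ℝ := (n:ℝ) + 2 with hx
  have hx2 : 2 ≤ x := by rw [hx]; linarith [Nat.cast_nonneg (α := ℝ) n]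
  have hx0 : 0 < x := by linarith
  have e1 : (n:ℝ) + 1 = x * (1 - 1 / x) := by rw [hx]; field_simp; ring
  have h1x : 0 < 1 - 1 / x := by
    rw [sub_pos, div_lt_one hx0]; linarith
  have h2 : 1 + ε / x ≤ (1 - 1 / x) ^ (-ε) := by
    rw [Real.rpow_def_of_pos h1x]
    have := Real.log_le_sub_one_of_pos h1x
    calc 1 + ε / x ≤ Real.exp (ε / x) := by linarith [Real.add_one_le_exp (ε / x)]
      _ ≤ _ := by
        apply Real.exp_le_exp.mpr
        have : ε / x = ε * (1 / x) := by ring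
        rw [this]; nlinarith
  rw [e1, Real.mul_rpow hx0.le h1x.le, sub_eq_add_neg (-1) ε, Real.rpow_add hx0, Real.rpow_neg_one]
  have h3 : 0 < x ^ (-ε) := Real.rpow_pos_of_pos hx0 _
  rw [one_div_mul_eq_div ε, le_div_iff₀ hε]
  calc x⁻¹ * x ^ (-ε) * ε = x ^ (-ε) * (1 + ε / x) - x ^ (-ε) := by field_simp; ring
    _ ≤ _ := by gcongr

lemma zeta_tail_bound (ε : ℝ) (hε : 0 < ε) :
    ∑' n : ℕ, (n:ℝ) ^ (-1 - ε) ≤ 1 + 1 / ε := by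
  have hnn : ∀ n : ℕ, 0 ≤ (n:ℝ) ^ (-1 - ε) := fun n => Real.rpow_nonneg (by positivity) _
  refine Real.tsum_le_of_sum_range_le hnn fun N => ?_
  have key : ∀ N : ℕ, ∑ n ∈ Finset.range (N + 2), (n:ℝ) ^ (-1 - ε) ≤ 1 + 1 / ε * (1 - ((N:ℝ) + 1) ^ (-ε)) := by
    intro N
    induction N with
    | zero =>
      rw [Finset.sum_range_succ, Finset.sum_range_succ]
      simp
      rw [Real.zero_rpow (by linarith)]
    | succ N ih =>
      rw [show N + 1 + 2 = (N + 2) + 1 by ring, Finset.sum_range_succ]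
      have := zeta_tele ε hε N
      push_cast
      have e : (N:ℝ) + 1 + 1 = N + 2 := by ring
      rw [e]
      nlinarith
  calc _ ≤ ∑ n ∈ Finset.range (N + 2), (n:ℝ) ^ (-1 - ε) :=
        Finset.sum_le_sum_of_subset_of_nonneg (by simp) fun n _ _ => hnn n
    _ ≤ _ := key N
    _ ≤ 1 + 1 / ε * 1 := by
        gcongr
        have := Real.rpow_nonneg (show (0:ℝ) ≤ (N:ℝ) + 1 by positivity) (-ε)
        linarith
    _ = _ := by ring

lemma _root_.HasSum.congr_fun_aux {f g : ℕ → ℝ} {a : ℝ} (h : HasSum f a) (e : g = f) : HasSum g a := e ▸ h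

lemma hasSum_mult (ε : ℝ) (hε : 0 < ε) (l : ℕ) (hl : 0 < l) :
    HasSum (fun n : ℕ => if l ∣ n then (n:ℝ) ^ (-1 - ε) else 0) ((l:ℝ) ^ (-1 - ε) * ∑' n : ℕ, (n:ℝ) ^ (-1 - ε)) := by
  have hs : Summable (fun n : ℕ => (n:ℝ) ^ (-1 - ε)) := Real.summable_nat_rpow.mpr (by linarith)
  have h1 := hs.hasSum.mul_left ((l:ℝ) ^ (-1 - ε))
  have hinj : Function.Injective (fun n : ℕ => l * n) := fun a b h => Nat.eq_of_mul_eq_mul_left hl h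
  rw [← hinj.hasSum_iff]
  · refine HasSum.congr_fun_aux h1 (funext fun n => ?_)
    change (if l ∣ l * n then ((l * n : ℕ):ℝ) ^ (-1 - ε) else 0) = _
    rw [if_pos (dvd_mul_right _ _)]
    push_cast
    rw [Real.mul_rpow (by positivity) (by positivity)]
  · intro n hn
    rw [if_neg]
    rintro ⟨m, rfl⟩
    exact hn ⟨m, rfl⟩

lemma hasSum_an_sq (Y ε : ℝ) (hε : 0 < ε) :
    HasSum (fun n : ℕ => an Y n ^ 2 * (n:ℝ) ^ (-1 - ε))
      (∑ h ∈ Finset.Ioc 0 (HY Y), ∑ k ∈ Finset.Ioc 0 (HY Y),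
        lam Y h * lam Y k * ((Nat.lcm h k : ℝ) ^ (-1 - ε) * ∑' n : ℕ, (n:ℝ) ^ (-1 - ε))) := by
  have h := hasSum_sum (L := SummationFilter.unconditional ℕ) (s := Finset.Ioc 0 (HY Y)) (f := fun h (n : ℕ) => ∑ k ∈ Finset.Ioc 0 (HY Y),
     lam Y h * lam Y k * (if Nat.lcm h k ∣ n then (n:ℝ) ^ (-1 - ε) else 0))
     (a := fun h => ∑ k ∈ Finset.Ioc 0 (HY Y),
        lam Y h * lam Y k * ((Nat.lcm h k : ℝ) ^ (-1 - ε) * ∑' n : ℕ, (n:ℝ) ^ (-1 - ε))) (by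
      intro h hh
      refine hasSum_sum (L := SummationFilter.unconditional ℕ) (f := fun k (n : ℕ) => lam Y h * lam Y k * (if Nat.lcm h k ∣ n then (n:ℝ) ^ (-1 - ε) else 0)) ?_
      intro k hk
      exact (hasSum_mult ε hε (Nat.lcm h k) (Nat.lcm_pos (Finset.mem_Ioc.mp hh).1 (Finset.mem_Ioc.mp hk).1)).mul_left _)
  convert h using 1
  ext n
  rw [an, Finset.sum_filter, sq, Finset.sum_mul_sum, Finset.sum_mul]
  refine Finset.sum_congr rfl fun h _ => ?_
  rw [Finset.sum_mul]
  refine Finset.sum_congr rfl fun k _ => ?_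
  simp only [Nat.lcm_dvd_iff]
  by_cases h1 : h ∣ n <;> by_cases h2 : k ∣ n <;> simp [h1, h2]

lemma sum_an_sq : ∃ K : ℝ, 0 < K ∧ ∀ Y : ℝ, Real.exp 1 ≤ Y → ∀ N : ℕ, (N:ℝ) ≤ Y ^ 25 →
    ∑ n ∈ Finset.Ioc 0 N, an Y n ^ 2 / n ≤ K := by
  obtain ⟨K, hK, hQ⟩ := QF_bound
  refine ⟨Real.exp 25 * (2 * (K * Real.exp 2)), by positivity, ?_⟩
  intro Y hYe N hN
  have hY : 1 < Y := lt_of_lt_of_le (by simp) hYe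
  have hY0 : 0 < Y := by linarith
  have hL1 : 1 ≤ Real.log Y := by
    rw [Real.le_log_iff_exp_le (by linarith)]; exact hYe
  set L := Real.log Y with hL
  have hL0 : 0 < L := by linarith
  set ε := 1 / L with hε
  have hε0 : 0 < ε := by positivity
  have hεL : ε * L = 1 := by rw [hε]; field_simp
  set Z := ∑' n : ℕ, (n:ℝ) ^ (-1 - ε) with hZ
  have hZ0 : 0 ≤ Z := tsum_nonneg fun n => Real.rpow_nonneg (by positivity) _
  have hZb : Z ≤ 2 * L := by
    have := zeta_tail_bound ε hε0
    have e : 1 / ε = L := by rw [hε]; field_simp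
    linarith
  have hs := hasSum_an_sq Y ε hε0
  have hq := hQ Y hYe ε hε0.le hεL.le (fun g => (g:ℝ) ^ (1 + ε)) (Real.exp 2) (by positivity) (by
    intro d hd hd2
    have hd0 : (0:ℝ) < d := by exact_mod_cast hd
    have hdY : (d:ℝ) ≤ Y ^ 2 := (Nat.le_floor_iff (by positivity)).mp hd2
    rw [abs_of_nonneg (Real.rpow_nonneg hd0.le _), Real.rpow_add hd0, Real.rpow_one, mul_comm]
    gcongr
    rw [Real.rpow_def_of_pos hd0]
    apply Real.exp_le_exp.mpr
    have : Real.log d ≤ 2 * L := by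
      calc Real.log d ≤ Real.log (Y ^ 2) := Real.log_le_log hd0 hdY
        _ = 2 * L := by rw [Real.log_pow]; push_cast; ring
    nlinarith)
  have e1 : ∑ h ∈ Finset.Ioc 0 (HY Y), ∑ k ∈ Finset.Ioc 0 (HY Y),
        lam Y h * lam Y k * ((Nat.lcm h k : ℝ) ^ (-1 - ε) * Z) = Z *
      ∑ h ∈ Finset.Ioc 0 (HY Y), ∑ k ∈ Finset.Ioc 0 (HY Y),
      lam Y h * lam Y k * (h:ℝ) ^ (-1 - ε) * (k:ℝ) ^ (-1 - ε) * ((Nat.gcd h k : ℕ) : ℝ) ^ (1 + ε) := by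
    simp_rw [Finset.mul_sum]
    refine Finset.sum_congr rfl fun h hh => Finset.sum_congr rfl fun k hk => ?_
    have hh1 : 0 < h := (Finset.mem_Ioc.mp hh).1
    have hk1 : 0 < k := (Finset.mem_Ioc.mp hk).1
    have hg : (0:ℝ) < (Nat.gcd h k : ℕ) := by exact_mod_cast Nat.gcd_pos_of_pos_left _ hh1
    have hgl : ((Nat.gcd h k : ℕ) : ℝ) * (Nat.lcm h k : ℕ) = h * k := by exact_mod_cast Nat.gcd_mul_lcm h k
    have : (Nat.lcm h k : ℝ) ^ (-1 - ε) = (h:ℝ) ^ (-1 - ε) * (k:ℝ) ^ (-1 - ε) * ((Nat.gcd h k : ℕ) : ℝ) ^ (1 + ε) := by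
      rw [← Real.mul_rpow (by positivity) (by positivity), ← hgl, Real.mul_rpow hg.le (by positivity)]
      have : (1 + ε) = -(-1 - ε) := by ring
      rw [this, Real.rpow_neg hg.le]
      have := (Real.rpow_pos_of_pos hg (-1 - ε)).ne'
      field_simp
    rw [this]; ring
  rw [e1] at hs
  have hsum : ∑ n ∈ Finset.Ioc 0 N, an Y n ^ 2 * (n:ℝ) ^ (-1 - ε) ≤ 2 * (K * Real.exp 2) := by
    refine (sum_le_hasSum _ (fun n _ => mul_nonneg (sq_nonneg _) (Real.rpow_nonneg (by positivity) _)) hs).trans ?_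
    have h1 := (le_abs_self _).trans hq
    calc _ ≤ Z * (K * Real.exp 2 / L) := by gcongr
      _ ≤ 2 * L * (K * Real.exp 2 / L) := by gcongr
      _ = _ := by field_simp
  calc _ ≤ ∑ n ∈ Finset.Ioc 0 N, Real.exp 25 * (an Y n ^ 2 * (n:ℝ) ^ (-1 - ε)) := by
        refine Finset.sum_le_sum fun n hn => ?_
        obtain ⟨h1, h2⟩ := Finset.mem_Ioc.mp hn
        have hn0 : (0:ℝ) < n := by exact_mod_cast h1
        have hnY : (n:ℝ) ≤ Y ^ 25 := le_trans (by exact_mod_cast h2) hN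
        have : 1 / (n:ℝ) ≤ Real.exp 25 * (n:ℝ) ^ (-1 - ε) := by
          rw [sub_eq_add_neg, Real.rpow_add hn0, Real.rpow_neg_one, Real.rpow_def_of_pos hn0, one_div,
            mul_left_comm, ← Real.exp_add]
          have hl : Real.log n ≤ 25 * L := by
            calc Real.log n ≤ Real.log (Y ^ 25) := Real.log_le_log hn0 hnY
              _ = 25 * L := by rw [Real.log_pow]; push_cast; ring
          have : 1 ≤ Real.exp (25 + Real.log n * -ε) := by
            rw [Real.one_le_exp_iff]; nlinarith
          exact le_mul_of_one_le_right (by positivity) this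
        calc an Y n ^ 2 / n = an Y n ^ 2 * (1 / n) := by ring
          _ ≤ an Y n ^ 2 * (Real.exp 25 * (n:ℝ) ^ (-1 - ε)) := by gcongr
          _ = _ := by ring
    _ = Real.exp 25 * ∑ n ∈ Finset.Ioc 0 N, an Y n ^ 2 * (n:ℝ) ^ (-1 - ε) := by rw [Finset.mul_sum]
    _ ≤ _ := by gcongr

end FZ

namespace FZ

lemma fract_sum_periodic_h (h k : ℕ) (hk : 0 < k) :
    Function.Periodic (fun v : ℝ => ∑ j ∈ Finset.range k, Int.fract ((v + j * h) / k)) h := by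
  intro v
  have hk0 : (k:ℝ) ≠ 0 := by exact_mod_cast hk.ne'
  simp only
  have e : ∀ j : ℕ, Int.fract ((v + h + j * h) / k) = Int.fract ((v + ((j + 1 : ℕ):ℝ) * h) / k) := by
    intro j; congr 1; push_cast; ring
  simp_rw [e]
  rw [← add_left_inj (Int.fract ((v + ((0:ℕ):ℝ) * h) / k))]
  rw [← Finset.sum_range_succ' (fun j : ℕ => Int.fract ((v + (j:ℝ) * h) / k)), Finset.sum_range_succ]
  congr 1
  have : (v + (k:ℝ) * h) / k = (v + ((0:ℕ):ℝ) * h) / k + h := by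
    field_simp; push_cast; ring
  rw [this, Int.fract_add_natCast]

lemma fract_sum_periodic_k (h k : ℕ) (hk : 0 < k) :
    Function.Periodic (fun v : ℝ => ∑ j ∈ Finset.range k, Int.fract ((v + j * h) / k)) k := by
  intro v
  have hk0 : (k:ℝ) ≠ 0 := by exact_mod_cast hk.ne'
  simp only
  refine Finset.sum_congr rfl fun j _ => ?_
  have : (v + (k:ℝ) + j * h) / k = (v + j * h) / k + (1:ℕ) := by
    field_simp; push_cast; ring
  rw [this, Int.fract_add_natCast]

lemma fract_sum_periodic_g (h k : ℕ) (hk : 0 < k) :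
    Function.Periodic (fun v : ℝ => ∑ j ∈ Finset.range k, Int.fract ((v + j * h) / k)) (Nat.gcd h k) := by
  have h1 := (fract_sum_periodic_h h k hk).int_mul (Nat.gcdA h k)
  have h2 := (fract_sum_periodic_k h k hk).int_mul (Nat.gcdB h k)
  have h3 := h1.add_period h2
  have e : ((Nat.gcd h k : ℕ):ℝ) = (Nat.gcdA h k : ℝ) * h + (Nat.gcdB h k : ℝ) * k := by
    have := congrArg (Int.cast : ℤ → ℝ) (Nat.gcd_eq_gcd_ab h k)
    push_cast at this
    rw [this]; ring
  rw [e]; exact h3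

lemma fract_sum (h k : ℕ) (hk : 0 < k) (v : ℝ) :
    ∑ j ∈ Finset.range k, Int.fract ((v + j * h) / k) =
      (Nat.gcd h k) * Int.fract (v / (Nat.gcd h k)) +
      ∑ j ∈ Finset.range k, Int.fract (((j * h : ℕ):ℝ) / k) := by
  set g := Nat.gcd h k with hg
  have hk0 : (0:ℝ) < k := by exact_mod_cast hk
  have hg0 : 0 < g := Nat.gcd_pos_of_pos_right _ hk
  have hgr : (0:ℝ) < g := by exact_mod_cast hg0
  have hper := (fract_sum_periodic_g h k hk).sub_int_mul_eq (x := v) ⌊v / g⌋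
  rw [← hper]
  have ev : v - (⌊v / g⌋:ℝ) * g = g * Int.fract (v / g) := by
    rw [Int.fract]; field_simp
  rw [← hg, ev]
  set y := (g:ℝ) * Int.fract (v / g) with hy
  have hy0 : 0 ≤ y := mul_nonneg hgr.le (Int.fract_nonneg _)
  have hyg : y < g := by
    have := Int.fract_lt_one (v / g)
    rw [hy]; nlinarith
  have : ∀ j ∈ Finset.range k, Int.fract ((y + j * h) / k) = y / k + Int.fract (((j * h : ℕ):ℝ) / k) := by
    intro j _
    rw [Int.fract_div_natCast_eq_div_natCast_mod]
    have hmod : (j * h) % k + g ≤ k := by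
      have hd1 : g ∣ (j * h) % k := (Nat.dvd_mod_iff (Nat.gcd_dvd_right h k)).mpr
        ((Nat.gcd_dvd_left h k).mul_left j)
      obtain ⟨a, ha⟩ := hd1
      obtain ⟨c, hc⟩ := Nat.gcd_dvd_right h k
      rw [← hg] at hc
      have hlt := Nat.mod_lt (j * h) hk
      have hac : a < c := by
        by_contra hcon
        push Not at hcon
        have := Nat.mul_le_mul_left g hcon
        omega
      have := Nat.mul_le_mul_left g (Nat.succ_le_of_lt hac)
      rw [Nat.mul_succ] at this
      omega
    have hmodr : (((j * h) % k : ℕ):ℝ) + g ≤ k := by exact_mod_cast hmod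
    rw [Int.fract_eq_iff]
    refine ⟨by positivity, ?_, ((j * h) / k : ℕ), ?_⟩
    · rw [← add_div, div_lt_one hk0]; linarith
    · have hdm : (k:ℝ) * ((j * h) / k : ℕ) + ((j * h) % k : ℕ) = j * h := by exact_mod_cast Nat.div_add_mod (j * h) k
      rw [Int.cast_natCast, ← hdm]
      field_simp; ring
  rw [Finset.sum_congr rfl this, Finset.sum_add_distrib]
  congr 1
  simp
  field_simp

/-- difference of fractional parts -/
noncomputable def xi (w : ℝ) (h : ℕ) (u : ℝ) : ℝ := Int.fract (u / h) - Int.fract ((u - w) / h)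

lemma xi_abs_le (w : ℝ) (h : ℕ) (u : ℝ) : |xi w h u| ≤ 1 := by
  rw [xi, abs_le]
  have h1 := Int.fract_nonneg (u / h)
  have h2 := Int.fract_lt_one (u / h)
  have h3 := Int.fract_nonneg ((u - w) / h)
  have h4 := Int.fract_lt_one ((u - w) / h)
  constructor <;> linarith

lemma xi_meas (w : ℝ) (h : ℕ) : Measurable (xi w h) := by
  unfold xi
  exact ((measurable_id.div_const _).fract).sub (((measurable_id.sub_const _).div_const _).fract)

lemma xi_periodic (w : ℝ) (h : ℕ) : Function.Periodic (xi w h) h := by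
  intro u
  rcases Nat.eq_zero_or_pos h with rfl | hh
  · simp [xi]
  have h0 : (h:ℝ) ≠ 0 := by exact_mod_cast hh.ne'
  rw [xi, xi]
  have e1 : (u + h) / h = u / h + 1 := by field_simp
  have e2 : (u + h - w) / h = (u - w) / h + 1 := by field_simp; ring
  rw [e1, e2, Int.fract_add_one, Int.fract_add_one]

lemma xi_sum (w : ℝ) (h k : ℕ) (hk : 0 < k) (v : ℝ) :
    ∑ j ∈ Finset.range k, xi w k (v + j * h) = (Nat.gcd h k) * xi w (Nat.gcd h k) v := by
  simp only [xi]
  rw [Finset.sum_sub_distrib, fract_sum h k hk v]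
  have : ∀ j : ℕ, (v + j * h - w) / k = ((v - w) + j * h) / k := by intro j; ring
  simp_rw [this]
  rw [fract_sum h k hk (v - w)]
  ring

lemma xi_prod_int (w : ℝ) (h k : ℕ) (a b : ℝ) :
    IntervalIntegrable (fun u => xi w h u * xi w k u) volume a b := by
  refine IntervalIntegrable.mono_fun (f := fun _ => (1:ℝ)) (g := fun u => xi w h u * xi w k u)
    intervalIntegrable_const ?_ ?_
  · exact ((xi_meas w h).mul (xi_meas w k)).aestronglyMeasurable
  · refine Eventually.of_forall fun u => ?_; beta_reduce
    rw [norm_mul, norm_one]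
    exact mul_le_one₀ (xi_abs_le w h u) (norm_nonneg _) (xi_abs_le w k u)

/-- correlation over a full period -/
noncomputable def Icor (w : ℝ) (h k : ℕ) : ℝ := ∫ u in (0:ℝ)..(h * k : ℕ), xi w h u * xi w k u

lemma Icor_eq (w : ℝ) (h k : ℕ) (hk : 0 < k) :
    Icor w h k = ∫ v in (0:ℝ)..h, xi w h v * ((Nat.gcd h k) * xi w (Nat.gcd h k) v) := by
  have h1 : Icor w h k = ∑ j ∈ Finset.range k, ∫ u in ((j * h : ℕ):ℝ)..((j + 1) * h : ℕ), xi w h u * xi w k u := by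
    rw [Icor, intervalIntegral.sum_integral_adjacent_intervals (a := fun j : ℕ => ((j * h : ℕ):ℝ))]
    · simp only [zero_mul, Nat.cast_zero]; rw [mul_comm h k]
    · intro j _; exact xi_prod_int _ _ _ _ _
  have h2 : ∀ j ∈ Finset.range k, ∫ u in ((j * h : ℕ):ℝ)..((j + 1) * h : ℕ), xi w h u * xi w k u
      = ∫ v in (0:ℝ)..h, xi w h v * xi w k (v + j * h) := by
    intro j _
    have := intervalIntegral.integral_comp_add_right (fun u => xi w h u * xi w k u) ((j * h : ℕ):ℝ) (a := 0) (b := h)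
    rw [zero_add] at this
    have e : (h:ℝ) + ((j * h : ℕ):ℝ) = ((j + 1) * h : ℕ) := by push_cast; ring
    rw [e] at this
    rw [← this]
    congr 1; ext v
    have hp := (xi_periodic w h).nat_mul j v
    push_cast
    rw [hp]
  rw [h1, Finset.sum_congr rfl h2, ← intervalIntegral.integral_finsetSum]
  · congr 1; ext v
    rw [← Finset.mul_sum, xi_sum w h k hk]
  · intro j _
    refine IntervalIntegrable.mono_fun (f := fun _ => (1:ℝ)) (g := fun u => xi w h u * xi w k (u + j * h))
      intervalIntegrable_const ?_ ?_
    · exact ((xi_meas w h).mul ((xi_meas w k).comp (measurable_id.add_const _))).aestronglyMeasurable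
    · refine Eventually.of_forall fun u => ?_; beta_reduce
      rw [norm_mul, norm_one]
      exact mul_le_one₀ (xi_abs_le w h u) (norm_nonneg _) (xi_abs_le w k _)

lemma Icor_comm (w : ℝ) (h k : ℕ) : Icor w h k = Icor w k h := by
  rw [Icor, Icor, mul_comm h k]; congr 1; ext u; ring

lemma Icor_gcd' (w : ℝ) (h k : ℕ) (hk : 0 < k) : Icor w h k = Icor w h (Nat.gcd h k) := by
  rw [Icor_eq w h k hk, Icor_eq w h (Nat.gcd h k) (Nat.gcd_pos_of_pos_right _ hk)]
  have : Nat.gcd h (Nat.gcd h k) = Nat.gcd h k := by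
    rw [← Nat.gcd_assoc, Nat.gcd_self]
  rw [this]

lemma Icor_gcd (w : ℝ) (h k : ℕ) (hh : 0 < h) (hk : 0 < k) :
    Icor w h k = Icor w (Nat.gcd h k) (Nat.gcd h k) := by
  rw [Icor_gcd' w h k hk, Icor_comm, Icor_gcd' w _ h hh]
  have : Nat.gcd (Nat.gcd h k) h = Nat.gcd h k := by
    rw [Nat.gcd_comm, ← Nat.gcd_assoc, Nat.gcd_self]
  rw [this]

lemma xi_sq_le (w : ℝ) (hw : 0 ≤ w) (h : ℕ) (hh : 0 < h) (u : ℝ) :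
    |xi w h u| ≤ 2 * (w / h) - xi w h u := by
  have h0 : (0:ℝ) < h := by exact_mod_cast hh
  have e : xi w h u = w / h - ((⌊u / h⌋ : ℝ) - ⌊(u - w) / h⌋) := by
    rw [xi, Int.fract, Int.fract]; ring
  have hn : (0:ℝ) ≤ (⌊u / h⌋ : ℝ) - ⌊(u - w) / h⌋ := by
    have : ⌊(u - w) / h⌋ ≤ ⌊u / h⌋ := Int.floor_mono (by gcongr; linarith)
    have : (⌊(u - w) / h⌋ : ℝ) ≤ ⌊u / h⌋ := by exact_mod_cast this
    linarith
  have hd : 0 ≤ w / h := by positivity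
  rw [abs_le]; constructor <;> linarith

lemma fract_div_int (h : ℕ) (c : ℝ) (a b : ℝ) :
    IntervalIntegrable (fun u => Int.fract ((u - c) / h)) volume a b := by
  refine IntervalIntegrable.mono_fun (f := fun _ => (1:ℝ)) (g := fun u => Int.fract ((u - c) / h))
    intervalIntegrable_const ?_ ?_
  · exact (((measurable_id.sub_const _).div_const _).fract).aestronglyMeasurable
  · refine Eventually.of_forall fun u => ?_; beta_reduce
    rw [norm_one, Real.norm_of_nonneg (Int.fract_nonneg _)]
    exact (Int.fract_lt_one _).le

lemma xi_int (w : ℝ) (h : ℕ) (a b : ℝ) : IntervalIntegrable (xi w h) volume a b := by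
  have := fract_div_int h 0 a b
  simp only [sub_zero] at this
  exact this.sub (fract_div_int h w a b)

/-- The integral of `xi` over any interval is at most `2 * w`. -/
lemma xi_integral_small (w : ℝ) (hw : 0 ≤ w) (h : ℕ) (a b : ℝ) :
    |∫ u in a..b, xi w h u| ≤ 2 * w := by
  have f0 : ∀ a b : ℝ, IntervalIntegrable (fun u => Int.fract (u / h)) volume a b := by
    intro a b
    have := fract_div_int h 0 a b
    simpa only [sub_zero] using this
  have e : ∫ u in a..b, xi w h u = (∫ u in a..b, Int.fract (u / h)) - ∫ u in a..b, Int.fract ((u - w) / h) := by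
    rw [← intervalIntegral.integral_sub (f0 a b) (fract_div_int h w a b)]; rfl
  have e2 := intervalIntegral.integral_comp_sub_right (fun u => Int.fract (u / h)) w (a := a) (b := b)
  rw [e2] at e
  have e3 : (∫ u in a..b, Int.fract (u / h)) - ∫ u in (a - w)..(b - w), Int.fract (u / h)
      = (∫ u in (b-w)..b, Int.fract (u / h)) - ∫ u in (a - w)..a, Int.fract (u / h) := by
    have i1 := intervalIntegral.integral_add_adjacent_intervals (f0 (a - w) a) (f0 a b)
    have i2 := intervalIntegral.integral_add_adjacent_intervals (f0 (a - w) (b - w)) (f0 (b-w) b)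
    linarith
  have bd : ∀ c : ℝ, |∫ u in (c-w)..c, Int.fract (u / (h:ℝ))| ≤ w := by
    intro c
    have := intervalIntegral.norm_integral_le_of_norm_le_const (a := c - w) (b := c) (C := 1)
      (f := fun u => Int.fract (u / (h:ℝ))) (fun u _ => by
        rw [Real.norm_of_nonneg (Int.fract_nonneg _)]
        exact (Int.fract_lt_one _).le)
    rw [Real.norm_eq_abs] at this
    refine this.trans ?_
    rw [one_mul, sub_sub_cancel, abs_of_nonneg hw]
  rw [e, e3]
  refine (abs_sub _ _).trans ?_
  linarith [bd a, bd b]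

lemma Icor_diag_bound (w : ℝ) (hw : 0 ≤ w) (g : ℕ) (hg : 0 < g) : |Icor w g g| ≤ 4 * w * g := by
  have g0 : (1:ℝ) ≤ g := by exact_mod_cast hg
  have hpos : 0 ≤ Icor w g g := by
    rw [Icor]
    apply intervalIntegral.integral_nonneg (by positivity)
    intro u _; exact mul_self_nonneg _
  rw [abs_of_nonneg hpos, Icor]
  calc _ ≤ ∫ u in (0:ℝ)..(g * g : ℕ), (2 * (w / g) - xi w g u) := by
        apply intervalIntegral.integral_mono_on (by positivity) (xi_prod_int _ _ _ _ _)
          (intervalIntegrable_const.sub (xi_int _ _ _ _))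
        intro u _
        refine le_trans ?_ (xi_sq_le w hw g hg u)
        have := xi_abs_le w g u
        rw [← abs_mul_abs_self]
        nlinarith [abs_nonneg (xi w g u)]
    _ = 2 * (w / g) * (g * g : ℕ) - ∫ u in (0:ℝ)..(g * g : ℕ), xi w g u := by
        rw [intervalIntegral.integral_sub intervalIntegrable_const (xi_int _ _ _ _)]
        simp; ring
    _ ≤ 2 * w * g + 2 * w := by
        have := (abs_le.mp (xi_integral_small w hw g 0 (g * g : ℕ))).1
        have e : 2 * (w / g) * ((g * g : ℕ):ℝ) = 2 * w * g := by push_cast; field_simp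
        rw [e]; linarith
    _ ≤ _ := by nlinarith

/-- A bounded periodic function integrates over an interval like its mean. -/
lemma periodic_mean {f : ℝ → ℝ} {P : ℝ} (hP : 0 < P) (hf : Function.Periodic f P)
    (hfi : ∀ a b, IntervalIntegrable f volume a b) (hb : ∀ u, |f u| ≤ 1) (V D : ℝ) (hD : 0 ≤ D) :
    |(∫ u in V..(V + D), f u) - D / P * ∫ u in (0:ℝ)..P, f u| ≤ 2 * P := by
  set n := ⌊D / P⌋₊ with hn
  have hn1 : (n:ℝ) ≤ D / P := Nat.floor_le (by positivity)
  have hn2 : D / P < n + 1 := Nat.lt_floor_add_one _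
  have hDP : D = D / P * P := by field_simp
  have h1 : ∫ u in V..(V + n * P), f u = n * ∫ u in (0:ℝ)..P, f u := by
    have := hf.intervalIntegral_add_zsmul_eq n V (fun _ _ => hfi _ _)
    simp only [zsmul_eq_mul, Int.cast_natCast] at this
    rw [this, hf.intervalIntegral_add_eq V 0, zero_add]
  have h2 := intervalIntegral.integral_add_adjacent_intervals (hfi V (V + n * P)) (hfi (V + n * P) (V + D))
  have h3 : |∫ u in (V + n * P)..(V + D), f u| ≤ P := by
    have := intervalIntegral.norm_integral_le_of_norm_le_const (a := V + n * P) (b := V + D) (C := 1)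
      (f := f) (fun u _ => hb u)
    rw [Real.norm_eq_abs] at this
    refine this.trans ?_
    rw [one_mul, abs_le]
    constructor <;> nlinarith
  have h4 : |∫ u in (0:ℝ)..P, f u| ≤ P := by
    have := intervalIntegral.norm_integral_le_of_norm_le_const (a := 0) (b := P) (C := 1)
      (f := f) (fun u _ => hb u)
    rw [Real.norm_eq_abs] at this
    refine this.trans ?_
    rw [one_mul, sub_zero, abs_of_pos hP]
  have e : (∫ u in V..(V + D), f u) - D / P * ∫ u in (0:ℝ)..P, f u
      = (∫ u in (V + n * P)..(V + D), f u) - (D / P - n) * ∫ u in (0:ℝ)..P, f u := by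
    rw [← h2, h1]; ring
  rw [e]
  refine (abs_sub _ _).trans ?_
  rw [abs_mul, abs_of_nonneg (by linarith : 0 ≤ D / P - n)]
  have : (D / P - n) * |∫ u in (0:ℝ)..P, f u| ≤ 1 * P := by
    gcongr; linarith
  linarith

end FZ

namespace FZ

lemma intInt_of_bdd {f : ℝ → ℝ} (hf : Measurable f) (C : ℝ) (hb : ∀ u, |f u| ≤ C) (a b : ℝ) :
    IntervalIntegrable f volume a b := by
  refine IntervalIntegrable.mono_fun (f := fun _ => C) (g := f)
    intervalIntegrable_const hf.aestronglyMeasurable ?_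
  refine Eventually.of_forall fun u => ?_
  exact (hb u).trans (le_abs_self C)

lemma intInt_fun_sum {ι : Type*} (s : Finset ι) {f : ι → ℝ → ℝ} {a b : ℝ}
    (hf : ∀ i ∈ s, IntervalIntegrable (f i) volume a b) :
    IntervalIntegrable (fun x => ∑ i ∈ s, f i x) volume a b := by
  have h := IntervalIntegrable.sum s hf
  have e : (∑ i ∈ s, f i) = fun x => ∑ i ∈ s, f i x := by ext x; simp
  rwa [← e]

lemma HY_le {Y : ℝ} : (HY Y : ℝ) ≤ Y ^ 2 := Nat.floor_le (by positivity)

lemma lin_bdd {Y : ℝ} (hY : 1 < Y) (f : ℕ → ℝ → ℝ) (hb : ∀ h u, |f h u| ≤ 1) (u : ℝ) :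
    |∑ h ∈ Finset.Ioc 0 (HY Y), lam Y h * f h u| ≤ Y ^ 2 := by
  refine (Finset.abs_sum_le_sum_abs _ _).trans ?_
  calc _ ≤ ∑ h ∈ Finset.Ioc 0 (HY Y), (1:ℝ) := Finset.sum_le_sum fun h hh => by
          rw [abs_mul]
          exact mul_le_one₀ (abs_lam_le hY (Finset.mem_Ioc.mp hh).1) (abs_nonneg _) (hb h u)
    _ = (HY Y : ℝ) := by simp
    _ ≤ _ := HY_le

lemma dJ_bound : ∃ K : ℝ, 0 < K ∧ ∀ Y : ℝ, Real.exp 1 ≤ Y → ∀ w V D : ℝ, 0 ≤ w → 0 ≤ D →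
    ∫ u in V..(V + D), (∑ h ∈ Finset.Ioc 0 (HY Y), lam Y h * xi w h u) ^ 2 ≤ D * (K * w / Real.log Y) + 2 * Y ^ 8 := by
  obtain ⟨K, hK, hQ⟩ := QF_bound
  refine ⟨K * 4, by positivity, ?_⟩
  intro Y hYe w V D hw hD
  have hY : 1 < Y := lt_of_lt_of_le (by simp) hYe
  have e1 : ∀ u, (∑ h ∈ Finset.Ioc 0 (HY Y), lam Y h * xi w h u) ^ 2 =
      ∑ h ∈ Finset.Ioc 0 (HY Y), ∑ k ∈ Finset.Ioc 0 (HY Y), lam Y h * lam Y k * (xi w h u * xi w k u) := by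
    intro u
    rw [sq, Finset.sum_mul_sum]
    refine Finset.sum_congr rfl fun h _ => Finset.sum_congr rfl fun k _ => by ring
  simp_rw [e1]
  rw [intervalIntegral.integral_finsetSum]
  swap
  · intro h _
    exact intInt_fun_sum _ fun k _ => (xi_prod_int w h k _ _).const_mul _
  have e2 : ∀ h ∈ Finset.Ioc 0 (HY Y), ∫ u in V..(V + D), ∑ k ∈ Finset.Ioc 0 (HY Y), lam Y h * lam Y k * (xi w h u * xi w k u)
      = ∑ k ∈ Finset.Ioc 0 (HY Y), lam Y h * lam Y k * ∫ u in V..(V + D), (xi w h u * xi w k u) := by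
    intro h _
    rw [intervalIntegral.integral_finsetSum]
    · simp_rw [intervalIntegral.integral_const_mul]
    · intro k _; exact (xi_prod_int w h k _ _).const_mul _
  rw [Finset.sum_congr rfl e2]
  have hq := hQ Y hYe 0 le_rfl (by simp) (fun g => Icor w g g) (4 * w) (by positivity) (by
    intro d hd _; exact Icor_diag_bound w hw d hd)
  have hq2 := (le_abs_self _).trans hq
  have e3 : ∀ h ∈ Finset.Ioc 0 (HY Y), ∀ k ∈ Finset.Ioc 0 (HY Y),
      lam Y h * lam Y k * ∫ u in V..(V + D), (xi w h u * xi w k u)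
      ≤ D * (lam Y h * lam Y k * (h:ℝ) ^ (-1 - (0:ℝ)) * (k:ℝ) ^ (-1 - (0:ℝ)) * Icor w (Nat.gcd h k) (Nat.gcd h k)) + 2 * Y ^ 4 := by
    intro h hh k hk
    obtain ⟨hh1, hh2⟩ := Finset.mem_Ioc.mp hh
    obtain ⟨hk1, hk2⟩ := Finset.mem_Ioc.mp hk
    have hh0 : (0:ℝ) < h := by exact_mod_cast hh1
    have hk0 : (0:ℝ) < k := by exact_mod_cast hk1
    have hhY : (h:ℝ) ≤ Y ^ 2 := le_trans (by exact_mod_cast hh2) HY_le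
    have hkY : (k:ℝ) ≤ Y ^ 2 := le_trans (by exact_mod_cast hk2) HY_le
    have hper : Function.Periodic (fun u => xi w h u * xi w k u) ((h * k : ℕ) : ℝ) := by
      have p1 := (xi_periodic w h).nat_mul k
      have p2 := (xi_periodic w k).nat_mul h
      intro u
      have q1 := p1 u
      have q2 := p2 u
      push_cast
      rw [mul_comm (k:ℝ)] at q1
      simp only [q1, q2]
    have hm := periodic_mean (P := ((h * k : ℕ) : ℝ)) (by push_cast; positivity) hper (fun a b => xi_prod_int w h k a b) (fun u => by
      rw [abs_mul]; exact mul_le_one₀ (xi_abs_le w h u) (abs_nonneg _) (xi_abs_le w k u)) V D hD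
    rw [← Icor, Icor_gcd w h k hh1 hk1] at hm
    set J := ∫ u in V..(V + D), (xi w h u * xi w k u)
    set I := Icor w (Nat.gcd h k) (Nat.gcd h k)
    have hll : |lam Y h * lam Y k| ≤ 1 := by
      rw [abs_mul]; exact mul_le_one₀ (abs_lam_le hY hh1) (abs_nonneg _) (abs_lam_le hY hk1)
    have hb : lam Y h * lam Y k * (J - D / ((h * k : ℕ) : ℝ) * I) ≤ 2 * Y ^ 4 := by
      refine (le_abs_self _).trans ?_
      rw [abs_mul]
      calc _ ≤ 1 * (2 * ((h * k : ℕ) : ℝ)) := mul_le_mul hll hm (abs_nonneg _) zero_le_one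
        _ ≤ 1 * (2 * (Y ^ 2 * Y ^ 2)) := by push_cast; gcongr
        _ = _ := by ring
    have e4 : D * (lam Y h * lam Y k * (h:ℝ) ^ (-1 - (0:ℝ)) * (k:ℝ) ^ (-1 - (0:ℝ)) * I)
       = lam Y h * lam Y k * (D / ((h * k : ℕ) : ℝ) * I) := by
      rw [sub_zero, Real.rpow_neg_one, Real.rpow_neg_one]; push_cast
      field_simp
    rw [e4]; linarith
  calc _ ≤ ∑ h ∈ Finset.Ioc 0 (HY Y), ∑ k ∈ Finset.Ioc 0 (HY Y), (D * (lam Y h * lam Y k * (h:ℝ) ^ (-1 - (0:ℝ)) * (k:ℝ) ^ (-1 - (0:ℝ)) * Icor w (Nat.gcd h k) (Nat.gcd h k)) + 2 * Y ^ 4) :=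
        Finset.sum_le_sum fun h hh => Finset.sum_le_sum fun k hk => e3 h hh k hk
    _ = D * (∑ h ∈ Finset.Ioc 0 (HY Y), ∑ k ∈ Finset.Ioc 0 (HY Y), (lam Y h * lam Y k * (h:ℝ) ^ (-1 - (0:ℝ)) * (k:ℝ) ^ (-1 - (0:ℝ)) * Icor w (Nat.gcd h k) (Nat.gcd h k)))
        + (HY Y) * ((HY Y) * (2 * Y ^ 4)) := by
        simp_rw [Finset.sum_add_distrib, Finset.mul_sum]
        simp
    _ ≤ D * (K * (4 * w) / Real.log Y) + Y ^ 2 * (Y ^ 2 * (2 * Y ^ 4)) := by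
        have := HY_le (Y := Y)
        gcongr
    _ = _ := by ring

/-- error from a dilation instead of a shift -/
lemma rJ_bound {Y : ℝ} (hY : 1 < Y) (V D τ : ℝ) (hD : 1 ≤ D) (hτ : 0 ≤ τ) :
    ∫ u in V..(V + D), (∑ h ∈ Finset.Ioc 0 (HY Y), lam Y h *
      (Int.fract (u * Real.exp (-τ) / h) - Int.fract ((u - V * (1 - Real.exp (-τ))) / h))) ^ 2 ≤ 4 * Y ^ 4 * D ^ 2 * τ := by
  set s := 1 - Real.exp (-τ) with hs
  have hs0 : 0 ≤ s := by
    have : Real.exp (-τ) ≤ 1 := Real.exp_le_one_iff.mpr (by linarith)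
    linarith
  have hsτ : s ≤ τ := by
    have := Real.add_one_le_exp (-τ); linarith
  set f : ℕ → ℝ → ℝ := fun h u => Int.fract (u * Real.exp (-τ) / h) - Int.fract ((u - V * s) / h) with hf
  have hfm : ∀ h, Measurable (f h) := fun h =>
    (((measurable_id.mul_const _).div_const _).fract).sub (((measurable_id.sub_const _).div_const _).fract)
  have hfb : ∀ h u, |f h u| ≤ 1 := by
    intro h u
    simp only [hf]
    rw [abs_le]
    have h1 := Int.fract_nonneg (u * Real.exp (-τ) / h)
    have h2 := Int.fract_lt_one (u * Real.exp (-τ) / h)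
    have h3 := Int.fract_nonneg ((u - V * s) / h)
    have h4 := Int.fract_lt_one ((u - V * s) / h)
    constructor <;> linarith
  set η := D * s with hη
  have hη0 : 0 ≤ η := by positivity
  have hpt : ∀ h ∈ Finset.Ioc 0 (HY Y), ∀ u ∈ Set.Icc V (V + D),
      f h u ^ 2 ≤ 2 * (η / h) - xi η h (u - V * s) := by
    intro h hh u hu
    have hh0 : (0:ℝ) < h := by exact_mod_cast (Finset.mem_Ioc.mp hh).1
    have h1 : f h u ^ 2 ≤ |f h u| := by
      rw [← sq_abs]; nlinarith [hfb h u, abs_nonneg (f h u)]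
    refine h1.trans ?_
    have eb : u * Real.exp (-τ) / h = (u - V * s) / h - (u - V) * s / h := by
      rw [← sub_div, hs]; ring
    have hfl : (⌊(u - V * s - η) / h⌋ : ℝ) ≤ ⌊u * Real.exp (-τ) / h⌋ := by
      have : ⌊(u - V * s - η) / h⌋ ≤ ⌊u * Real.exp (-τ) / h⌋ := by
        apply Int.floor_mono
        rw [eb, ← sub_div]
        gcongr
        rw [hη]; nlinarith [hu.1, hu.2]
      exact_mod_cast this
    have hfl2 : (⌊u * Real.exp (-τ) / h⌋ : ℝ) ≤ ⌊(u - V * s) / h⌋ := by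
      have : ⌊u * Real.exp (-τ) / h⌋ ≤ ⌊(u - V * s) / h⌋ := by
        apply Int.floor_mono
        rw [eb]
        have : 0 ≤ (u - V) * s / h := div_nonneg (mul_nonneg (by linarith [hu.1]) hs0) hh0.le
        linarith
      exact_mod_cast this
    have e2 : f h u = -((u - V) * s / h) + ((⌊(u - V * s) / h⌋ : ℝ) - ⌊u * Real.exp (-τ) / h⌋) := by
      simp only [hf, Int.fract]; rw [eb]; ring
    have e3 : xi η h (u - V * s) = η / h - ((⌊(u - V * s) / h⌋ : ℝ) - ⌊(u - V * s - η) / h⌋) := by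
      rw [xi, Int.fract, Int.fract]; ring
    have h5 : 0 ≤ (u - V) * s / h := div_nonneg (mul_nonneg (by linarith [hu.1]) hs0) hh0.le
    have h6 : (u - V) * s / h ≤ η / h := by
      rw [hη]; gcongr; linarith [hu.2]
    rw [e3, e2, abs_le]
    constructor <;> linarith
  have hle : ∀ h ∈ Finset.Ioc 0 (HY Y), ∫ u in V..(V + D), f h u ^ 2 ≤ 4 * D * η := by
    intro h hh
    have hh1 : (1:ℝ) ≤ h := by exact_mod_cast (Finset.mem_Ioc.mp hh).1
    have hxi : IntervalIntegrable (fun u => xi η h (u - V * s)) volume V (V + D) :=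
      intInt_of_bdd ((xi_meas η h).comp (measurable_id.sub_const _)) 1 (fun u => xi_abs_le _ _ _) _ _
    calc _ ≤ ∫ u in V..(V + D), (2 * (η / h) - xi η h (u - V * s)) := by
          apply intervalIntegral.integral_mono_on (by linarith) _ (intervalIntegrable_const.sub hxi) (hpt h hh)
          exact intInt_of_bdd ((hfm h).pow_const 2) 1 (fun u => by
            rw [abs_pow]; exact pow_le_one₀ (abs_nonneg _) (hfb h u)) _ _
      _ = D * (2 * (η / h)) - ∫ u in V..(V + D), xi η h (u - V * s) := by
          rw [intervalIntegral.integral_sub intervalIntegrable_const hxi]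
          simp
          ring
      _ = D * (2 * (η / h)) - ∫ u in (V - V * s)..(V + D - V * s), xi η h u := by
          rw [intervalIntegral.integral_comp_sub_right (fun u => xi η h u)]
      _ ≤ D * (2 * (η / 1)) + 2 * η := by
          have := (abs_le.mp (xi_integral_small η hη0 h (V - V * s) (V + D - V * s))).1
          have h7 : D * (2 * (η / h)) ≤ D * (2 * (η / 1)) := by gcongr
          linarith
      _ ≤ _ := by nlinarith
  calc _ ≤ ∫ u in V..(V + D), ∑ h ∈ Finset.Ioc 0 (HY Y), (HY Y) * f h u ^ 2 := by
        apply intervalIntegral.integral_mono_on (by linarith)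
        · refine intInt_of_bdd (Measurable.pow_const (Finset.measurable_fun_sum _ fun h _ => (hfm h).const_mul _) 2) ((Y^2)^2) (fun u => ?_) _ _
          rw [abs_pow]
          have := lin_bdd hY f hfb u
          gcongr
        · refine intInt_fun_sum _ fun h _ => IntervalIntegrable.const_mul ?_ _
          exact intInt_of_bdd ((hfm h).pow_const 2) 1 (fun u => by
            rw [abs_pow]; exact pow_le_one₀ (abs_nonneg _) (hfb h u)) _ _
        · intro u _
          have := sq_sum_le_card_mul_sum_sq (s := Finset.Ioc 0 (HY Y)) (f := fun h => lam Y h * f h u)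
          refine this.trans ?_
          rw [Nat.card_Ioc, Nat.sub_zero, Finset.mul_sum]
          refine Finset.sum_le_sum fun h hh => ?_
          gcongr ?_ * ?_
          rw [mul_pow]
          have h1 := abs_lam_le hY (Finset.mem_Ioc.mp hh).1
          have : lam Y h ^ 2 ≤ 1 := by rw [← sq_abs]; exact pow_le_one₀ (abs_nonneg _) h1
          exact mul_le_of_le_one_left (sq_nonneg _) this
    _ = ∑ h ∈ Finset.Ioc 0 (HY Y), (HY Y) * ∫ u in V..(V + D), f h u ^ 2 := by
        rw [intervalIntegral.integral_finsetSum]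
        · simp_rw [intervalIntegral.integral_const_mul]
        · intro h _
          refine IntervalIntegrable.const_mul ?_ _
          exact intInt_of_bdd ((hfm h).pow_const 2) 1 (fun u => by
            rw [abs_pow]; exact pow_le_one₀ (abs_nonneg _) (hfb h u)) _ _
    _ ≤ ∑ h ∈ Finset.Ioc 0 (HY Y), (HY Y) * (4 * D * η) := by
        refine Finset.sum_le_sum fun h hh => ?_
        gcongr
        exact hle h hh
    _ = (HY Y) * ((HY Y) * (4 * D * η)) := by simp
    _ ≤ Y ^ 2 * (Y ^ 2 * (4 * D * (D * τ))) := by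
        have := HY_le (Y := Y)
        rw [hη]
        gcongr
    _ = _ := by ring

/-- the remainder function -/
noncomputable def dfun (Y τ u : ℝ) : ℝ :=
  -∑ h ∈ Finset.Ioc 0 (HY Y), lam Y h * (Int.fract (u / h) - Int.fract (u * Real.exp (-τ) / h))

lemma fract_diff_abs (a b : ℝ) : |Int.fract a - Int.fract b| ≤ 1 := by
  rw [abs_le]
  have h1 := Int.fract_nonneg a
  have h2 := Int.fract_lt_one a
  have h3 := Int.fract_nonneg b
  have h4 := Int.fract_lt_one b
  constructor <;> linarith

lemma dfun_abs_le {Y : ℝ} (hY : 1 < Y) (τ u : ℝ) : |dfun Y τ u| ≤ Y ^ 2 := by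
  rw [dfun, abs_neg]
  exact lin_bdd hY (fun h u => Int.fract (u / h) - Int.fract (u * Real.exp (-τ) / h)) (fun h u => fract_diff_abs _ _) u

lemma dfun_meas (Y τ : ℝ) : Measurable (dfun Y τ) := by
  unfold dfun
  refine Measurable.neg (Finset.measurable_fun_sum _ fun h _ => Measurable.const_mul ?_ _)
  exact ((measurable_id.div_const _).fract).sub (((measurable_id.mul_const _).div_const _).fract)

lemma dfun_sq_int {Y : ℝ} (hY : 1 < Y) (τ a b : ℝ) : IntervalIntegrable (fun u => dfun Y τ u ^ 2) volume a b :=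
  intInt_of_bdd ((dfun_meas Y τ).pow_const 2) ((Y^2)^2) (fun u => by
    rw [abs_pow]; have := dfun_abs_le hY τ u; gcongr) _ _

lemma log_le_self' {Y : ℝ} (hY : 0 < Y) : Real.log Y ≤ Y := by
  have := Real.log_le_sub_one_of_pos hY; linarith

lemma d_local : ∃ K : ℝ, 0 < K ∧ ∀ Y : ℝ, Real.exp 1 ≤ Y → ∀ V : ℝ, Y ^ 24 ≤ V →
    ∫ u in V..(V + Y ^ 18), dfun Y (1 / Y ^ 32) u ^ 2 ≤ K * (Y ^ 18 * (1 / Y ^ 32) * V / Real.log Y) := by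
  obtain ⟨K, hK, hJ⟩ := dJ_bound
  refine ⟨2 * K + 12, by positivity, ?_⟩
  intro Y hYe V hV
  have hY : 1 < Y := lt_of_lt_of_le (by simp) hYe
  have hY0 : 0 < Y := by linarith
  have hL1 : 1 ≤ Real.log Y := by
    rw [Real.le_log_iff_exp_le (by linarith)]; exact hYe
  have hLY := log_le_self' hY0
  set L := Real.log Y with hL
  set τ := 1 / Y ^ 32 with hτ
  have hτ0 : 0 < τ := by positivity
  set s := 1 - Real.exp (-τ) with hs
  have hs0 : 0 ≤ s := by
    have : Real.exp (-τ) ≤ 1 := Real.exp_le_one_iff.mpr (by linarith)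
    linarith
  have hsτ : s ≤ τ := by
    have := Real.add_one_le_exp (-τ); linarith
  have hV0 : 0 < V := lt_of_lt_of_le (by positivity) hV
  have hD1 : 1 ≤ Y ^ 18 := one_le_pow₀ hY.le
  have h1 := hJ Y hYe (V * s) V (Y ^ 18) (by positivity) (by positivity)
  have h2 := rJ_bound hY V (Y ^ 18) τ hD1 hτ0.le
  rw [← hs] at h2
  have hmeas1 : Measurable (fun u => ∑ h ∈ Finset.Ioc 0 (HY Y), lam Y h * xi (V * s) h u) :=
    Finset.measurable_fun_sum _ fun h _ => (xi_meas _ h).const_mul _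
  have hmeas2 : Measurable (fun u => ∑ h ∈ Finset.Ioc 0 (HY Y), lam Y h *
      (Int.fract (u * Real.exp (-τ) / h) - Int.fract ((u - V * s) / h))) :=
    Finset.measurable_fun_sum _ fun h _ => Measurable.const_mul
     ((((measurable_id.mul_const _).div_const _).fract).sub (((measurable_id.sub_const _).div_const _).fract)) _
  have i1 : IntervalIntegrable (fun u => (∑ h ∈ Finset.Ioc 0 (HY Y), lam Y h * xi (V * s) h u) ^ 2) volume V (V + Y ^ 18) :=
    intInt_of_bdd (hmeas1.pow_const 2) ((Y^2)^2) (fun u => by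
      rw [abs_pow]; have := lin_bdd hY (fun h u => xi (V * s) h u) (fun h u => xi_abs_le _ _ _) u; gcongr) _ _
  have i2 : IntervalIntegrable (fun u => (∑ h ∈ Finset.Ioc 0 (HY Y), lam Y h *
      (Int.fract (u * Real.exp (-τ) / h) - Int.fract ((u - V * s) / h))) ^ 2) volume V (V + Y ^ 18) :=
    intInt_of_bdd (hmeas2.pow_const 2) ((Y^2)^2) (fun u => by
      rw [abs_pow]
      have := lin_bdd hY (fun h u => (Int.fract (u * Real.exp (-τ) / h) - Int.fract ((u - V * s) / h))) (fun h u => fract_diff_abs _ _) u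
      gcongr) _ _
  have hmain : ∫ u in V..(V + Y ^ 18), dfun Y τ u ^ 2 ≤ 2 * (Y ^ 18 * (K * (V * s) / L) + 2 * Y ^ 8) + 2 * (4 * Y ^ 4 * (Y ^ 18) ^ 2 * τ) := by
    calc _ ≤ ∫ u in V..(V + Y ^ 18), (2 * (∑ h ∈ Finset.Ioc 0 (HY Y), lam Y h * xi (V * s) h u) ^ 2 +
            2 * (∑ h ∈ Finset.Ioc 0 (HY Y), lam Y h *
      (Int.fract (u * Real.exp (-τ) / h) - Int.fract ((u - V * s) / h))) ^ 2) := by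
          apply intervalIntegral.integral_mono_on (by linarith) (dfun_sq_int hY _ _ _) ((i1.const_mul 2).add (i2.const_mul 2))
          intro u _
          have e : dfun Y τ u = -(∑ h ∈ Finset.Ioc 0 (HY Y), lam Y h * xi (V * s) h u) + (∑ h ∈ Finset.Ioc 0 (HY Y), lam Y h *
            (Int.fract (u * Real.exp (-τ) / h) - Int.fract ((u - V * s) / h))) := by
            rw [dfun, ← Finset.sum_neg_distrib, ← Finset.sum_neg_distrib, ← Finset.sum_add_distrib]
            refine Finset.sum_congr rfl fun h _ => ?_
            rw [xi]; ring
          rw [e]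
          nlinarith [sq_nonneg ((∑ h ∈ Finset.Ioc 0 (HY Y), lam Y h * xi (V * s) h u) + (∑ h ∈ Finset.Ioc 0 (HY Y), lam Y h *
            (Int.fract (u * Real.exp (-τ) / h) - Int.fract ((u - V * s) / h))))]
      _ ≤ _ := by
          rw [intervalIntegral.integral_add (i1.const_mul 2) (i2.const_mul 2), intervalIntegral.integral_const_mul,
            intervalIntegral.integral_const_mul]
          linarith
  refine hmain.trans ?_
  have hVL : Y ^ 22 ≤ V / L := by
    rw [le_div_iff₀ (by linarith)]
    calc Y ^ 22 * L ≤ Y ^ 22 * Y := by gcongr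
      _ = Y ^ 23 := by ring
      _ ≤ Y ^ 24 := pow_le_pow_right₀ hY.le (by norm_num)
      _ ≤ V := hV
  have t1 : Y ^ 18 * (K * (V * s) / L) ≤ K * (Y ^ 18 * τ * V / L) := by
    calc _ = K * (Y ^ 18 * s * V / L) := by ring
      _ ≤ _ := by gcongr
  have t2 : Y ^ 8 ≤ Y ^ 18 * τ * V / L := by
    calc Y ^ 8 = Y ^ 18 * τ * Y ^ 22 := by rw [hτ]; field_simp
      _ ≤ Y ^ 18 * τ * (V / L) := by gcongr
      _ = _ := by ring
  have t3 : Y ^ 4 * (Y ^ 18) ^ 2 * τ ≤ Y ^ 18 * τ * V / L := by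
    calc Y ^ 4 * (Y ^ 18) ^ 2 * τ = Y ^ 18 * τ * Y ^ 22 := by ring
      _ ≤ Y ^ 18 * τ * (V / L) := by gcongr
      _ = _ := by ring
  linarith

lemma d_dyadic : ∃ K : ℝ, 0 < K ∧ ∀ Y : ℝ, Real.exp 1 ≤ Y → ∀ X : ℝ, Y ^ 24 ≤ X →
    ∫ u in X..(2 * X), dfun Y (1 / Y ^ 32) u ^ 2 ≤ K * ((1 / Y ^ 32) * X ^ 2 / Real.log Y) := by
  obtain ⟨K, hK, hJ⟩ := d_local
  refine ⟨6 * K, by positivity, ?_⟩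
  intro Y hYe X hX
  have hY : 1 < Y := lt_of_lt_of_le (by simp) hYe
  have hY0 : 0 < Y := by linarith
  have hL1 : 1 ≤ Real.log Y := by
    rw [Real.le_log_iff_exp_le (by linarith)]; exact hYe
  have hX0 : 0 < X := lt_of_lt_of_le (by positivity) hX
  set D := Y ^ 18 with hD
  have hD0 : 0 < D := by positivity
  have hDX : D ≤ X := le_trans (pow_le_pow_right₀ hY.le (by norm_num)) hX
  set τ := 1 / Y ^ 32 with hτ
  have hτ0 : 0 < τ := by positivity
  set n := ⌈X / D⌉₊ with hn
  have hn1 : X / D ≤ n := Nat.le_ceil _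
  have hn2 : (n:ℝ) < X / D + 1 := Nat.ceil_lt_add_one (by positivity)
  rw [div_le_iff₀ hD0] at hn1
  have hn3 : n * D ≤ 2 * X := by
    have : (n:ℝ) * D ≤ (X / D + 1) * D := by gcongr
    have e : (X / D + 1) * D = X + D := by field_simp
    linarith
  have hintg : ∀ a b, IntervalIntegrable (fun u => dfun Y τ u ^ 2) volume a b := dfun_sq_int hY τ
  calc _ ≤ ∫ u in X..(X + n * D), dfun Y τ u ^ 2 := by
        apply intervalIntegral.integral_mono_interval le_rfl (by linarith) (by linarith)
        · exact Eventually.of_forall fun u => sq_nonneg _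
        · exact hintg _ _
    _ = ∑ i ∈ Finset.range n, ∫ u in (X + i * D)..(X + (i + 1 : ℕ) * D), dfun Y τ u ^ 2 := by
        rw [intervalIntegral.sum_integral_adjacent_intervals (a := fun i : ℕ => X + i * D)]
        · simp
        · intro j _; exact hintg _ _
    _ ≤ ∑ i ∈ Finset.range n, K * (D * τ * (3 * X) / Real.log Y) := by
        refine Finset.sum_le_sum fun i hi => ?_
        have hi1 : (i:ℝ) * D ≤ n * D := by
          gcongr; exact (Finset.mem_range.mp hi).le
        have hi0 : 0 ≤ (i:ℝ) * D := by positivity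
        have := hJ Y hYe (X + i * D) (by linarith)
        have e : X + (i + 1 : ℕ) * D = X + i * D + D := by push_cast; ring
        rw [e]
        refine this.trans ?_
        gcongr
        linarith
    _ = (n * D) * (K * (τ * (3 * X) / Real.log Y)) := by simp; ring
    _ ≤ (2 * X) * (K * (τ * (3 * X) / Real.log Y)) := by gcongr
    _ = _ := by ring

end FZ

namespace FZ

noncomputable def Asum (Y u : ℝ) : ℝ := ∑ n ∈ Finset.Ioc 1 ⌊u⌋₊, an Y n
noncomputable def dl (Y τ v : ℝ) : ℝ := Asum Y (Real.exp v) - Asum Y (Real.exp (v - τ))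
noncomputable def ph (Y τ v : ℝ) : ℝ := dl Y τ v - Real.exp (-τ) * dl Y τ (v + τ)

lemma Asum_zero {Y u : ℝ} (hY : 1 < Y) (hu : u ≤ Y) : Asum Y u = 0 := by
  unfold Asum
  refine Finset.sum_eq_zero fun n hn => ?_
  obtain ⟨h1, h2⟩ := Finset.mem_Ioc.mp hn
  refine an_eq_zero hY h1 ?_
  by_cases hu0 : 0 ≤ u
  · exact le_trans ((Nat.le_floor_iff hu0).mp h2) hu
  · rw [Nat.floor_of_nonpos (by linarith)] at h2
    omega

lemma Asum_meas (Y : ℝ) : Measurable (Asum Y) := by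
  have : Asum Y = (fun N : ℕ => ∑ n ∈ Finset.Ioc 1 N, an Y n) ∘ (fun u : ℝ => ⌊u⌋₊) := rfl
  rw [this]
  exact (measurable_of_countable _).comp Nat.measurable_floor

lemma dl_meas (Y τ : ℝ) : Measurable (dl Y τ) := by
  unfold dl
  exact ((Asum_meas Y).comp Real.measurable_exp).sub
    ((Asum_meas Y).comp (Real.measurable_exp.comp (measurable_id.sub_const τ)))

lemma ph_meas (Y τ : ℝ) : Measurable (ph Y τ) := by
  unfold ph
  exact (dl_meas Y τ).sub (((dl_meas Y τ).comp (measurable_id.add_const τ)).const_mul _)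

/-- `A(u) + 1 = u M(1) - ∑ lam {u/h}` for `u ≥ 1`. -/
lemma Asum_eq {Y u : ℝ} (hY : 1 < Y) (hu : 1 ≤ u) :
    Asum Y u = u * (∑ h ∈ Finset.Ioc 0 (HY Y), lam Y h / h) -
      (∑ h ∈ Finset.Ioc 0 (HY Y), lam Y h * Int.fract (u / h)) - 1 := by
  have hu0 : 0 ≤ u := by linarith
  have hN : 1 ≤ ⌊u⌋₊ := Nat.le_floor (by simpa using hu)
  have h1 : ∑ n ∈ Finset.Ioc 0 ⌊u⌋₊, an Y n = 1 + Asum Y u := by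
    rw [Asum, ← Finset.sum_Ioc_consecutive _ (Nat.zero_le 1) hN]
    simp [an_one hY]
  have h2 : ∑ n ∈ Finset.Ioc 0 ⌊u⌋₊, an Y n = ∑ h ∈ Finset.Ioc 0 (HY Y), lam Y h * (⌊u⌋₊ / h : ℕ) := by
    unfold an
    simp_rw [Finset.sum_filter]
    rw [Finset.sum_comm]
    refine Finset.sum_congr rfl fun h hh => ?_
    rw [← Finset.sum_filter, Finset.sum_const, nsmul_eq_mul, mul_comm, Nat.Ioc_filter_dvd_card_eq_div]
  have h3 : ∀ h ∈ Finset.Ioc 0 (HY Y), lam Y h * ((⌊u⌋₊ / h : ℕ) : ℝ) = u * (lam Y h / h) - lam Y h * Int.fract (u / h) := by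
    intro h hh
    rw [← Nat.floor_div_natCast, natCast_floor_eq_intCast_floor (by positivity)]
    have := Int.self_sub_floor (u / h)
    rw [← this]; ring
  rw [h2, Finset.sum_congr rfl h3, Finset.sum_sub_distrib, ← Finset.mul_sum] at h1
  linarith

lemma dl_eq {Y τ v : ℝ} (hY : 1 < Y) (hτ : 0 ≤ τ) (hv : τ ≤ v) :
    dl Y τ v = dfun Y τ (Real.exp v) + Real.exp v * (1 - Real.exp (-τ)) * (∑ h ∈ Finset.Ioc 0 (HY Y), lam Y h / h) := by
  rw [dl, Asum_eq hY (Real.one_le_exp (by linarith)), Asum_eq hY (Real.one_le_exp (by linarith)), dfun]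
  simp_rw [mul_sub]
  rw [Finset.sum_sub_distrib, sub_eq_add_neg v τ, Real.exp_add]
  ring

lemma ph_eq {Y τ v : ℝ} (hY : 1 < Y) (hτ : 0 ≤ τ) (hv : τ ≤ v) :
    ph Y τ v = dfun Y τ (Real.exp v) - Real.exp (-τ) * dfun Y τ (Real.exp (v + τ)) := by
  rw [ph, dl_eq hY hτ hv, dl_eq hY hτ (by linarith)]
  have : Real.exp (v + τ) * Real.exp (-τ) = Real.exp v := by rw [← Real.exp_add]; congr 1; ring
  linear_combination (-(1 - Real.exp (-τ)) * (∑ h ∈ Finset.Ioc 0 (HY Y), lam Y h / h)) * this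

lemma dl_zero {Y τ v : ℝ} (hY : 1 < Y) (hτ : 0 ≤ τ) (hv : v ≤ Real.log Y) : dl Y τ v = 0 := by
  have h1 : Real.exp v ≤ Y := by
    rw [← Real.le_log_iff_exp_le (by linarith)]; exact hv
  have h2 : Real.exp (v - τ) ≤ Y := le_trans (Real.exp_le_exp.mpr (by linarith)) h1
  rw [dl, Asum_zero hY h1, Asum_zero hY h2, sub_zero]

lemma ph_zero {Y τ v : ℝ} (hY : 1 < Y) (hτ : 0 ≤ τ) (hv : v ≤ Real.log Y - τ) : ph Y τ v = 0 := by
  rw [ph, dl_zero hY hτ (by linarith), dl_zero hY hτ (by linarith)]; simp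

lemma ph_abs_le {Y τ : ℝ} (hY : 1 < Y) (hτ : 0 ≤ τ) (hτ2 : 2 * τ ≤ Real.log Y) (v : ℝ) : |ph Y τ v| ≤ 2 * Y ^ 2 := by
  by_cases hv : τ ≤ v
  · rw [ph_eq hY hτ hv]
    have h1 := dfun_abs_le hY τ (Real.exp v)
    have h2 := dfun_abs_le hY τ (Real.exp (v + τ))
    have h3 : Real.exp (-τ) ≤ 1 := Real.exp_le_one_iff.mpr (by linarith)
    calc _ ≤ |dfun Y τ (Real.exp v)| + |Real.exp (-τ) * dfun Y τ (Real.exp (v + τ))| := abs_sub _ _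
      _ ≤ Y ^ 2 + 1 * Y ^ 2 := by
        rw [abs_mul, abs_of_pos (Real.exp_pos _)]
        gcongr
      _ = _ := by ring
  · push Not at hv
    rw [ph_zero hY hτ (by linarith)]
    simp; positivity

lemma exp_cov (s : Set ℝ) (hs : MeasurableSet s) (g : ℝ → ℝ) :
    ∫ u in Real.exp '' s, g u = ∫ v in s, Real.exp v * g (Real.exp v) := by
  have := integral_image_eq_integral_abs_deriv_smul hs
    (fun x _ => (Real.hasDerivAt_exp x).hasDerivWithinAt) (Real.exp_injective.injOn) g
  rw [this]
  simp [abs_of_pos (Real.exp_pos _)]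

lemma exp_image_Ioc (a b : ℝ) : Real.exp '' (Ioc a b) = Ioc (Real.exp a) (Real.exp b) := by
  ext u
  constructor
  · rintro ⟨v, ⟨h1, h2⟩, rfl⟩
    exact ⟨Real.exp_lt_exp.mpr h1, Real.exp_le_exp.mpr h2⟩
  · rintro ⟨h1, h2⟩
    have hu : 0 < u := lt_trans (Real.exp_pos a) h1
    refine ⟨Real.log u, ⟨?_, ?_⟩, Real.exp_log hu⟩
    · rwa [Real.lt_log_iff_exp_lt hu]
    · rwa [Real.log_le_iff_le_exp hu]

lemma geom_exp {x : ℝ} (hx : 0 < x) (n : ℕ) : ∑ k ∈ Finset.range n, Real.exp (-x * k) ≤ (1 + x) / x := by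
  have e : ∀ k : ℕ, Real.exp (-x * k) = Real.exp (-x) ^ k := fun k => by
    rw [← Real.exp_nat_mul]; congr 1; ring
  simp_rw [e]
  have h1 : Real.exp (-x) < 1 := by rw [Real.exp_lt_one_iff]; linarith
  have h2 : Real.exp (-x) * (1 + x) ≤ 1 := by
    rw [Real.exp_neg, inv_mul_le_iff₀ (Real.exp_pos _)]
    linarith [Real.add_one_le_exp x]
  calc _ ≤ (1 - Real.exp (-x))⁻¹ := by
        rw [← tsum_geometric_of_lt_one (Real.exp_pos _).le h1]
        exact (summable_geometric_of_lt_one (Real.exp_pos _).le h1).sum_le_tsum _ (fun _ _ => by positivity)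
    _ ≤ _ := by
        rw [inv_le_comm₀ (by linarith) (by positivity), inv_div, div_le_iff₀ (by positivity)]
        linarith

lemma d_L2 : ∃ K : ℝ, 0 < K ∧ ∀ Y : ℝ, Real.exp 1 ≤ Y →
    IntegrableOn (fun v => dfun Y (1 / Y ^ 32) (Real.exp v) ^ 2 * Real.exp (-(1 + 2 / Real.log Y) * v)) (Ioi (24 * Real.log Y)) ∧
    ∫ v in Ioi (24 * Real.log Y), dfun Y (1 / Y ^ 32) (Real.exp v) ^ 2 * Real.exp (-(1 + 2 / Real.log Y) * v) ≤ K * (1 / Y ^ 32) := by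
  obtain ⟨K, hK, hd⟩ := d_dyadic
  refine ⟨K * 4, by positivity, ?_⟩
  intro Y hYe
  have hY : 1 < Y := lt_of_lt_of_le (by simp) hYe
  have hY0 : 0 < Y := by linarith
  have hL1 : 1 ≤ Real.log Y := by
    rw [Real.le_log_iff_exp_le (by linarith)]; exact hYe
  set L := Real.log Y with hL
  set τ := 1 / Y ^ 32 with hτ
  have hτ0 : 0 < τ := by positivity
  set G := fun v : ℝ => dfun Y τ (Real.exp v) ^ 2 * Real.exp (-(1 + 2 / L) * v) with hG
  have hGm : Measurable G := by
    apply Measurable.mul (((dfun_meas Y τ).comp Real.measurable_exp).pow_const 2)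
    fun_prop
  have hintg : IntegrableOn G (Ioi (24 * L)) := by
    have h0 : 0 < 1 + 2 / L := by positivity
    have := (integrableOn_exp_mul_Ioi (a := -(1 + 2 / L)) (by linarith) (24 * L)).const_mul ((Y^2)^2)
    refine Integrable.mono' this hGm.aestronglyMeasurable (Eventually.of_forall fun v => ?_)
    rw [hG]
    simp only [norm_mul, norm_pow, Real.norm_eq_abs, Real.abs_exp]
    have := dfun_abs_le hY τ (Real.exp v)
    gcongr
  refine ⟨hintg, ?_⟩
  set l := Real.log 2 with hl
  have hl0 : 0.6 < l := by have := Real.log_two_gt_d9; linarith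
  have hl1 : l < 0.7 := by have := Real.log_two_lt_d9; linarith
  have hblock : ∀ k : ℕ, ∫ v in (24 * L + k * l)..(24 * L + (k + 1 : ℕ) * l), G v ≤ K * τ / L * Real.exp (- (2 * l / L) * k) := by
    intro k
    set w := 24 * L + k * l with hw
    have hw1 : 24 * L ≤ w := by rw [hw]; have : 0 ≤ k * l := by positivity
                                linarith
    have hw2 : 24 * L + (k + 1 : ℕ) * l = w + l := by push_cast; rw [hw]; ring
    rw [hw2]
    have hX : Y ^ 24 ≤ Real.exp w := by
      have : Y ^ 24 = Real.exp (24 * L) := by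
        rw [show (24:ℝ) * L = (24:ℕ) * L by norm_num, Real.exp_nat_mul, hL, Real.exp_log hY0]
      rw [this]; exact Real.exp_le_exp.mpr hw1
    have h1 := hd Y hYe (Real.exp w) hX
    have h2 : 2 * Real.exp w = Real.exp (w + l) := by
      rw [Real.exp_add w l, hl, Real.exp_log (by norm_num)]; ring
    rw [intervalIntegral.integral_of_le (by linarith [Real.exp_pos w]), h2, ← exp_image_Ioc,
      exp_cov _ measurableSet_Ioc] at h1
    rw [intervalIntegral.integral_of_le (by linarith)]
    have hi2 : IntegrableOn (fun v => Real.exp v * dfun Y τ (Real.exp v) ^ 2) (Ioc w (w + l)) := by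
      have : IntegrableOn (fun _ : ℝ => Real.exp (w + l) * (Y^2)^2) (Ioc w (w + l)) := by
        apply integrableOn_const (by simp)
      refine Integrable.mono' this (Measurable.aestronglyMeasurable ?_) ?_
      · exact Real.measurable_exp.mul (((dfun_meas Y τ).comp Real.measurable_exp).pow_const 2)
      · refine (ae_restrict_mem measurableSet_Ioc).mono fun v hv => ?_
        simp only [norm_mul, norm_pow, Real.norm_eq_abs, Real.abs_exp]
        have := dfun_abs_le hY τ (Real.exp v)
        have := hv.2
        gcongr
    have hi1 : IntegrableOn G (Ioc w (w + l)) := hintg.mono_set (fun v hv => lt_of_le_of_lt hw1 hv.1)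
    calc ∫ v in Ioc w (w + l), G v ≤ ∫ v in Ioc w (w + l), Real.exp (-(2 + 2 / L) * w) * (Real.exp v * dfun Y τ (Real.exp v) ^ 2) := by
          refine setIntegral_mono_on hi1 (hi2.const_mul _) measurableSet_Ioc fun v hv => ?_
          have : Real.exp (-(1 + 2 / L) * v) ≤ Real.exp (-(2 + 2 / L) * w) * Real.exp v := by
            rw [← Real.exp_add]
            apply Real.exp_le_exp.mpr
            have : 0 ≤ (2 + 2 / L) * (v - w) := mul_nonneg (by positivity) (by linarith [hv.1])
            linarith
          rw [hG]
          beta_reduce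
          calc _ ≤ dfun Y τ (Real.exp v) ^ 2 * (Real.exp (-(2 + 2 / L) * w) * Real.exp v) := by gcongr
            _ = _ := by ring
      _ = Real.exp (-(2 + 2 / L) * w) * ∫ v in Ioc w (w + l), Real.exp v * dfun Y τ (Real.exp v) ^ 2 := by
          rw [integral_const_mul]
      _ ≤ Real.exp (-(2 + 2 / L) * w) * (K * (τ * Real.exp w ^ 2 / L)) := by
          gcongr
      _ = K * τ / L * Real.exp (-(2 / L) * w) := by
          have : Real.exp (-(2 + 2 / L) * w) = Real.exp (-(2 / L) * w) / Real.exp w ^ 2 := by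
            rw [← Real.exp_nat_mul, ← Real.exp_sub]; congr 1; push_cast; ring
          rw [this]
          field_simp
      _ ≤ _ := by
          gcongr K * τ / L * Real.exp ?_
          rw [hw]
          have : 0 ≤ 2 / L * (24 * L) := by positivity
          calc _ = -(2 / L * (24 * L)) + -(2 * l / L) * k := by ring
            _ ≤ _ := by linarith
  have hfin : ∀ n : ℕ, ∫ v in (24 * L)..(24 * L + n * l), G v ≤ K * 4 * τ := by
    intro n
    have hadj := intervalIntegral.sum_integral_adjacent_intervals (μ := volume) (f := G) (a := fun k : ℕ => 24 * L + k * l) (n := n) (by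
      intro k _
      rw [intervalIntegrable_iff_integrableOn_Ioc_of_le (by push_cast; linarith)]
      refine hintg.mono_set (fun v hv => lt_of_le_of_lt ?_ hv.1)
      have : 0 ≤ k * l := by positivity
      linarith)
    simp only [Nat.cast_zero, zero_mul, add_zero] at hadj
    rw [← hadj]
    calc _ ≤ ∑ k ∈ Finset.range n, K * τ / L * Real.exp (- (2 * l / L) * k) := Finset.sum_le_sum fun k _ => hblock k
      _ ≤ K * τ / L * ((1 + 2 * l / L) / (2 * l / L)) := by
          rw [← Finset.mul_sum]
          gcongr
          exact geom_exp (by positivity) n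
      _ = K * τ * ((1 + 2 * l / L) / (2 * l)) := by field_simp
      _ ≤ K * τ * 4 := by
          gcongr
          rw [div_le_iff₀ (by positivity)]
          have : 2 * l / L ≤ 2 * l := div_le_self (by positivity) hL1
          nlinarith
      _ = _ := by ring
  have ht : Tendsto (fun n : ℕ => 24 * L + n * l) atTop atTop :=
    tendsto_atTop_add_const_left _ _ ((tendsto_natCast_atTop_atTop).atTop_mul_const (by positivity))
  exact le_of_tendsto (intervalIntegral_tendsto_integral_Ioi _ hintg ht) (Eventually.of_forall hfin)

lemma dl_sq_le {Y τ v : ℝ} (hτ : 0 ≤ τ) (N : ℕ) (hv : Real.exp v ≤ N)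
    (hs : Real.exp v < Real.exp (v - τ) + 1) :
    dl Y τ v ^ 2 ≤ ∑ n ∈ Finset.Ioc 1 N, an Y n ^ 2 * (Ico (Real.log n) (Real.log n + τ)).indicator (fun _ => (1:ℝ)) v := by
  have hnn : ∀ n ∈ Finset.Ioc 1 N, 0 ≤ an Y n ^ 2 * (Ico (Real.log n) (Real.log n + τ)).indicator (fun _ => (1:ℝ)) v := by
    intro n _
    exact mul_nonneg (sq_nonneg _) (indicator_nonneg (fun _ _ => zero_le_one) _)
  set a := ⌊Real.exp (v - τ)⌋₊ with ha
  set b := ⌊Real.exp v⌋₊ with hb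
  have hab : a ≤ b := Nat.floor_le_floor (Real.exp_le_exp.mpr (by linarith))
  have hba : b ≤ a + 1 := by
    have h1 : (b:ℝ) ≤ Real.exp v := Nat.floor_le (Real.exp_pos _).le
    have h2 := Nat.lt_floor_add_one (Real.exp (v - τ))
    have : (b:ℝ) < ((a + 2 : ℕ) : ℝ) := by push_cast; linarith
    have : b < a + 2 := by exact_mod_cast this
    omega
  have hdl : dl Y τ v = ∑ n ∈ Finset.Ioc 1 b, an Y n - ∑ n ∈ Finset.Ioc 1 a, an Y n := rfl
  by_cases hcase : b = a + 1 ∧ 1 ≤ a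
  · obtain ⟨h1, h2⟩ := hcase
    rw [h1, Finset.sum_Ioc_succ_top (by omega), add_sub_cancel_left] at hdl
    have hbN : a + 1 ≤ N := by
      rw [← h1]; exact_mod_cast le_trans (Nat.floor_le (Real.exp_pos v).le) hv
    have := Finset.single_le_sum hnn (a := a + 1) (Finset.mem_Ioc.mpr ⟨by omega, hbN⟩)
    refine le_trans ?_ this
    have hmem : v ∈ Ico (Real.log ((a + 1 : ℕ):ℝ)) (Real.log ((a + 1 : ℕ):ℝ) + τ) := by
      constructor
      · rw [Real.log_le_iff_le_exp (by positivity), ← h1]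
        exact Nat.floor_le (Real.exp_pos v).le
      · rw [← sub_lt_iff_lt_add, Real.lt_log_iff_exp_lt (by positivity)]
        push_cast
        exact Nat.lt_floor_add_one _
    rw [indicator_of_mem hmem, mul_one, hdl]
  · have : dl Y τ v = 0 := by
      rw [hdl]
      by_cases h : b = a
      · rw [h, sub_self]
      · have h1 : b = 1 := by omega
        have h2 : a = 0 := by omega
        rw [h1, h2]; simp
    rw [this]
    simpa using Finset.sum_nonneg hnn

lemma dl_L2 : ∃ K : ℝ, 0 < K ∧ ∀ Y : ℝ, Real.exp 1 ≤ Y →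
    IntegrableOn (fun v => dl Y (1 / Y ^ 32) v ^ 2 * Real.exp (-(1 + 2 / Real.log Y) * v)) (Iic (24 * Real.log Y + 1 / Y ^ 32)) ∧
    ∫ v in Iic (24 * Real.log Y + 1 / Y ^ 32), dl Y (1 / Y ^ 32) v ^ 2 * Real.exp (-(1 + 2 / Real.log Y) * v) ≤ K * (1 / Y ^ 32) := by
  obtain ⟨K, hK, ha⟩ := sum_an_sq
  refine ⟨K, by positivity, ?_⟩
  intro Y hYe
  have hY : 1 < Y := lt_of_lt_of_le (by simp) hYe
  have hY2 : 2 ≤ Y := by have := Real.add_one_le_exp (1:ℝ); linarith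
  have hY0 : 0 < Y := by linarith
  have hL1 : 1 ≤ Real.log Y := by
    rw [Real.le_log_iff_exp_le (by linarith)]; exact hYe
  set L := Real.log Y with hL
  set τ := 1 / Y ^ 32 with hτ
  have hτ0 : 0 < τ := by positivity
  have hτ1 : τ ≤ 1 := by rw [hτ, div_le_one (by positivity)]; exact one_le_pow₀ hY.le
  set N := ⌊Y ^ 25⌋₊ + 0 with hN
  have hexp : ∀ v, v ≤ 24 * L + τ → Real.exp v ≤ Y ^ 24 * (1 + 2 * τ) := by
    intro v hv
    have h24 : Y ^ 24 = Real.exp (24 * L) := by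
        rw [show (24:ℝ) * L = (24:ℕ) * L by norm_num, Real.exp_nat_mul, hL, Real.exp_log hY0]
    calc _ ≤ Real.exp (24 * L + τ) := Real.exp_le_exp.mpr hv
      _ = Y ^ 24 * Real.exp τ := by rw [Real.exp_add, h24]
      _ ≤ _ := by
        gcongr
        have := Real.abs_exp_sub_one_sub_id_le (x := τ) (by rw [abs_of_pos hτ0]; exact hτ1)
        have := (abs_le.mp this).2
        nlinarith
  have hYY : Y ^ 24 * (1 + 2 * τ) + 1 ≤ Y ^ 25 := by
    have e1 : Y ^ 24 * τ ≤ 1 / 4 := by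
      rw [hτ, mul_one_div, div_le_div_iff₀ (by positivity) (by norm_num)]
      have : Y ^ 32 = Y ^ 24 * Y ^ 8 := by ring
      rw [this]
      have : (2:ℝ) ^ 8 ≤ Y ^ 8 := by gcongr
      have : 0 < Y ^ 24 := by positivity
      nlinarith
    have e2 : Y ^ 25 = Y ^ 24 * Y := by ring
    have e3 : (2:ℝ) ^ 24 ≤ Y ^ 24 := by gcongr
    nlinarith
  have hle : ∀ v, v ≤ 24 * L + τ → dl Y τ v ^ 2 ≤ ∑ n ∈ Finset.Ioc 1 N, an Y n ^ 2 * (Ico (Real.log n) (Real.log n + τ)).indicator (fun _ => (1:ℝ)) v := by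
    intro v hv
    have h1 := hexp v hv
    refine dl_sq_le hτ0.le N ?_ ?_
    · have := Nat.lt_floor_add_one (Y ^ 25)
      rw [hN]; push_cast
      linarith
    · have : Real.exp (v - τ) = Real.exp v * Real.exp (-τ) := by rw [← Real.exp_add]; rfl
      rw [this]
      have h2 := Real.add_one_le_exp (-τ)
      have h3 : Real.exp v * τ < 1 := by
        have e0 : Y ^ 24 * (1 + 2 * τ) ≤ Y ^ 25 := by linarith
        calc Real.exp v * τ ≤ Y ^ 25 * τ := by gcongr; linarith
          _ < 1 := by
            rw [hτ, mul_one_div, div_lt_one (by positivity)]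
            exact pow_lt_pow_right₀ hY (by norm_num)
      nlinarith [Real.exp_pos v]
  set c := -(1 + 2 / L) with hc
  have hc1 : c ≤ -1 := by rw [hc]; have : 0 < 2 / L := by positivity
                          linarith
  have hterm : ∀ n : ℕ, 1 ≤ n → IntegrableOn (fun v => Real.exp (c * v)) (Ico (Real.log n) (Real.log n + τ)) ∧
      ∫ v in Ico (Real.log n) (Real.log n + τ), Real.exp (c * v) ≤ τ * (1 / n) := by
    intro n hn
    have hcont : Continuous (fun v : ℝ => Real.exp (c * v)) := by fun_prop
    have hi : IntegrableOn (fun v => Real.exp (c * v)) (Ico (Real.log n) (Real.log n + τ)) :=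
      (hcont.integrableOn_Icc (μ := volume)).mono_set Ico_subset_Icc_self
    refine ⟨hi, ?_⟩
    have hn0 : (0:ℝ) < n := by exact_mod_cast hn
    calc _ ≤ ∫ v in Ico (Real.log n) (Real.log n + τ), (1 / n : ℝ) := by
          refine setIntegral_mono_on hi (integrableOn_const (by simp)) measurableSet_Ico fun v hv => ?_
          have h0 : 0 ≤ Real.log n := Real.log_nonneg (by exact_mod_cast hn)
          have : c * v ≤ - Real.log n := by nlinarith [hv.1]
          calc _ ≤ Real.exp (- Real.log n) := Real.exp_le_exp.mpr this
            _ = _ := by rw [Real.exp_neg, Real.exp_log hn0, one_div]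
      _ = _ := by simp [hτ0.le]
  have hterm2 : ∀ n : ℕ, (fun v => an Y n ^ 2 * (Ico (Real.log n) (Real.log n + τ)).indicator (fun _ => (1:ℝ)) v * Real.exp (c * v))
      = fun v => an Y n ^ 2 * (Ico (Real.log n) (Real.log n + τ)).indicator (fun v => Real.exp (c * v)) v := by
    intro n; funext v
    by_cases h : v ∈ Ico (Real.log n) (Real.log n + τ)
    · simp [indicator_of_mem h]
    · simp [indicator_of_notMem h]
  have hI : ∀ n ∈ Finset.Ioc 1 N, Integrable (fun v => an Y n ^ 2 * (Ico (Real.log n) (Real.log n + τ)).indicator (fun _ => (1:ℝ)) v * Real.exp (c * v)) := by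
    intro n hn
    rw [hterm2]
    exact ((integrable_indicator_iff measurableSet_Ico).mpr (hterm n (by have := (Finset.mem_Ioc.mp hn).1; omega)).1).const_mul _
  have hSI := integrable_finsetSum (Finset.Ioc 1 N) hI
  have hpt : ∀ v, v ≤ 24 * L + τ → dl Y τ v ^ 2 * Real.exp (c * v) ≤ ∑ n ∈ Finset.Ioc 1 N, an Y n ^ 2 * (Ico (Real.log n) (Real.log n + τ)).indicator (fun _ => (1:ℝ)) v * Real.exp (c * v) := by
    intro v hv
    rw [← Finset.sum_mul]
    gcongr
    exact hle v hv
  have hintg : IntegrableOn (fun v => dl Y τ v ^ 2 * Real.exp (c * v)) (Iic (24 * L + τ)) := by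
    refine Integrable.mono' hSI.integrableOn (Measurable.aestronglyMeasurable ?_) ?_
    · exact ((dl_meas Y τ).pow_const 2).mul (by fun_prop)
    · refine (ae_restrict_mem measurableSet_Iic).mono fun v hv => ?_
      rw [Real.norm_of_nonneg (by positivity)]
      exact hpt v hv
  refine ⟨hintg, ?_⟩
  calc _ ≤ ∫ v in Iic (24 * L + τ), ∑ n ∈ Finset.Ioc 1 N, an Y n ^ 2 * (Ico (Real.log n) (Real.log n + τ)).indicator (fun _ => (1:ℝ)) v * Real.exp (c * v) :=
        setIntegral_mono_on hintg hSI.integrableOn measurableSet_Iic hpt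
    _ ≤ ∫ v, ∑ n ∈ Finset.Ioc 1 N, an Y n ^ 2 * (Ico (Real.log n) (Real.log n + τ)).indicator (fun _ => (1:ℝ)) v * Real.exp (c * v) := by
        refine setIntegral_le_integral hSI (Eventually.of_forall fun v => ?_)
        exact Finset.sum_nonneg fun n _ => mul_nonneg (mul_nonneg (sq_nonneg _) (indicator_nonneg (fun _ _ => zero_le_one) _)) (Real.exp_pos _).le
    _ = ∑ n ∈ Finset.Ioc 1 N, an Y n ^ 2 * ∫ v in Ico (Real.log n) (Real.log n + τ), Real.exp (c * v) := by
        rw [integral_finsetSum _ hI]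
        refine Finset.sum_congr rfl fun n _ => ?_
        rw [hterm2, integral_const_mul, integral_indicator measurableSet_Ico]
    _ ≤ ∑ n ∈ Finset.Ioc 1 N, an Y n ^ 2 * (τ * (1 / n)) := by
        refine Finset.sum_le_sum fun n hn => ?_
        gcongr
        exact (hterm n (by have := (Finset.mem_Ioc.mp hn).1; omega)).2
    _ = τ * ∑ n ∈ Finset.Ioc 1 N, an Y n ^ 2 / n := by
        rw [Finset.mul_sum]
        refine Finset.sum_congr rfl fun n _ => by ring
    _ ≤ τ * ∑ n ∈ Finset.Ioc 0 N, an Y n ^ 2 / n := by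
        gcongr
        exact Nat.zero_le 1
    _ ≤ τ * K := by
        gcongr
        exact ha Y hYe N (by rw [hN, add_zero]; exact Nat.floor_le (by positivity))
    _ = _ := by ring

lemma ph_L2 : ∃ K : ℝ, 0 < K ∧ ∀ Y : ℝ, Real.exp 1 ≤ Y →
    Integrable (fun v => ph Y (1 / Y ^ 32) v ^ 2 * Real.exp (-(1 + 2 / Real.log Y) * v)) ∧
    ∫ v, ph Y (1 / Y ^ 32) v ^ 2 * Real.exp (-(1 + 2 / Real.log Y) * v) ≤ K * (1 / Y ^ 32) := by
  obtain ⟨K1, hK1, hd1⟩ := dl_L2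
  obtain ⟨K2, hK2, hd2⟩ := d_L2
  refine ⟨60 * (K1 + K2), by positivity, ?_⟩
  intro Y hYe
  obtain ⟨i1, b1⟩ := hd1 Y hYe
  obtain ⟨i2, b2⟩ := hd2 Y hYe
  have hY : 1 < Y := lt_of_lt_of_le (by simp) hYe
  have hY0 : 0 < Y := by linarith
  have hL1 : 1 ≤ Real.log Y := by
    rw [Real.le_log_iff_exp_le (by linarith)]; exact hYe
  set L := Real.log Y with hL
  set τ := 1 / Y ^ 32 with hτ
  have hτ0 : 0 < τ := by positivity
  have hτ1 : τ ≤ 1 := by rw [hτ, div_le_one (by positivity)]; exact one_le_pow₀ hY.le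
  set c := -(1 + 2 / L) with hc
  have hcτ : Real.exp (-(c * τ)) ≤ 28 := by
    have h1 : -(c * τ) ≤ 3 := by
      rw [hc]
      have : 2 / L ≤ 2 := div_le_self (by norm_num) hL1
      have : 0 < 2 / L := by positivity
      nlinarith
    calc _ ≤ Real.exp 3 := Real.exp_le_exp.mpr h1
      _ = Real.exp 1 ^ 3 := by rw [← Real.exp_nat_mul]; norm_num
      _ ≤ 2.72 ^ 3 := by have := Real.exp_one_lt_d9; gcongr; linarith
      _ ≤ 28 := by norm_num
  have he1 : Real.exp (-τ) ^ 2 ≤ 1 := pow_le_one₀ (Real.exp_pos _).le (Real.exp_le_one_iff.mpr (by linarith))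
  -- shifting
  have shiftI : ∀ (f : ℝ → ℝ) (s : Set ℝ), MeasurableSet s → IntegrableOn (fun v => f v * Real.exp (c * v)) s →
      IntegrableOn (fun v => f (v + τ) * Real.exp (c * v)) ((fun v => v + τ) ⁻¹' s) ∧
      ∫ v in ((fun v => v + τ) ⁻¹' s), f (v + τ) * Real.exp (c * v) = Real.exp (-(c * τ)) * ∫ v in s, f v * Real.exp (c * v) := by
    intro f s hs hi
    have hmp : MeasurePreserving (fun v : ℝ => v + τ) volume volume := measurePreserving_add_right volume τ
    have hemb : MeasurableEmbedding (fun v : ℝ => v + τ) := measurableEmbedding_addRight τ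
    have e : ∀ v, f (v + τ) * Real.exp (c * v) = Real.exp (-(c * τ)) * (f (v + τ) * Real.exp (c * (v + τ))) := by
      intro v
      have : Real.exp (c * (v + τ)) = Real.exp (c * v) * Real.exp (c * τ) := by rw [← Real.exp_add]; congr 1; ring
      rw [this, Real.exp_neg]
      field_simp
    simp_rw [e]
    constructor
    · exact ((hmp.integrableOn_comp_preimage hemb).mpr hi).const_mul _
    · rw [integral_const_mul]
      congr 1
      exact hmp.setIntegral_preimage_emb hemb (fun v => f v * Real.exp (c * v)) s
  obtain ⟨j1, k1⟩ := shiftI (fun v => dl Y τ v ^ 2) _ measurableSet_Iic i1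
  obtain ⟨j2, k2⟩ := shiftI (fun v => dfun Y τ (Real.exp v) ^ 2) _ measurableSet_Ioi i2
  have s1 : Iic (24 * L) ⊆ Iic (24 * L + τ) := Iic_subset_Iic.mpr (by linarith)
  have s2 : Iic (24 * L) ⊆ (fun v => v + τ) ⁻¹' Iic (24 * L + τ) := fun v hv => by
    simp only [mem_preimage, mem_Iic] at *; linarith
  have s3 : Ioi (24 * L) ⊆ (fun v => v + τ) ⁻¹' Ioi (24 * L) := fun v hv => by
    simp only [mem_preimage, mem_Ioi] at *; linarith
  have hm : Measurable (fun v => ph Y τ v ^ 2 * Real.exp (c * v)) := ((ph_meas Y τ).pow_const 2).mul (by fun_prop)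
  have p1 : ∀ v, ph Y τ v ^ 2 * Real.exp (c * v) ≤ 2 * (dl Y τ v ^ 2 * Real.exp (c * v)) + 2 * (dl Y τ (v + τ) ^ 2 * Real.exp (c * v)) := by
    intro v
    have : ph Y τ v ^ 2 ≤ 2 * dl Y τ v ^ 2 + 2 * dl Y τ (v + τ) ^ 2 := by
      rw [ph]
      have := mul_le_mul_of_nonneg_right he1 (sq_nonneg (dl Y τ (v + τ)))
      nlinarith [sq_nonneg (dl Y τ v + Real.exp (-τ) * dl Y τ (v + τ))]
    have := mul_le_mul_of_nonneg_right this (Real.exp_pos (c * v)).le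
    linarith
  have p2 : ∀ v ∈ Ioi (24 * L), ph Y τ v ^ 2 * Real.exp (c * v) ≤ 2 * (dfun Y τ (Real.exp v) ^ 2 * Real.exp (c * v)) + 2 * (dfun Y τ (Real.exp (v + τ)) ^ 2 * Real.exp (c * v)) := by
    intro v hv
    have : ph Y τ v ^ 2 ≤ 2 * dfun Y τ (Real.exp v) ^ 2 + 2 * dfun Y τ (Real.exp (v + τ)) ^ 2 := by
      rw [ph_eq hY hτ0.le (by have : 24 * L < v := hv
                              linarith)]
      have := mul_le_mul_of_nonneg_right he1 (sq_nonneg (dfun Y τ (Real.exp (v + τ))))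
      nlinarith [sq_nonneg (dfun Y τ (Real.exp v) + Real.exp (-τ) * dfun Y τ (Real.exp (v + τ)))]
    have := mul_le_mul_of_nonneg_right this (Real.exp_pos (c * v)).le
    linarith
  have q1 : IntegrableOn (fun v => 2 * (dl Y τ v ^ 2 * Real.exp (c * v)) + 2 * (dl Y τ (v + τ) ^ 2 * Real.exp (c * v))) (Iic (24 * L)) := ((i1.mono_set s1).const_mul 2).add ((j1.mono_set s2).const_mul 2)
  have q2 : IntegrableOn (fun v => 2 * (dfun Y τ (Real.exp v) ^ 2 * Real.exp (c * v)) + 2 * (dfun Y τ (Real.exp (v + τ)) ^ 2 * Real.exp (c * v))) (Ioi (24 * L)) := (i2.const_mul 2).add ((j2.mono_set s3).const_mul 2)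
  have I1 : IntegrableOn (fun v => ph Y τ v ^ 2 * Real.exp (c * v)) (Iic (24 * L)) := by
    refine Integrable.mono' q1 hm.aestronglyMeasurable (Eventually.of_forall fun v => ?_)
    rw [Real.norm_of_nonneg (by positivity)]
    exact p1 v
  have I2 : IntegrableOn (fun v => ph Y τ v ^ 2 * Real.exp (c * v)) (Ioi (24 * L)) := by
    refine Integrable.mono' q2 hm.aestronglyMeasurable ((ae_restrict_mem measurableSet_Ioi).mono fun v hv => ?_)
    rw [Real.norm_of_nonneg (by positivity)]
    exact p2 v hv
  have I : Integrable (fun v => ph Y τ v ^ 2 * Real.exp (c * v)) := by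
    rw [← integrableOn_univ, ← Iic_union_Ioi (a := 24 * L)]
    exact I1.union I2
  refine ⟨I, ?_⟩
  have B1 : ∫ v in Iic (24 * L), ph Y τ v ^ 2 * Real.exp (c * v) ≤ 2 * (K1 * τ) + 2 * (28 * (K1 * τ)) := by
    calc _ ≤ ∫ v in Iic (24 * L), (2 * (dl Y τ v ^ 2 * Real.exp (c * v)) + 2 * (dl Y τ (v + τ) ^ 2 * Real.exp (c * v))) :=
          setIntegral_mono I1 q1 p1
      _ = 2 * (∫ v in Iic (24 * L), dl Y τ v ^ 2 * Real.exp (c * v)) + 2 * ∫ v in Iic (24 * L), dl Y τ (v + τ) ^ 2 * Real.exp (c * v) := by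
          rw [integral_add ((i1.mono_set s1).const_mul 2) ((j1.mono_set s2).const_mul 2), integral_const_mul, integral_const_mul]
      _ ≤ _ := by
          have e1 := setIntegral_mono_set i1 (Eventually.of_forall fun v => mul_nonneg (sq_nonneg (dl Y τ v)) (Real.exp_pos (c * v)).le) (LE.le.eventuallyLE s1)
          have e2 := setIntegral_mono_set j1 (Eventually.of_forall fun v => mul_nonneg (sq_nonneg (dl Y τ (v + τ))) (Real.exp_pos (c * v)).le) (LE.le.eventuallyLE s2)
          rw [k1] at e2
          have e3 : Real.exp (-(c * τ)) * ∫ v in Iic (24 * L + τ), dl Y τ v ^ 2 * Real.exp (c * v) ≤ 28 * (K1 * τ) :=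
            mul_le_mul hcτ b1 (integral_nonneg fun v => by positivity) (by norm_num)
          have e4 := e1.trans b1
          have e5 := e2.trans e3
          linarith
  have B2 : ∫ v in Ioi (24 * L), ph Y τ v ^ 2 * Real.exp (c * v) ≤ 2 * (K2 * τ) + 2 * (28 * (K2 * τ)) := by
    calc _ ≤ ∫ v in Ioi (24 * L), (2 * (dfun Y τ (Real.exp v) ^ 2 * Real.exp (c * v)) + 2 * (dfun Y τ (Real.exp (v + τ)) ^ 2 * Real.exp (c * v))) :=
          setIntegral_mono_on I2 q2 measurableSet_Ioi p2
      _ = 2 * (∫ v in Ioi (24 * L), dfun Y τ (Real.exp v) ^ 2 * Real.exp (c * v)) + 2 * ∫ v in Ioi (24 * L), dfun Y τ (Real.exp (v + τ)) ^ 2 * Real.exp (c * v) := by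
          rw [integral_add (i2.const_mul 2) ((j2.mono_set s3).const_mul 2), integral_const_mul, integral_const_mul]
      _ ≤ _ := by
          have e2 := setIntegral_mono_set j2 (Eventually.of_forall fun v => mul_nonneg (sq_nonneg (dfun Y τ (Real.exp (v + τ)))) (Real.exp_pos (c * v)).le) (LE.le.eventuallyLE s3)
          rw [k2] at e2
          have e3 : Real.exp (-(c * τ)) * ∫ v in Ioi (24 * L), dfun Y τ (Real.exp v) ^ 2 * Real.exp (c * v) ≤ 28 * (K2 * τ) :=
            mul_le_mul hcτ b2 (integral_nonneg fun v => by positivity) (by norm_num)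
          have e5 := e2.trans e3
          linarith
  rw [← integral_add_compl measurableSet_Iic I, compl_Iic]
  have : 0 < K1 * τ := by positivity
  have : 0 < K2 * τ := by positivity
  linarith
end FZ

namespace FZ

noncomputable def Mf (Y : ℝ) (s : ℂ) : ℂ := ∑ h ∈ Finset.Ioc 0 (HY Y), (lam Y h : ℂ) * (h:ℂ) ^ (-s)
noncomputable def gf (Y : ℝ) (s : ℂ) : ℂ := riemannZeta s * Mf Y s - 1
noncomputable def lap (f : ℝ → ℝ) (s : ℂ) : ℂ := ∫ v : ℝ, (f v : ℂ) * cexp (-s * v)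

lemma LS_lam {Y : ℝ} (hY : 1 < Y) (s : ℂ) :
    LSeriesSummable (fun n => (lam Y n : ℂ)) s ∧ LSeries (fun n => (lam Y n : ℂ)) s = Mf Y s := by
  have h0 : ∀ n ∉ Finset.Ioc 0 (HY Y), LSeries.term (fun n => (lam Y n : ℂ)) s n = 0 := by
    intro n hn
    by_cases hn0 : n = 0
    · simp [hn0]
    · rw [LSeries.term_of_ne_zero hn0, lam_eq_zero hY (by
        rw [Finset.mem_Ioc] at hn; omega)]
      simp
  constructor
  · exact summable_of_ne_finset_zero h0
  · rw [LSeries, tsum_eq_sum h0, Mf]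
    refine Finset.sum_congr rfl fun n hn => ?_
    rw [LSeries.term_of_ne_zero (by have := (Finset.mem_Ioc.mp hn).1; omega), Complex.cpow_neg, div_eq_mul_inv]

lemma LS_an {Y : ℝ} (hY : 1 < Y) {s : ℂ} (hs : 1 < s.re) :
    LSeriesSummable (fun n => (an Y n : ℂ)) s ∧ LSeries (fun n => (an Y n : ℂ)) s = riemannZeta s * Mf Y s := by
  obtain ⟨h1, h2⟩ := LS_lam hY s
  have h3 : LSeriesSummable 1 s := LSeriesSummable_one_iff.mpr hs
  have e : ∀ {n : ℕ}, n ≠ 0 → LSeries.convolution (fun n => (lam Y n : ℂ)) 1 n = (an Y n : ℂ) := by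
    intro n hn
    rw [LSeries.convolution_def]
    rw [an_eq_divisors hY (Nat.pos_of_ne_zero hn)]
    simp only [Pi.one_apply, mul_one]
    push_cast
    exact Nat.sum_divisorsAntidiagonal (fun i _ => (lam Y i : ℂ))
  constructor
  · exact (LSeriesSummable_congr s e).mp (h1.convolution h3)
  · rw [← LSeries_congr e s, LSeries_convolution' h1 h3, h2, LSeries_one_eq_riemannZeta hs, mul_comm]

lemma Asum_abs_le {Y u : ℝ} (hY : 1 < Y) (hu : 0 ≤ u) : |Asum Y u| ≤ Y ^ 2 * u := by
  unfold Asum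
  refine (Finset.abs_sum_le_sum_abs _ _).trans ?_
  calc _ ≤ ∑ n ∈ Finset.Ioc 1 ⌊u⌋₊, Y ^ 2 := Finset.sum_le_sum fun n _ => abs_an_le_HY hY n
    _ = (⌊u⌋₊ - 1 : ℕ) * Y ^ 2 := by simp
    _ ≤ u * Y ^ 2 := by
      gcongr
      exact le_trans (by exact_mod_cast Nat.sub_le _ _) (Nat.floor_le hu)
    _ = _ := by ring

lemma exp_cov_c (s : Set ℝ) (hs : MeasurableSet s) (g : ℝ → ℂ) :
    ∫ u in Real.exp '' s, g u = ∫ v in s, (Real.exp v : ℂ) * g (Real.exp v) := by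
  have := integral_image_eq_integral_abs_deriv_smul hs
    (fun x _ => (Real.hasDerivAt_exp x).hasDerivWithinAt) (Real.exp_injective.injOn) g
  rw [this]
  simp [abs_of_pos (Real.exp_pos _)]

lemma exp_image_Ioi (a : ℝ) : Real.exp '' (Ioi a) = Ioi (Real.exp a) := by
  ext u
  constructor
  · rintro ⟨v, h1, rfl⟩
    exact Real.exp_lt_exp.mpr h1
  · intro h1
    have hu : 0 < u := lt_trans (Real.exp_pos a) h1
    refine ⟨Real.log u, ?_, Real.exp_log hu⟩
    exact (Real.lt_log_iff_exp_lt hu).mpr h1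

lemma Aexp_int {Y : ℝ} (hY : 1 < Y) {s : ℂ} (hs : 1 < s.re) :
    Integrable (fun v : ℝ => (Asum Y (Real.exp v) : ℂ) * cexp (-s * v)) := by
  have hb : IntegrableOn (fun v : ℝ => Y ^ 2 * Real.exp ((1 - s.re) * v)) (Ioi 0) :=
    (integrableOn_exp_mul_Ioi (by linarith) 0).const_mul _
  have hb2 := (integrable_indicator_iff measurableSet_Ioi).mpr hb
  refine Integrable.mono' hb2 (Measurable.aestronglyMeasurable ?_) (Eventually.of_forall fun v => ?_)
  · exact (Complex.measurable_ofReal.comp ((Asum_meas Y).comp Real.measurable_exp)).mul (by fun_prop)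
  · by_cases hv : v ∈ Ioi (0:ℝ)
    · rw [indicator_of_mem hv, norm_mul, Complex.norm_real, Complex.norm_exp]
      have h1 := Asum_abs_le hY (Real.exp_pos v).le
      have h2 : (-s * (v:ℂ)).re = -s.re * v := by simp
      rw [h2]
      calc _ ≤ Y ^ 2 * Real.exp v * Real.exp (-s.re * v) := by
            gcongr; exact h1
        _ = _ := by rw [mul_assoc, ← Real.exp_add]; congr 2; ring
    · rw [indicator_of_notMem hv]
      have : Real.exp v ≤ 1 := Real.exp_le_one_iff.mpr (by simpa using hv)
      rw [Asum_zero hY (by linarith)]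
      simp

lemma lap_A {Y : ℝ} (hY : 1 < Y) {s : ℂ} (hs : 1 < s.re) :
    lap (fun v => Asum Y (Real.exp v)) s = gf Y s / s := by
  have hs0 : s ≠ 0 := by rintro rfl; simp at hs; linarith
  set f : ℕ → ℂ := fun n => if n = 1 then 0 else (an Y n : ℂ) with hf
  set δ1 : ℕ → ℂ := fun n => if n = 1 then 1 else 0 with hδ
  obtain ⟨h1, h2⟩ := LS_an hY hs
  have hsum1 : LSeriesSummable δ1 s := by
    refine summable_of_ne_finset_zero (s := {1}) fun n hn => ?_
    have : n ≠ 1 := by simpa using hn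
    by_cases hn0 : n = 0
    · simp [hn0]
    · rw [LSeries.term_of_ne_zero hn0]; simp [hδ, this]
  have hL1 : LSeries δ1 s = 1 := by
    rw [LSeries, tsum_eq_single 1]
    · simp [LSeries.term_of_ne_zero, hδ]
    · intro n hn
      by_cases hn0 : n = 0
      · simp [hn0]
      · rw [LSeries.term_of_ne_zero hn0]; simp [hδ, hn]
  have hfeq : f = (fun n => (an Y n : ℂ)) - δ1 := by
    funext n
    simp only [hf, hδ, Pi.sub_apply]
    split_ifs with h
    · rw [h, an_one hY]; simp
    · simp
  have hfs : LSeriesSummable f s := by rw [hfeq]; exact h1.sub hsum1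
  have hfL : LSeries f s = gf Y s := by rw [hfeq, LSeries_sub h1 hsum1, h2, hL1, gf]
  have hA : ∀ n : ℕ, ∑ k ∈ Finset.Icc 1 n, f k = (∑ k ∈ Finset.Ioc 1 n, an Y k : ℝ) := by
    intro n
    by_cases hn : 1 ≤ n
    · rw [← Finset.add_sum_Ioc_eq_sum_Icc hn]
      have : ∑ k ∈ Finset.Ioc 1 n, f k = ∑ k ∈ Finset.Ioc 1 n, (an Y k : ℂ) := by
        refine Finset.sum_congr rfl fun k hk => ?_
        have := (Finset.mem_Ioc.mp hk).1
        simp only [hf]; rw [if_neg (by omega)]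
      rw [this]; simp [hf]
    · have : n = 0 := by omega
      simp [this]
  have hO : (fun n : ℕ => ∑ k ∈ Finset.Icc 1 n, f k) =O[atTop] fun n => (n:ℝ) ^ (1:ℝ) := by
    refine Asymptotics.IsBigO.of_bound (Y ^ 2) (Eventually.of_forall fun n => ?_)
    rw [hA, Complex.norm_real, Real.rpow_one, Real.norm_natCast]
    have := Asum_abs_le hY (Nat.cast_nonneg n)
    rw [Asum, Nat.floor_natCast] at this
    exact this
  have := LSeries_eq_mul_integral f zero_le_one hs hfs hO
  rw [hfL] at this
  rw [this, mul_div_cancel_left₀ _ hs0, show Ioi (1:ℝ) = Real.exp '' (Ioi 0) by rw [exp_image_Ioi, Real.exp_zero],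
    exp_cov_c _ measurableSet_Ioi, lap]
  have hz : ∀ v ∉ Ioi (0:ℝ), (Asum Y (Real.exp v) : ℂ) * cexp (-s * v) = 0 := by
    intro v hv
    have : Real.exp v ≤ 1 := Real.exp_le_one_iff.mpr (by simpa using hv)
    rw [Asum_zero hY (by linarith)]
    simp
  rw [← setIntegral_eq_integral_of_forall_compl_eq_zero hz]
  refine setIntegral_congr_fun measurableSet_Ioi fun v _ => ?_
  beta_reduce
  rw [hA, Asum]
  have e : ((Real.exp v : ℝ) : ℂ) ^ (-(s + 1)) = cexp (-(s+1) * v) := by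
    rw [Complex.cpow_def_of_ne_zero (by exact_mod_cast (Real.exp_pos v).ne'), ← Complex.ofReal_log (Real.exp_pos v).le,
      Real.log_exp]
    congr 1; ring
  rw [e, Complex.ofReal_exp]
  rw [mul_left_comm, ← Complex.exp_add]
  congr 2; ring

lemma shift_lap (f : ℝ → ℝ) (s : ℂ) (a : ℝ) :
    lap (fun v => f (v + a)) s = cexp (s * a) * lap f s := by
  rw [lap, lap, ← integral_const_mul]
  rw [← integral_add_right_eq_self (fun v : ℝ => cexp (s * a) * ((f v : ℂ) * cexp (-s * v))) a]
  congr 1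
  funext v
  rw [mul_left_comm, ← Complex.exp_add]
  congr 2
  push_cast; ring

lemma shift_int (f : ℝ → ℝ) (s : ℂ) (a : ℝ) (hf : Integrable (fun v : ℝ => (f v : ℂ) * cexp (-s * v))) :
    Integrable (fun v : ℝ => (f (v + a) : ℂ) * cexp (-s * v)) := by
  have := (hf.comp_add_right a).const_mul (cexp (s * a))
  refine this.congr (Eventually.of_forall fun v => ?_)
  beta_reduce
  rw [mul_left_comm, ← Complex.exp_add]
  congr 2
  push_cast; ring

lemma lap_ph_one {Y τ : ℝ} (hY : 1 < Y) {s : ℂ} (hs : 1 < s.re) :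
    lap (ph Y τ) s = (1 - cexp (-τ * s)) * (1 - cexp (τ * (s - 1))) / s * gf Y s := by
  have hA := lap_A hY hs
  have iA := Aexp_int hY hs
  have s1 := shift_lap (fun v => Asum Y (Real.exp v)) s (-τ)
  have j1 := shift_int (fun v => Asum Y (Real.exp v)) s (-τ) iA
  have idl : Integrable (fun v : ℝ => (dl Y τ v : ℂ) * cexp (-s * v)) := by
    refine (iA.sub j1).congr (Eventually.of_forall fun v => ?_)
    simp only [Pi.sub_apply, dl, sub_eq_add_neg v τ]
    push_cast; ring
  have ldl : lap (dl Y τ) s = (1 - cexp (-τ * s)) * lap (fun v => Asum Y (Real.exp v)) s := by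
    have : lap (dl Y τ) s = lap (fun v => Asum Y (Real.exp v)) s - lap (fun v => Asum Y (Real.exp (v + -τ))) s := by
      rw [lap, lap, lap, ← integral_sub iA j1]
      congr 1; funext v
      simp only [dl, sub_eq_add_neg v τ]
      push_cast; ring
    rw [this, s1]
    have e : s * ((-τ : ℝ) : ℂ) = -τ * s := by push_cast; ring
    rw [e]; ring
  have s2 := shift_lap (dl Y τ) s τ
  have j2 := shift_int (dl Y τ) s τ idl
  have : lap (ph Y τ) s = lap (dl Y τ) s - cexp (-τ) * lap (fun v => dl Y τ (v + τ)) s := by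
    rw [lap, lap, lap, ← integral_const_mul, ← integral_sub idl (j2.const_mul _)]
    congr 1; funext v
    simp only [ph]
    push_cast; ring
  rw [this, s2, ldl, hA]
  have e : cexp (τ * (s - 1)) = cexp (-τ) * cexp (s * τ) := by
    rw [← Complex.exp_add]; congr 1; ring
  rw [e]; ring

lemma gf_diff {Y : ℝ} {s : ℂ} (hs : s ≠ 1) : DifferentiableAt ℂ (gf Y) s := by
  unfold gf Mf
  refine ((differentiableAt_riemannZeta hs).mul ?_).sub_const 1
  refine DifferentiableAt.fun_sum fun h hh => ?_
  refine DifferentiableAt.const_mul ?_ _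
  have : (h:ℂ) ≠ 0 := by exact_mod_cast (by have := (Finset.mem_Ioc.mp hh).1; omega)
  exact DifferentiableAt.const_cpow (by fun_prop) (Or.inl this)

lemma lap_diff {f : ℝ → ℝ} (hf : Measurable f) {B : ℝ} (hb : ∀ v, |f v| ≤ B) (hz : ∀ v ≤ 0, f v = 0) {s : ℂ} (hs : 0 < s.re) :
    DifferentiableAt ℂ (lap f) s := by
  have hB : 0 ≤ B := (abs_nonneg _).trans (hb 0)
  set ε := s.re / 2 with hε
  have hε0 : 0 < ε := by positivity
  set bound : ℝ → ℝ := (Ioi (0:ℝ)).indicator (fun v => (2 / ε) * B * Real.exp (-(ε/2) * v)) with hbd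
  have hbi : Integrable bound := by
    rw [hbd, integrable_indicator_iff measurableSet_Ioi]
    exact (integrableOn_exp_mul_Ioi (by linarith) 0).const_mul _
  have hmeas : ∀ z : ℂ, Measurable (fun v : ℝ => (f v : ℂ) * cexp (-z * v)) := fun z =>
    (Complex.measurable_ofReal.comp hf).mul (by fun_prop)
  have hmeas' : Measurable (fun v : ℝ => (f v : ℂ) * (-v * cexp (-s * v))) :=
    (Complex.measurable_ofReal.comp hf).mul (by fun_prop)
  have hre : ∀ z ∈ Metric.ball s ε, ε ≤ z.re := by
    intro z hz
    have h1 : ‖z - s‖ < ε := by simpa [dist_eq_norm] using hz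
    have h2 := (Complex.abs_re_le_norm (z - s)).trans h1.le
    have h3 := (abs_le.mp h2).1
    rw [Complex.sub_re] at h3
    linarith
  have hintg : Integrable (fun v : ℝ => (f v : ℂ) * cexp (-s * v)) := by
    have hi : Integrable ((Ioi (0:ℝ)).indicator (fun v => B * Real.exp (-s.re * v))) := by
      rw [integrable_indicator_iff measurableSet_Ioi]
      exact (integrableOn_exp_mul_Ioi (by linarith) 0).const_mul _
    refine Integrable.mono' hi (hmeas s).aestronglyMeasurable (Eventually.of_forall fun v => ?_)
    by_cases hv : v ∈ Ioi (0:ℝ)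
    · rw [indicator_of_mem hv, norm_mul, Complex.norm_real, Complex.norm_exp]
      have h2 : (-s * (v:ℂ)).re = -s.re * v := by simp
      rw [h2]
      gcongr
      exact hb v
    · rw [indicator_of_notMem hv, hz v (by simpa using hv)]; simp
  have := hasDerivAt_integral_of_dominated_loc_of_deriv_le (μ := volume) (F := fun (z : ℂ) (v : ℝ) => (f v : ℂ) * cexp (-z * v))
    (F' := fun (z : ℂ) (v : ℝ) => (f v : ℂ) * (-v * cexp (-z * v))) (x₀ := s) (s := Metric.ball s ε) (bound := bound)
    (Metric.ball_mem_nhds s hε0) (Eventually.of_forall fun z => (hmeas z).aestronglyMeasurable) hintg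
    hmeas'.aestronglyMeasurable (Eventually.of_forall fun v z hzb => ?_) hbi (Eventually.of_forall fun v z _ => ?_)
  · exact this.2.differentiableAt
  · by_cases hv : v ∈ Ioi (0:ℝ)
    · rw [hbd, indicator_of_mem hv, norm_mul, norm_mul, norm_neg, Complex.norm_real, Complex.norm_real, Complex.norm_exp]
      have hv0 : 0 < v := hv
      have h2 : (-z * (v:ℂ)).re = -z.re * v := by simp
      rw [h2, Real.norm_of_nonneg hv0.le]
      have h3 := hre z hzb
      have h4 : v ≤ 2 / ε * Real.exp (ε / 2 * v) := by
        have := Real.add_one_le_exp (ε / 2 * v)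
        calc v = 2 / ε * (ε / 2 * v) := by field_simp
          _ ≤ _ := by gcongr; linarith
      calc ‖f v‖ * (v * Real.exp (-z.re * v)) ≤ B * (2 / ε * Real.exp (ε / 2 * v) * Real.exp (-ε * v)) := by
            gcongr
            exact hb v
        _ = _ := by
            rw [mul_assoc (2 / ε), ← Real.exp_add]
            rw [show ε / 2 * v + -ε * v = -(ε / 2) * v by ring]
            ring
    · rw [hbd, indicator_of_notMem hv, hz v (by simpa using hv)]; simp
  · have h1 : HasDerivAt (fun z : ℂ => -z * (v:ℂ)) (-v : ℂ) z := by
      simpa using (hasDerivAt_id z).neg.mul_const (v:ℂ)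
    have := (h1.cexp).const_mul (f v : ℂ)
    refine this.congr_deriv ?_
    ring

lemma lap_ph {Y τ : ℝ} (hY : 1 < Y) (hτ : 0 ≤ τ) (hτ2 : 2 * τ ≤ Real.log Y) {s : ℂ} (hs : 0 < s.re) (hs2 : 0 < s.im) :
    lap (ph Y τ) s = (1 - cexp (-τ * s)) * (1 - cexp (τ * (s - 1))) / s * gf Y s := by
  set U : Set ℂ := {z | 0 < z.re} ∩ {z | 0 < z.im} with hU
  have hUo : IsOpen U := (isOpen_lt continuous_const Complex.continuous_re).inter (isOpen_lt continuous_const Complex.continuous_im)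
  have hUc : Convex ℝ U := (convex_halfSpace_re_gt 0).inter (convex_halfSpace_im_gt 0)
  have d1 : DifferentiableOn ℂ (lap (ph Y τ)) U := fun z hz =>
    (lap_diff (ph_meas Y τ) (ph_abs_le hY hτ hτ2) (fun v hv => ph_zero hY hτ (by linarith)) hz.1).differentiableWithinAt
  have d2 : DifferentiableOn ℂ (fun s => (1 - cexp (-τ * s)) * (1 - cexp (τ * (s - 1))) / s * gf Y s) U := by
    intro z hz
    have hz0 : z ≠ 0 := by rintro rfl; simpa using hz.1
    have hz1 : z ≠ 1 := by rintro rfl; simpa using hz.2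
    refine DifferentiableAt.differentiableWithinAt (DifferentiableAt.mul (DifferentiableAt.div ?_ differentiableAt_id hz0) (gf_diff hz1))
    fun_prop
  refine AnalyticOnNhd.eqOn_of_preconnected_of_eventuallyEq (d1.analyticOnNhd hUo) (d2.analyticOnNhd hUo) hUc.isPreconnected
    (z₀ := 2 + I) (by simp [hU]) ?_ (show s ∈ U from ⟨hs, hs2⟩)
  have : {z : ℂ | 1 < z.re} ∈ nhds (2 + I) := (isOpen_lt continuous_const Complex.continuous_re).mem_nhds (by simp)
  filter_upwards [this] with z hz
  exact lap_ph_one hY hz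
end FZ

namespace FZ

noncomputable def ft (f : ℝ → ℝ) (t : ℝ) : ℂ := ∫ v : ℝ, (f v : ℂ) * cexp (-(I * t) * v)

lemma norm_cexp_I (t v : ℝ) : ‖cexp (-(I * t) * v)‖ = 1 := by
  rw [Complex.norm_exp]; simp

lemma ft_cont {f : ℝ → ℝ} (hf : Integrable f) : Continuous (ft f) := by
  unfold ft
  refine continuous_of_dominated (bound := fun v => ‖f v‖) ?_ ?_ hf.norm ?_
  · intro t
    exact hf.ofReal.aestronglyMeasurable.mul (Continuous.aestronglyMeasurable (by fun_prop))
  · intro t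
    refine Eventually.of_forall fun v => ?_
    rw [norm_mul, norm_cexp_I, Complex.norm_real, mul_one]
  · refine Eventually.of_forall fun v => ?_
    fun_prop

lemma ft_le {f : ℝ → ℝ} (t : ℝ) : ‖ft f t‖ ≤ ∫ v, ‖f v‖ := by
  unfold ft
  refine (norm_integral_le_integral_norm _).trans (le_of_eq ?_)
  congr 1; funext v
  rw [norm_mul, norm_cexp_I, Complex.norm_real, mul_one]

lemma gauss_ft {b : ℝ} (hb : 0 < b) (y : ℝ) :
    ∫ t : ℝ, cexp (-(I * t) * y) * (Real.exp (-b * t ^ 2) : ℂ) = ((√(π / b) * Real.exp (-(1 / (4 * b)) * y ^ 2) : ℝ) : ℂ) := by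
  have h := fourierIntegral_gaussian (b := (b:ℂ)) (by simpa using hb) (-y : ℂ)
  have e1 : ((π:ℂ) / b) ^ ((1:ℂ) / 2) = ((√(π / b) : ℝ) : ℂ) := by
    rw [Real.sqrt_eq_rpow, Complex.ofReal_cpow (by positivity)]
    push_cast; rfl
  rw [e1] at h
  push_cast
  have e2 : cexp (-(-(y:ℂ)) ^ 2 / (4 * b)) = cexp (-(1 / (4 * b)) * y ^ 2) := by
    congr 1; ring
  rw [e2] at h
  rw [← h]
  congr 1; funext t
  congr 2
  ring

lemma planch {f : ℝ → ℝ} (hf : Integrable f) (hf2 : Integrable (fun v => f v ^ 2)) {b : ℝ} (hb : 0 < b) :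
    ∫ t : ℝ, Real.exp (-b * t ^ 2) * ‖ft f t‖ ^ 2 ≤ 2 * π * ∫ v, f v ^ 2 := by
  set W : ℝ → ℝ := fun y => √(π / b) * Real.exp (-(1 / (4 * b)) * y ^ 2) with hW
  have hW0 : ∀ y, 0 ≤ W y := fun y => by positivity
  have hWi : Integrable W := (integrable_exp_neg_mul_sq (by positivity)).const_mul _
  have hWint : ∫ y, W y = 2 * π := by
    rw [hW, integral_const_mul, integral_gaussian, ← Real.sqrt_mul (by positivity)]
    have : π / b * (π / (1 / (4 * b))) = (2 * π) ^ 2 := by field_simp; ring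
    rw [this, Real.sqrt_sq (by positivity)]
  have hwi : Integrable (fun t : ℝ => Real.exp (-b * t ^ 2)) := integrable_exp_neg_mul_sq hb
  have hff : Integrable (fun p : ℝ × ℝ => (f p.1 : ℂ) * (f p.2 : ℂ)) (volume.prod volume) := hf.ofReal.mul_prod hf.ofReal
  have key : ((∫ t : ℝ, Real.exp (-b * t ^ 2) * ‖ft f t‖ ^ 2 : ℝ) : ℂ) = ∫ p : ℝ × ℝ, (f p.1 : ℂ) * (f p.2 : ℂ) * (W (p.1 - p.2) : ℂ) := by
    have h1 : ∀ t : ℝ, ((Real.exp (-b * t ^ 2) * ‖ft f t‖ ^ 2 : ℝ) : ℂ) =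
        ∫ p : ℝ × ℝ, (Real.exp (-b * t ^ 2) : ℂ) * ((f p.1 : ℂ) * (f p.2 : ℂ) * cexp (-(I * t) * (p.1 - p.2 : ℝ))) := by
      intro t
      rw [integral_const_mul]
      push_cast
      congr 1
      rw [← Complex.mul_conj']
      have hc : (starRingEnd ℂ) (ft f t) = ∫ v : ℝ, (f v : ℂ) * cexp ((I * t) * v) := by
        rw [ft, ← integral_conj]
        congr 1; funext v
        rw [map_mul, Complex.conj_ofReal, ← Complex.exp_conj]
        simp
      rw [hc, ft]
      have := integral_prod_mul (μ := (volume : Measure ℝ)) (ν := (volume : Measure ℝ)) (fun v : ℝ => (f v : ℂ) * cexp (-(I * t) * v)) (fun v : ℝ => (f v : ℂ) * cexp ((I * t) * v))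
      rw [← this]
      refine integral_congr_ae (Eventually.of_forall fun p => ?_)
      beta_reduce
      have e : cexp (-(I * t) * (p.1 - p.2)) = cexp (-(I * t) * p.1) * cexp ((I * t) * p.2) := by
        rw [← Complex.exp_add]; congr 1; ring
      rw [e]; ring
    rw [← integral_complex_ofReal]
    simp_rw [h1]
    rw [integral_integral_swap]
    · refine integral_congr_ae (Eventually.of_forall fun p => ?_)
      beta_reduce
      have := gauss_ft hb (p.1 - p.2)
      rw [hW]
      beta_reduce
      rw [← this, ← integral_const_mul]
      congr 1; funext t; ring
    · have hI : Integrable (fun q : ℝ × (ℝ × ℝ) => (Real.exp (-b * q.1 ^ 2) : ℂ) * ((f q.2.1 : ℂ) * (f q.2.2 : ℂ))) (volume.prod volume) :=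
        hwi.ofReal.mul_prod hff
      have hm : Measurable (fun q : ℝ × (ℝ × ℝ) => cexp (-(I * q.1) * (q.2.1 - q.2.2 : ℝ))) := by fun_prop
      have := hI.bdd_mul (c := 1) hm.aestronglyMeasurable (Eventually.of_forall fun q => by
        rw [norm_cexp_I])
      refine this.congr (Eventually.of_forall fun q => ?_)
      simp only [Function.uncurry]
      ring
  have i1 : Integrable (fun p : ℝ × ℝ => f p.2 ^ 2 * W (p.1 - p.2)) (volume.prod volume) := by
    have := Integrable.convolution_integrand (ContinuousLinearMap.mul ℝ ℝ) hf2 hWi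
    simpa using this
  have hWe : ∀ x y, W (x - y) = W (y - x) := fun x y => by
    rw [hW]; beta_reduce; congr 3; ring
  have i2 : Integrable (fun p : ℝ × ℝ => f p.1 ^ 2 * W (p.1 - p.2)) (volume.prod volume) := by
    have := i1.swap
    refine this.congr (Eventually.of_forall fun p => ?_)
    simp only [Function.comp, Prod.swap]
    rw [hWe]
  have v2 : ∫ p : ℝ × ℝ, f p.1 ^ 2 * W (p.1 - p.2) = 2 * π * ∫ v, f v ^ 2 := by
    have := integral_prod _ i2
    rw [Measure.volume_eq_prod, this]
    simp_rw [integral_const_mul]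
    have : ∀ x, ∫ y, W (x - y) = 2 * π := fun x => by rw [integral_sub_left_eq_self W volume x, hWint]
    simp_rw [this]
    rw [integral_mul_const, mul_comm]
  have v1 : ∫ p : ℝ × ℝ, f p.2 ^ 2 * W (p.1 - p.2) = 2 * π * ∫ v, f v ^ 2 := by
    rw [← v2]
    rw [Measure.volume_eq_prod, ← integral_prod_swap]
    congr 1; funext p
    simp only [Prod.fst_swap, Prod.snd_swap]
    rw [hWe]
  have hnn : 0 ≤ ∫ t : ℝ, Real.exp (-b * t ^ 2) * ‖ft f t‖ ^ 2 := integral_nonneg fun t => by positivity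
  calc _ = ‖((∫ t : ℝ, Real.exp (-b * t ^ 2) * ‖ft f t‖ ^ 2 : ℝ) : ℂ)‖ := by
        rw [Complex.norm_real, Real.norm_of_nonneg hnn]
    _ ≤ ∫ p : ℝ × ℝ, (1 / 2 * (f p.1 ^ 2 * W (p.1 - p.2)) + 1 / 2 * (f p.2 ^ 2 * W (p.1 - p.2))) := by
        rw [key]
        refine norm_integral_le_of_norm_le ?_ (Eventually.of_forall fun p => ?_)
        · exact (i2.const_mul _).add (i1.const_mul _)
        · rw [norm_mul, norm_mul, Complex.norm_real, Complex.norm_real, Complex.norm_real, Real.norm_of_nonneg (hW0 _)]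
          have : ‖f p.1‖ * ‖f p.2‖ ≤ 1 / 2 * f p.1 ^ 2 + 1 / 2 * f p.2 ^ 2 := by
            rw [Real.norm_eq_abs, Real.norm_eq_abs, ← sq_abs (f p.1), ← sq_abs (f p.2)]
            nlinarith [sq_nonneg (|f p.1| - |f p.2|)]
          have := mul_le_mul_of_nonneg_right this (hW0 (p.1 - p.2))
          linarith
    _ = 2 * π * ∫ v, f v ^ 2 := by
        rw [Measure.volume_eq_prod] at v1 v2
        rw [Measure.volume_eq_prod, integral_add (i2.const_mul _) (i1.const_mul _), integral_const_mul, integral_const_mul, v1, v2]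
        ring

lemma planch_int {f : ℝ → ℝ} (hf : Integrable f) (hf2 : Integrable (fun v => f v ^ 2)) {a b : ℝ} (ha : 0 ≤ a) (hab : a ≤ b) :
    ∫ t in a..b, ‖ft f t‖ ^ 2 ≤ 20 * ∫ v, f v ^ 2 := by
  by_cases hb0 : b = 0
  · have : a = 0 := by linarith
    rw [this, hb0]; simp
    exact integral_nonneg fun v => sq_nonneg _
  have hb : 0 < b := lt_of_le_of_ne (ha.trans hab) (Ne.symm hb0)
  have hc := ft_cont hf
  have h1 := planch hf hf2 (b := 1 / b ^ 2) (by positivity)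
  have hintg : Integrable (fun t : ℝ => Real.exp (-(1 / b ^ 2) * t ^ 2) * ‖ft f t‖ ^ 2) := by
    have hw : Integrable (fun t : ℝ => Real.exp (-(1 / b ^ 2) * t ^ 2)) := integrable_exp_neg_mul_sq (by positivity)
    refine Integrable.mono' (hw.mul_const ((∫ v, ‖f v‖) ^ 2)) (Continuous.aestronglyMeasurable (by fun_prop)) (Eventually.of_forall fun t => ?_)
    rw [Real.norm_of_nonneg (by positivity)]
    gcongr
    exact ft_le t
  have hcc : Continuous (fun t => ‖ft f t‖ ^ 2) := by fun_prop
  calc _ ≤ ∫ t in a..b, Real.exp 1 * (Real.exp (-(1 / b ^ 2) * t ^ 2) * ‖ft f t‖ ^ 2) := by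
        refine intervalIntegral.integral_mono_on hab (hcc.intervalIntegrable _ _) (Continuous.intervalIntegrable (by fun_prop) _ _) fun t ht => ?_
        rw [← mul_assoc, ← Real.exp_add]
        have : 0 ≤ 1 + -(1 / b ^ 2) * t ^ 2 := by
          have : t ^ 2 ≤ b ^ 2 := by gcongr; exact ha.trans ht.1; exact ht.2
          have : 1 / b ^ 2 * t ^ 2 ≤ 1 := by rw [one_div_mul_eq_div, div_le_one (by positivity)]; exact this
          linarith
        have := Real.one_le_exp this
        nlinarith [sq_nonneg ‖ft f t‖]
    _ = Real.exp 1 * ∫ t in Ioc a b, (Real.exp (-(1 / b ^ 2) * t ^ 2) * ‖ft f t‖ ^ 2) := by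
        rw [intervalIntegral.integral_const_mul, intervalIntegral.integral_of_le hab]
    _ ≤ Real.exp 1 * ∫ t, (Real.exp (-(1 / b ^ 2) * t ^ 2) * ‖ft f t‖ ^ 2) := by
        exact mul_le_mul_of_nonneg_left (setIntegral_le_integral hintg (Eventually.of_forall fun t => by positivity)) (Real.exp_pos 1).le
    _ ≤ Real.exp 1 * (2 * π * ∫ v, f v ^ 2) := by gcongr
    _ ≤ _ := by
        rw [← mul_assoc]
        have h3 := Real.exp_one_lt_d9
        have h4 := Real.pi_lt_d2
        have : 0 ≤ ∫ v, f v ^ 2 := integral_nonneg fun v => sq_nonneg _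
        gcongr
        have := Real.exp_pos 1
        nlinarith [Real.pi_pos]
end FZ

namespace FZ

lemma one_sub_exp_low (z : ℂ) : Real.exp z.re * |Real.sin z.im| ≤ ‖1 - cexp z‖ := by
  have h := Complex.abs_im_le_norm (1 - cexp z)
  rw [Complex.sub_im, Complex.exp_im, Complex.one_im, zero_sub, abs_neg, abs_mul, abs_of_pos (Real.exp_pos _)] at h
  exact h

lemma sin_low {x : ℝ} (h1 : 1 / 2 ≤ x) (h2 : x ≤ 5 / 2) : 1 / 4 ≤ Real.sin x := by
  have hp3 := Real.pi_gt_d2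
  have hp4 := Real.pi_lt_d2
  rcases le_total x (π / 2) with h | h
  · have := Real.mul_le_sin (by linarith) h
    have h5 : 1 / 4 ≤ 2 / π := by rw [le_div_iff₀ Real.pi_pos]; linarith
    have h6 : 1 / 2 ≤ 2 / π := by rw [le_div_iff₀ Real.pi_pos]; linarith
    nlinarith
  · have := Real.mul_le_sin (x := π - x) (by linarith) (by linarith)
    rw [Real.sin_pi_sub] at this
    have h6 : 1 / 2 ≤ 2 / π := by rw [le_div_iff₀ Real.pi_pos]; linarith
    nlinarith

lemma F_low {T σ t : ℝ} (hT : 1 ≤ T) (h0 : 0 < σ) (h6 : σ ≤ 6) (ht1 : T / 2 ≤ t) (ht2 : t ≤ 5 * T / 2) :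
    Real.exp (-7) / 144 / T ≤ ‖(1 - cexp (-((1 / T : ℝ) : ℂ) * (σ + I * t))) * (1 - cexp (((1 / T : ℝ) : ℂ) * ((σ + I * t) - 1))) / (σ + I * t)‖ := by
  have hT0 : 0 < T := by linarith
  have hτ : 0 < 1 / T := by positivity
  have hτ1 : 1 / T ≤ 1 := by rw [div_le_one hT0]; exact hT
  have hx1 : 1 / 2 ≤ 1 / T * t := by rw [one_div_mul_eq_div, le_div_iff₀ hT0]; linarith
  have hx2 : 1 / T * t ≤ 5 / 2 := by rw [one_div_mul_eq_div, div_le_iff₀ hT0]; linarith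
  have hs := sin_low hx1 hx2
  have a1 := one_sub_exp_low (-((1 / T : ℝ) : ℂ) * (σ + I * t))
  have a2 := one_sub_exp_low (((1 / T : ℝ) : ℂ) * ((σ + I * t) - 1))
  have r1 : (-((1 / T : ℝ) : ℂ) * (σ + I * t)).re = -(1 / T * σ) := by
    rw [← Complex.ofReal_neg, Complex.re_ofReal_mul]; simp
  have i1 : (-((1 / T : ℝ) : ℂ) * (σ + I * t)).im = -(1 / T * t) := by
    rw [← Complex.ofReal_neg, Complex.im_ofReal_mul]; simp
  have r2 : (((1 / T : ℝ) : ℂ) * ((σ + I * t) - 1)).re = 1 / T * (σ - 1) := by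
    rw [Complex.re_ofReal_mul]; simp
  have i2 : (((1 / T : ℝ) : ℂ) * ((σ + I * t) - 1)).im = 1 / T * t := by
    rw [Complex.im_ofReal_mul]; simp
  rw [r1, i1, Real.sin_neg, abs_neg, abs_of_pos (by linarith)] at a1
  rw [r2, i2, abs_of_pos (by linarith)] at a2
  have b1 : Real.exp (-6) * (1 / 4) ≤ ‖1 - cexp (-((1 / T : ℝ) : ℂ) * (σ + I * t))‖ := by
    refine le_trans ?_ a1
    have : -6 ≤ -(1 / T * σ) := by nlinarith
    gcongr
  have b2 : Real.exp (-1) * (1 / 4) ≤ ‖1 - cexp (((1 / T : ℝ) : ℂ) * ((σ + I * t) - 1))‖ := by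
    refine le_trans ?_ a2
    have : -1 ≤ 1 / T * (σ - 1) := by nlinarith
    gcongr
  have b3 : ‖(σ + I * t : ℂ)‖ ≤ 9 * T := by
    refine (norm_add_le _ _).trans ?_
    rw [norm_mul, Complex.norm_I, Complex.norm_real, Complex.norm_real, Real.norm_of_nonneg h0.le, Real.norm_of_nonneg (by linarith)]
    linarith
  have b4 : 0 < ‖(σ + I * t : ℂ)‖ := by
    rw [norm_pos_iff]; intro h
    have := congrArg Complex.re h
    simp at this; linarith
  rw [norm_div, norm_mul, le_div_iff₀ b4]
  calc _ ≤ Real.exp (-7) / 144 / T * (9 * T) := by gcongr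
    _ = (Real.exp (-6) * (1 / 4)) * (Real.exp (-1) * (1 / 4)) := by
        rw [show (-7:ℝ) = -6 + -1 by norm_num, Real.exp_add]; field_simp; norm_num
    _ ≤ _ := by gcongr

lemma lap_eq_ft (f : ℝ → ℝ) (σ t : ℝ) : lap f (σ + I * t) = ft (fun v => f v * Real.exp (-σ * v)) t := by
  rw [lap, ft]
  congr 1; funext v
  push_cast
  rw [mul_assoc, ← Complex.exp_add]
  congr 2; ring

lemma bdd_supp_int {f : ℝ → ℝ} {B σ : ℝ} (hm : Measurable f) (hσ : 0 < σ) (hB : ∀ v, |f v| ≤ B)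
    (h0 : ∀ v ≤ 0, f v = 0) : Integrable (fun v => f v * Real.exp (-σ * v)) ∧ ∫ v, |f v * Real.exp (-σ * v)| ≤ B / σ := by
  have hg : Integrable ((Ioi (0:ℝ)).indicator fun v => B * Real.exp (-σ * v)) := by
    rw [integrable_indicator_iff measurableSet_Ioi]
    exact ((integrableOn_exp_mul_Ioi (by linarith) 0)).const_mul B
  have hb : ∀ v, |f v * Real.exp (-σ * v)| ≤ (Ioi (0:ℝ)).indicator (fun v => B * Real.exp (-σ * v)) v := by
    intro v
    by_cases hv : 0 < v
    · rw [indicator_of_mem (show v ∈ Ioi (0:ℝ) from hv), abs_mul, abs_of_pos (Real.exp_pos _)]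
      gcongr; exact hB v
    · rw [indicator_of_notMem (by simpa using hv), h0 v (by linarith)]; simp
  have hi : Integrable (fun v => f v * Real.exp (-σ * v)) := by
    refine hg.mono' (by fun_prop) (Eventually.of_forall hb)
  refine ⟨hi, (integral_mono hi.abs hg hb).trans ?_⟩
  rw [integral_indicator measurableSet_Ioi, integral_const_mul, integral_exp_mul_Ioi (by linarith)]
  simp; rw [div_eq_mul_inv]

lemma ph_int {Y σ : ℝ} (hY : Real.exp 1 ≤ Y) (hσ : 0 < σ) :
    Integrable (fun v => ph Y (1 / Y ^ 32) v * Real.exp (-σ * v)) ∧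
    Integrable (fun v => (ph Y (1 / Y ^ 32) v * Real.exp (-σ * v)) ^ 2) ∧
    ∫ v, (ph Y (1 / Y ^ 32) v * Real.exp (-σ * v)) ^ 2 ≤ 2 * Y ^ 4 / σ := by
  have h2 : (2:ℝ) ≤ Real.exp 1 := by have := Real.add_one_le_exp (1:ℝ); linarith
  have hY1 : 2 ≤ Y := h2.trans hY
  have hL : 1 ≤ Real.log Y := by rw [Real.le_log_iff_exp_le (by linarith)]; exact hY
  have hτ : (1:ℝ) / Y ^ 32 ≤ 1 / 2 := by
    have : (2:ℝ) ≤ Y ^ 32 := hY1.trans (le_self_pow₀ (by linarith) (by norm_num))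
    gcongr
  have hτ0 : 0 ≤ (1:ℝ) / Y ^ 32 := by positivity
  have hz : ∀ v ≤ 0, ph Y (1 / Y ^ 32) v = 0 := fun v hv => ph_zero (by linarith) hτ0 (by linarith)
  have hb := ph_abs_le (Y := Y) (by linarith) hτ0 (by linarith)
  have hm := ph_meas (Y := Y) (τ := 1 / Y ^ 32)
  have A := bdd_supp_int (f := ph Y (1 / Y ^ 32)) hm hσ hb hz
  have B := bdd_supp_int (f := fun v => ph Y (1 / Y ^ 32) v ^ 2) (B := (2 * Y ^ 2) ^ 2) (σ := 2 * σ) (hm.pow_const 2) (by linarith)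
    (fun v => by
      rw [abs_pow]; gcongr; exact hb v) (fun v hv => by rw [hz v hv]; norm_num)
  have e : ∀ v, ph Y (1 / Y ^ 32) v ^ 2 * Real.exp (-(2 * σ) * v) = (ph Y (1 / Y ^ 32) v * Real.exp (-σ * v)) ^ 2 := by
    intro v
    rw [mul_pow, ← Real.exp_nat_mul]; congr 2; push_cast; ring
  simp_rw [e] at B
  refine ⟨A.1, B.1, ?_⟩
  have := B.2
  simp_rw [abs_sq] at this
  refine this.trans (le_of_eq ?_)
  field_simp

lemma ph_L2_shift : ∃ K > 0, ∀ Y ≥ Real.exp 1, ∀ σ : ℝ, 1 / 2 + 1 / Real.log Y ≤ σ → σ ≤ 6 →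
    ∫ v, (ph Y (1 / Y ^ 32) v * Real.exp (-σ * v)) ^ 2 ≤ K * (1 / Y ^ 32) * Real.exp (-2 * (σ - 1 / 2 - 1 / Real.log Y) * Real.log Y) := by
  obtain ⟨K, hK, h⟩ := ph_L2
  refine ⟨K * Real.exp 12, by positivity, fun Y hY σ h1 h6 => ?_⟩
  obtain ⟨hi, hle⟩ := h Y hY
  have h2 : (2:ℝ) ≤ Real.exp 1 := by have := Real.add_one_le_exp (1:ℝ); linarith
  have hY1 : 2 ≤ Y := h2.trans hY
  have hL : 1 ≤ Real.log Y := by rw [Real.le_log_iff_exp_le (by linarith)]; exact hY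
  have hτ : (1:ℝ) / Y ^ 32 ≤ 1 / 2 := by
    have : (2:ℝ) ≤ Y ^ 32 := hY1.trans (le_self_pow₀ (by linarith) (by norm_num))
    gcongr
  have hτ0 : 0 ≤ (1:ℝ) / Y ^ 32 := by positivity
  have hl0 : 0 < 1 / Real.log Y := by positivity
  set D := σ - 1 / 2 - 1 / Real.log Y with hD
  have hD0 : 0 ≤ D := by linarith
  have hI := (ph_int hY (σ := σ) (by linarith)).2.1
  have hpt : ∀ v, (ph Y (1 / Y ^ 32) v * Real.exp (-σ * v)) ^ 2 ≤ (Real.exp 12 * Real.exp (-2 * D * Real.log Y)) * (ph Y (1 / Y ^ 32) v ^ 2 * Real.exp (-(1 + 2 / Real.log Y) * v)) := by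
    intro v
    rcases le_total v (Real.log Y - 1 / Y ^ 32) with hv | hv
    · rw [ph_zero (by linarith) hτ0 hv]; simp
    · rw [mul_pow, ← Real.exp_nat_mul, ← Real.exp_add, mul_left_comm (Real.exp _), ← Real.exp_add]
      have : ((2:ℕ):ℝ) * (-σ * v) ≤ 12 + -2 * D * Real.log Y + -(1 + 2 / Real.log Y) * v := by
        have e : (2 / Real.log Y) = 2 * (1 / Real.log Y) := by ring
        have e2 : σ = D + 1 / 2 + 1 / Real.log Y := by rw [hD]; ring
        rw [e, e2]; push_cast
        nlinarith
      gcongr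
  calc _ ≤ ∫ v, (Real.exp 12 * Real.exp (-2 * D * Real.log Y)) * (ph Y (1 / Y ^ 32) v ^ 2 * Real.exp (-(1 + 2 / Real.log Y) * v)) :=
        integral_mono hI (hi.const_mul _) hpt
    _ ≤ (Real.exp 12 * Real.exp (-2 * D * Real.log Y)) * (K * (1 / Y ^ 32)) := by
        rw [integral_const_mul]
        exact mul_le_mul_of_nonneg_left hle (by positivity)
    _ = _ := by ring

lemma g_mean_gen {Y σ : ℝ} (hY : Real.exp 1 ≤ Y) (hσ : 0 < σ) (hσ6 : σ ≤ 6) :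
    ∫ t in (Y ^ 32 / 2)..(5 * Y ^ 32 / 2), ‖gf Y (σ + I * t)‖ ^ 2 ≤
      (144 * Real.exp 7 * Y ^ 32) ^ 2 * (20 * ∫ v, (ph Y (1 / Y ^ 32) v * Real.exp (-σ * v)) ^ 2) := by
  have h2 : (2:ℝ) ≤ Real.exp 1 := by have := Real.add_one_le_exp (1:ℝ); linarith
  have hY1 : 2 ≤ Y := h2.trans hY
  have hL : 1 ≤ Real.log Y := by rw [Real.le_log_iff_exp_le (by linarith)]; exact hY
  have hT2 : (2:ℝ) ≤ Y ^ 32 := hY1.trans (le_self_pow₀ (by linarith) (by norm_num))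
  have hτ : (1:ℝ) / Y ^ 32 ≤ 1 / 2 := by
    gcongr
  obtain ⟨hi, hi2, -⟩ := ph_int hY hσ
  have hab : Y ^ 32 / 2 ≤ 5 * Y ^ 32 / 2 := by linarith
  have hP := planch_int hi hi2 (a := Y ^ 32 / 2) (b := 5 * Y ^ 32 / 2) (by positivity) hab
  have hcc := ft_cont hi
  calc _ ≤ ∫ t in (Y ^ 32 / 2)..(5 * Y ^ 32 / 2), (144 * Real.exp 7 * Y ^ 32) ^ 2 * ‖ft (fun v => ph Y (1 / Y ^ 32) v * Real.exp (-σ * v)) t‖ ^ 2 := by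
        refine intervalIntegral.integral_mono_on hab (ContinuousOn.intervalIntegrable ?_) (Continuous.intervalIntegrable (by fun_prop) _ _) fun t ht => ?_
        · intro t ht
          rw [uIcc_of_le hab] at ht
          have hne : (σ + I * t : ℂ) ≠ 1 := by
            intro h
            have := congrArg Complex.im h
            simp at this; linarith [ht.1]
          have hc : ContinuousAt (fun t : ℝ => gf Y (σ + I * t)) t := by
            have := (gf_diff (Y := Y) hne).continuousAt
            exact ContinuousAt.comp (f := fun t : ℝ => (σ + I * t : ℂ)) this (by fun_prop)
          exact (hc.norm.pow 2).continuousWithinAt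
        · rw [← lap_eq_ft, lap_ph (by linarith) (by positivity) (by linarith) (by simpa using hσ) (by simp; linarith [ht.1]), norm_mul, ← mul_pow, ← mul_assoc, mul_pow _ ‖gf Y (σ + I * t)‖]
          have hF := F_low (T := Y ^ 32) (by linarith) hσ hσ6 ht.1 ht.2
          have h1 : 1 ≤ 144 * Real.exp 7 * Y ^ 32 * ‖(1 - cexp (-((1 / Y ^ 32 : ℝ) : ℂ) * (σ + I * t))) * (1 - cexp (((1 / Y ^ 32 : ℝ) : ℂ) * ((σ + I * t) - 1))) / (σ + I * t)‖ := by
            calc (1:ℝ) = 144 * Real.exp 7 * Y ^ 32 * (Real.exp (-7) / 144 / Y ^ 32) := by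
                  rw [Real.exp_neg]; field_simp
              _ ≤ _ := by gcongr
          refine le_mul_of_one_le_left (by positivity) ?_
          exact one_le_pow₀ h1
    _ = (144 * Real.exp 7 * Y ^ 32) ^ 2 * ∫ t in (Y ^ 32 / 2)..(5 * Y ^ 32 / 2), ‖ft (fun v => ph Y (1 / Y ^ 32) v * Real.exp (-σ * v)) t‖ ^ 2 :=
        intervalIntegral.integral_const_mul _ _
    _ ≤ _ := mul_le_mul_of_nonneg_left hP (by positivity)

lemma g_mean : ∃ K > 0, ∀ Y ≥ Real.exp 1, ∀ σ : ℝ, 1 / 2 + 1 / Real.log Y ≤ σ → σ ≤ 6 →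
    ∫ t in (Y ^ 32 / 2)..(5 * Y ^ 32 / 2), ‖gf Y (σ + I * t)‖ ^ 2 ≤ K * Y ^ 32 * Real.exp (-2 * (σ - 1 / 2 - 1 / Real.log Y) * Real.log Y) := by
  obtain ⟨K, hK, h⟩ := ph_L2_shift
  refine ⟨(144 * Real.exp 7) ^ 2 * 20 * K, by positivity, fun Y hY σ h1 h6 => ?_⟩
  have hY1 : 0 < Y := (Real.exp_pos 1).trans_le hY
  have hL : 0 < Real.log Y := by
    have : 1 ≤ Real.log Y := by rw [Real.le_log_iff_exp_le (by linarith)]; exact hY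
    linarith
  have : 0 < 1 / Real.log Y := by positivity
  refine (g_mean_gen hY (by linarith) h6).trans ?_
  refine (mul_le_mul_of_nonneg_left (mul_le_mul_of_nonneg_left (h Y hY σ h1 h6) (by norm_num)) (by positivity)).trans (le_of_eq ?_)
  field_simp

lemma g_mean_crude : ∃ K > 0, ∀ Y ≥ Real.exp 1, ∀ σ : ℝ, 1 / 4 ≤ σ → σ ≤ 6 →
    ∫ t in (Y ^ 32 / 2)..(5 * Y ^ 32 / 2), ‖gf Y (σ + I * t)‖ ^ 2 ≤ K * Y ^ 68 := by
  refine ⟨(144 * Real.exp 7) ^ 2 * 20 * 8, by positivity, fun Y hY σ h1 h6 => ?_⟩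
  have hY1 : 0 < Y := (Real.exp_pos 1).trans_le hY
  refine (g_mean_gen hY (by linarith) h6).trans ?_
  have h3 := (ph_int hY (σ := σ) (by linarith)).2.2
  have h4 : 2 * Y ^ 4 / σ ≤ 8 * Y ^ 4 := by
    rw [div_le_iff₀ (by linarith)]
    have : 0 < Y ^ 4 := by positivity
    nlinarith
  refine (mul_le_mul_of_nonneg_left (mul_le_mul_of_nonneg_left (h3.trans h4) (by norm_num)) (by positivity)).trans (le_of_eq ?_)
  ring
end FZ

namespace FZ

lemma jensen_ge {f : ℂ → ℂ} {c : ℂ} {R : ℝ} (hR : 0 < R) (hf : AnalyticOnNhd ℂ f (Metric.closedBall c R))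
    (hc : f c ≠ 0) (S : Finset ℂ) (m : ℂ → ℕ) (hS : ∀ ρ ∈ S, ρ ∈ Metric.closedBall c R)
    (hm : ∀ ρ ∈ S, (m ρ : ℕ∞) ≤ analyticOrderAt f ρ) :
    ∑ ρ ∈ S, (m ρ : ℝ) * Real.log (R * ‖c - ρ‖⁻¹) + Real.log ‖f c‖ ≤ Real.circleAverage (fun z => Real.log ‖f z‖) c R := by
  have hf' : AnalyticOnNhd ℂ f (Metric.closedBall c |R|) := by rwa [abs_of_pos hR]
  rw [hf'.circleAverage_log_norm hR.ne' hc, abs_of_pos hR]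
  have hfin : ∀ u ∈ Metric.closedBall c R, analyticOrderAt f u ≠ ⊤ := by
    intro u hu h
    rw [analyticOrderAt_eq_top] at h
    have := hf.eqOn_zero_of_preconnected_of_eventuallyEq_zero (convex_closedBall c R).isPreconnected hu h
    exact hc (this (Metric.mem_closedBall_self hR.le))
  have hlog : ∀ u ∈ Metric.closedBall c R, 0 ≤ Real.log (R * ‖c - u‖⁻¹) := by
    intro u hu
    rw [mem_closedBall_iff_norm'] at hu
    by_cases h0 : ‖c - u‖ = 0
    · rw [h0]; simp
    · refine Real.log_nonneg ?_
      have : 0 < ‖c - u‖ := lt_of_le_of_ne (norm_nonneg _) (Ne.symm h0)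
      rw [← div_eq_mul_inv, le_div_iff₀ this]; linarith
  have hterm : ∀ u, 0 ≤ ((MeromorphicOn.divisor f (Metric.closedBall c R) u : ℤ) : ℝ) * Real.log (R * ‖c - u‖⁻¹) := by
    intro u
    by_cases hu : u ∈ Metric.closedBall c R
    · exact mul_nonneg (by exact_mod_cast MeromorphicOn.AnalyticOnNhd.divisor_nonneg hf u) (hlog u hu)
    · simp [hu]
  have hsupp := (MeromorphicOn.divisor f (Metric.closedBall c R)).finiteSupport (isCompact_closedBall c R)
  have hsub : Function.support (fun u => ((MeromorphicOn.divisor f (Metric.closedBall c R) u : ℤ) : ℝ) * Real.log (R * ‖c - u‖⁻¹)) ⊆ ↑(hsupp.toFinset ∪ S) := by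
    intro u hu
    rw [Finset.coe_union]
    left
    simp only [Finite.coe_toFinset, Function.mem_support]
    intro h
    apply hu
    simp [h]
  rw [finsum_eq_sum_of_support_subset _ hsub]
  gcongr ?_ + _
  calc _ ≤ ∑ u ∈ S, ((MeromorphicOn.divisor f (Metric.closedBall c R) u : ℤ) : ℝ) * Real.log (R * ‖c - u‖⁻¹) := by
        refine Finset.sum_le_sum fun ρ hρ => ?_
        refine mul_le_mul_of_nonneg_right ?_ (hlog ρ (hS ρ hρ))
        rw [MeromorphicOn.AnalyticOnNhd.divisor_apply hf (hS ρ hρ)]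
        have h1 := hm ρ hρ
        have h2 := hfin ρ (hS ρ hρ)
        lift analyticOrderAt f ρ to ℕ using h2 with n
        simp only [Nat.cast_le] at h1
        simp
        exact_mod_cast h1
    _ ≤ _ := Finset.sum_le_sum_of_subset_of_nonneg Finset.subset_union_right fun u _ _ => hterm u

/-- `1 - g²` -/
noncomputable def hf (Y : ℝ) (s : ℂ) : ℂ := 1 - gf Y s ^ 2

lemma Mf_diff (Y : ℝ) : Differentiable ℂ (Mf Y) := by
  unfold Mf
  refine Differentiable.fun_sum fun h hh => ?_
  have h0 : (h : ℂ) ≠ 0 := by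
    have := (Finset.mem_Ioc.1 hh).1
    exact_mod_cast this.ne'
  exact (differentiable_const _).mul (Differentiable.const_cpow (differentiable_id.neg) (Or.inl h0))

lemma an_of_diff {f : ℂ → ℂ} (h : ∀ s ≠ 1, DifferentiableAt ℂ f s) {s : ℂ} (hs : s ≠ 1) : AnalyticAt ℂ f s := by
  have : DifferentiableOn ℂ f {1}ᶜ := fun z hz => (h z hz).differentiableWithinAt
  exact this.analyticAt (isOpen_compl_singleton.mem_nhds hs)

lemma hf_an {Y : ℝ} {s : ℂ} (hs : s ≠ 1) : AnalyticAt ℂ (hf Y) s := by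
  refine an_of_diff (fun s hs => ?_) hs
  exact (differentiableAt_const _).sub ((gf_diff hs).pow 2)

lemma zeta_an {s : ℂ} (hs : s ≠ 1) : AnalyticAt ℂ riemannZeta s :=
  an_of_diff (fun _ h => differentiableAt_riemannZeta h) hs

noncomputable def zm (ρ : ℂ) : ℕ := (analyticOrderAt riemannZeta ρ).toNat

lemma zm_le {Y : ℝ} {ρ : ℂ} (hs : ρ ≠ 1) : (zm ρ : ℕ∞) ≤ analyticOrderAt (hf Y) ρ := by
  have e : hf Y = riemannZeta * (fun s => Mf Y s * (2 - riemannZeta s * Mf Y s)) := by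
    funext s
    simp only [hf, gf, Pi.mul_apply]; ring
  have a2 : AnalyticAt ℂ (fun s => Mf Y s * (2 - riemannZeta s * Mf Y s)) ρ := by
    refine an_of_diff (fun s hs => ?_) hs
    have := differentiableAt_riemannZeta hs
    have := (Mf_diff Y) s
    fun_prop
  rw [e, analyticOrderAt_mul (zeta_an hs) a2]
  refine (ENat.natCast_toNat_le_self _).trans le_self_add

lemma hf_norm_le (Y : ℝ) (s : ℂ) : Real.log ‖hf Y s‖ ≤ Real.log (1 + ‖gf Y s‖ ^ 2) := by
  by_cases h : hf Y s = 0
  · rw [h]; simp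
    exact Real.log_nonneg (by nlinarith [sq_nonneg ‖gf Y s‖])
  · refine Real.log_le_log (norm_pos_iff.2 h) ?_
    refine (norm_sub_le _ _).trans ?_
    rw [norm_one, norm_pow]

lemma hf_norm_ge {Y : ℝ} {s : ℂ} (h : ‖gf Y s‖ ^ 2 ≤ 1 / 2) : -(2 * ‖gf Y s‖ ^ 2) ≤ Real.log ‖hf Y s‖ ∧ hf Y s ≠ 0 := by
  have h1 : 1 - ‖gf Y s‖ ^ 2 ≤ ‖hf Y s‖ := by
    have := norm_sub_norm_le 1 (gf Y s ^ 2)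
    rwa [norm_one, norm_pow] at this
  have h0 : 0 < ‖hf Y s‖ := by linarith
  refine ⟨?_, norm_pos_iff.1 h0⟩
  set a := ‖gf Y s‖ ^ 2
  have ha : 0 ≤ a := by positivity
  calc -(2 * a) ≤ 1 - (1 - a)⁻¹ := by
        have : (1 - a)⁻¹ ≤ 1 + 2 * a := by
          rw [inv_le_iff_one_le_mul₀ (by linarith)]; nlinarith
        linarith
    _ ≤ Real.log (1 - a) := Real.one_sub_inv_le_log_of_pos (by linarith)
    _ ≤ _ := Real.log_le_log (by linarith) h1

lemma log_geom {σ0 η t : ℝ} {ρ : ℂ} (h1 : σ0 ≤ 1) (h0 : 0 ≤ σ0) (hη : 0 < η) (_hη1 : η ≤ 1) (hβ : σ0 + η ≤ ρ.re) (hβ1 : ρ.re < 1)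
    (ht : |t - ρ.im| ≤ √η) :
    ‖(3 + I * t : ℂ) - ρ‖ ≤ 3 - σ0 ∧ η / 9 ≤ Real.log ((3 - σ0) * ‖(3 + I * t : ℂ) - ρ‖⁻¹) := by
  have hR : 0 < 3 - σ0 := by linarith
  have hn : ‖(3 + I * t : ℂ) - ρ‖ ^ 2 = (3 - ρ.re) ^ 2 + (t - ρ.im) ^ 2 := by
    rw [← Complex.normSq_eq_norm_sq, Complex.normSq_apply]; simp; ring
  have ht2 : (t - ρ.im) ^ 2 ≤ η := by
    rw [← sq_abs, ← Real.sq_sqrt hη.le]; gcongr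
  have hpos : 0 < ‖(3 + I * t : ℂ) - ρ‖ ^ 2 := by rw [hn]; nlinarith
  have hp : 0 < ‖(3 + I * t : ℂ) - ρ‖ := by
    rcases (norm_nonneg ((3 + I * t : ℂ) - ρ)).lt_or_eq with h | h
    · exact h
    · rw [← h] at hpos; norm_num at hpos
  have hle : ‖(3 + I * t : ℂ) - ρ‖ ^ 2 ≤ (3 - σ0) ^ 2 - 2 * η := by
    rw [hn]
    nlinarith
  refine ⟨?_, ?_⟩
  · refine le_of_sq_le_sq ?_ hR.le
    linarith
  · have e : Real.log ((3 - σ0) * ‖(3 + I * t : ℂ) - ρ‖⁻¹) = 1 / 2 * Real.log ((3 - σ0) ^ 2 / ‖(3 + I * t : ℂ) - ρ‖ ^ 2) := by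
      rw [← div_pow, Real.log_pow, ← div_eq_mul_inv]; push_cast; ring
    rw [e]
    have h3 := Real.one_sub_inv_le_log_of_pos (show 0 < (3 - σ0) ^ 2 / ‖(3 + I * t : ℂ) - ρ‖ ^ 2 by positivity)
    rw [inv_div] at h3
    have h4 : ‖(3 + I * t : ℂ) - ρ‖ ^ 2 / (3 - σ0) ^ 2 ≤ 1 - 2 * η / 9 := by
      rw [div_le_iff₀ (by positivity)]
      nlinarith [mul_nonneg h0 hη.le]
    linarith
end FZ

namespace FZ

lemma g3 : ∃ C > 0, ∀ Y : ℝ, 1 < Y → ∀ t : ℝ, ‖gf Y (3 + I * t)‖ ^ 2 ≤ C / Y := by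
  have hsum : Summable (fun n : ℕ => 1 / (n:ℝ) ^ (3 / 2 : ℝ)) := Real.summable_one_div_nat_rpow.2 (by norm_num)
  set A := ∑' n : ℕ, 1 / (n:ℝ) ^ (3 / 2 : ℝ) with hA
  have hA0 : 0 < A := by
    refine hsum.tsum_pos (fun n => by positivity) 1 (by simp)
  refine ⟨A ^ 2, by positivity, fun Y hY t => ?_⟩
  have hre : (3 + I * t : ℂ).re = 3 := by simp
  obtain ⟨h1, h2⟩ := LS_an hY (s := 3 + I * t) (by rw [hre]; norm_num)
  have e : gf Y (3 + I * t) = ∑' n : ℕ, (LSeries.term (fun n => (an Y n : ℂ)) (3 + I * t) n - if n = 1 then 1 else 0) := by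
    rw [gf, ← h2, LSeries, Summable.tsum_sub h1 (summable_of_ne_finset_zero (s := {1}) (by intro b hb; simp at hb; simp [hb]))]
    congr 1
    rw [tsum_ite_eq]
  have hY0 : 0 < Y := by linarith
  have hb : ∀ n : ℕ, ‖LSeries.term (fun n => (an Y n : ℂ)) (3 + I * t) n - if n = 1 then 1 else 0‖ ≤ 1 / √Y * (1 / (n:ℝ) ^ (3 / 2 : ℝ)) := by
    intro n
    rcases Nat.eq_zero_or_pos n with hn | hn
    · rw [hn]; simp
    rcases eq_or_ne n 1 with h | h
    · rw [h, if_pos rfl, LSeries.term_of_ne_zero one_ne_zero, an_one hY]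
      simp
    rw [if_neg h, sub_zero, LSeries.term_of_ne_zero hn.ne']
    rcases le_or_gt (n:ℝ) Y with h3 | h3
    · rw [an_eq_zero hY (by omega) h3]; simp; positivity
    · have hn0 : (0:ℝ) < n := by exact_mod_cast hn
      rw [norm_div, Complex.norm_natCast_cpow_of_pos hn, hre, Complex.norm_real, Real.norm_eq_abs]
      have e3 : (n:ℝ) ^ (3:ℝ) = n * (√n * (n:ℝ) ^ (3 / 2 : ℝ)) := by
        rw [Real.sqrt_eq_rpow, ← Real.rpow_add hn0]
        nth_rewrite 2 [← Real.rpow_one (n:ℝ)]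
        rw [← Real.rpow_add hn0]; norm_num
      rw [e3]
      calc _ ≤ (n:ℝ) / (n * (√n * (n:ℝ) ^ (3 / 2 : ℝ))) := by
            gcongr; exact abs_an_le hY hn
        _ = 1 / √n * (1 / (n:ℝ) ^ (3 / 2 : ℝ)) := by field_simp
        _ ≤ _ := by gcongr
  have h4 : ‖gf Y (3 + I * t)‖ ≤ 1 / √Y * A := by
    rw [e, hA, ← tsum_mul_left]
    exact tsum_of_norm_bounded (hsum.mul_left _).hasSum hb
  calc _ ≤ (1 / √Y * A) ^ 2 := by gcongr
    _ = _ := by rw [mul_pow, div_pow, Real.sq_sqrt hY0.le]; ring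

lemma fubini_rect {F : ℝ → ℝ → ℝ} {a b c d : ℝ} (hab : a ≤ b) (hcd : c ≤ d)
    (hF : ContinuousOn (Function.uncurry F) (Icc a b ×ˢ Icc c d)) :
    IntervalIntegrable (fun t => ∫ θ in c..d, F t θ) volume a b ∧
    IntervalIntegrable (fun θ => ∫ t in a..b, F t θ) volume c d ∧
    ∫ t in a..b, ∫ θ in c..d, F t θ = ∫ θ in c..d, ∫ t in a..b, F t θ := by
  have hI : Integrable (Function.uncurry F) ((volume.restrict (Ioc a b)).prod (volume.restrict (Ioc c d))) := by
    rw [Measure.prod_restrict]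
    have : IntegrableOn (Function.uncurry F) (Icc a b ×ˢ Icc c d) (volume.prod volume) := by
      rw [← Measure.volume_eq_prod]
      exact hF.integrableOn_compact (isCompact_Icc.prod isCompact_Icc)
    exact this.mono_set (prod_mono Ioc_subset_Icc_self Ioc_subset_Icc_self)
  simp_rw [intervalIntegral.integral_of_le hab, intervalIntegral.integral_of_le hcd, intervalIntegrable_iff_integrableOn_Ioc_of_le hab, intervalIntegrable_iff_integrableOn_Ioc_of_le hcd]
  exact ⟨hI.integral_prod_left, hI.integral_prod_right, integral_integral_swap hI⟩

/-- the integrand -/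
noncomputable def Lg (Y : ℝ) (s : ℂ) : ℝ := Real.log (1 + ‖gf Y s‖ ^ 2)

lemma Lg_nonneg (Y : ℝ) (s : ℂ) : 0 ≤ Lg Y s := Real.log_nonneg (by nlinarith [sq_nonneg ‖gf Y s‖])

lemma Lg_cont {Y : ℝ} {s : ℂ} (hs : s ≠ 1) : ContinuousAt (Lg Y) s := by
  have := (gf_diff (Y := Y) hs).continuousAt
  unfold Lg
  refine ContinuousAt.log (by fun_prop) ?_
  positivity

lemma Lg_cont_on {Y : ℝ} {X : Type*} [TopologicalSpace X] {f : X → ℂ} (hf : Continuous f) {s : Set X} (h : ∀ x ∈ s, f x ≠ 1) :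
    ContinuousOn (fun x => Lg Y (f x)) s := fun x hx =>
  (ContinuousAt.comp (f := f) (Lg_cont (h x hx)) hf.continuousAt).continuousWithinAt

lemma jensen_pt {Y σ0 η t c0 : ℝ} (hc0 : ∀ t : ℝ, ‖gf Y (3 + I * t)‖ ^ 2 ≤ c0) (hc : c0 ≤ 1 / 2)
    (h0 : 0 ≤ σ0) (h1 : σ0 ≤ 1) (hη : 0 < η) (hη1 : η ≤ 1) (ht : 4 ≤ t) (S : Finset ℂ)
    (hS : ∀ ρ ∈ S, σ0 + η ≤ ρ.re ∧ ρ.re < 1) :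
    ∑ ρ ∈ S, (if |t - ρ.im| ≤ √η then (zm ρ : ℝ) * (η / 9) else 0) ≤
      (2 * π)⁻¹ * (∫ θ in (0:ℝ)..2 * π, Lg Y (circleMap (3 + I * t) (3 - σ0) θ)) + 2 * c0 := by
  have hR : 0 < 3 - σ0 := by linarith
  have hne : ∀ z ∈ Metric.closedBall (3 + I * t : ℂ) (3 - σ0), z ≠ 1 := by
    intro z hz h
    rw [h, mem_closedBall_iff_norm'] at hz
    have := (Complex.abs_im_le_norm _).trans hz
    simp at this
    rw [abs_of_pos (by linarith)] at this
    linarith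
  have hg := hf_norm_ge ((hc0 t).trans hc)
  have hJ := jensen_ge (f := hf Y) hR (fun z hz => hf_an (hne z hz)) hg.2 (S.filter fun ρ => |t - ρ.im| ≤ √η) zm
    (fun ρ hρ => by
      rw [Finset.mem_filter] at hρ
      rw [mem_closedBall_iff_norm']
      exact (log_geom h1 h0 hη hη1 (hS ρ hρ.1).1 (hS ρ hρ.1).2 hρ.2).1)
    (fun ρ hρ => by
      rw [Finset.mem_filter] at hρ
      apply zm_le
      intro h
      have := (hS ρ hρ.1).2
      rw [h] at this; simp at this)
  have hsph : ∀ z ∈ Metric.sphere (3 + I * t : ℂ) |3 - σ0|, z ≠ 1 := by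
    rw [abs_of_pos hR]
    exact fun z hz => hne z (Metric.sphere_subset_closedBall hz)
  have hA : Real.circleAverage (fun z => Real.log ‖hf Y z‖) (3 + I * t) (3 - σ0) ≤ Real.circleAverage (Lg Y) (3 + I * t) (3 - σ0) := by
    refine Real.circleAverage_mono ?_ ?_ fun z _ => hf_norm_le Y z
    · exact MeromorphicOn.circleIntegrable_log_norm (f := hf Y) fun z hz => (hf_an (hsph z hz)).meromorphicAt
    · exact ContinuousOn.circleIntegrable' fun z hz => (Lg_cont (hsph z hz)).continuousWithinAt
  rw [← Finset.sum_filter]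
  have hB : Real.circleAverage (Lg Y) (3 + I * t) (3 - σ0) = (2 * π)⁻¹ * (∫ θ in (0:ℝ)..2 * π, Lg Y (circleMap (3 + I * t) (3 - σ0) θ)) := by
    rw [Real.circleAverage_def, smul_eq_mul]
  have hC : ∑ ρ ∈ S.filter (fun ρ => |t - ρ.im| ≤ √η), (zm ρ : ℝ) * (η / 9) ≤ ∑ ρ ∈ S.filter (fun ρ => |t - ρ.im| ≤ √η), (zm ρ : ℝ) * Real.log ((3 - σ0) * ‖(3 + I * t : ℂ) - ρ‖⁻¹) := by
    refine Finset.sum_le_sum fun ρ hρ => ?_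
    rw [Finset.mem_filter] at hρ
    exact mul_le_mul_of_nonneg_left (log_geom h1 h0 hη hη1 (hS ρ hρ.1).1 (hS ρ hρ.1).2 hρ.2).2 (Nat.cast_nonneg _)
  have := hg.1
  have := hc0 t
  linarith

lemma circ_eq (t R θ : ℝ) : circleMap (3 + I * t) R θ = ((3 + R * Real.cos θ : ℝ) : ℂ) + I * ((t + R * Real.sin θ : ℝ) : ℂ) := by
  rw [circleMap, Complex.exp_mul_I, ← Complex.ofReal_cos, ← Complex.ofReal_sin]
  push_cast; ring

lemma jensen_int {Y σ0 η T c0 : ℝ} (hc0 : ∀ t : ℝ, ‖gf Y (3 + I * t)‖ ^ 2 ≤ c0) (hc : c0 ≤ 1 / 2)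
    (h0 : 0 ≤ σ0) (h1 : σ0 ≤ 1) (hη : 0 < η) (hη1 : η ≤ 1) (hT : 8 ≤ T) (S : Finset ℂ)
    (hS : ∀ ρ ∈ S, σ0 + η ≤ ρ.re ∧ ρ.re < 1 ∧ T < ρ.im ∧ ρ.im ≤ 2 * T) :
    (∑ ρ ∈ S, (zm ρ : ℝ)) * (2 * η * √η / 9) ≤
      (2 * π)⁻¹ * (∫ θ in (0:ℝ)..2 * π, ∫ t in (T / 2)..(5 * T / 2), Lg Y (((3 + (3 - σ0) * Real.cos θ : ℝ) : ℂ) + I * t)) + (T + 2) * (2 * c0) ∧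
      IntervalIntegrable (fun θ => ∫ t in (T / 2)..(5 * T / 2), Lg Y (((3 + (3 - σ0) * Real.cos θ : ℝ) : ℂ) + I * t)) volume 0 (2 * π) := by
  have hR : 0 < 3 - σ0 := by linarith
  have hab : T - 1 ≤ 2 * T + 1 := by linarith
  have hcd : 0 ≤ 2 * π := by positivity
  have hne1 : ∀ x : ℝ, ∀ y : ℝ, 0 < y → ((x:ℂ) + I * y) ≠ 1 := by
    intro x y hy h
    have := congrArg Complex.im h
    simp at this; linarith
  have hy : ∀ t θ : ℝ, T - 1 ≤ t → T / 2 ≤ t + (3 - σ0) * Real.sin θ := by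
    intro t θ ht
    have := Real.neg_one_le_sin θ
    nlinarith
  have hy' : ∀ t θ : ℝ, t ≤ 2 * T + 1 → t + (3 - σ0) * Real.sin θ ≤ 5 * T / 2 := by
    intro t θ ht
    have := Real.sin_le_one θ
    nlinarith
  -- first Fubini
  have F1 := fubini_rect (F := fun t θ => Lg Y (circleMap (3 + I * t) (3 - σ0) θ)) hab hcd (by
    simp only [Function.uncurry_def, circ_eq]
    refine Lg_cont_on (by fun_prop) ?_
    rintro ⟨t, θ⟩ ⟨ht, -⟩
    exact hne1 _ _ (by have := hy t θ ht.1; dsimp only; linarith))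
  have F2 := fubini_rect (F := fun θ t : ℝ => Lg Y (((3 + (3 - σ0) * Real.cos θ : ℝ) : ℂ) + I * t)) hcd (c := T / 2) (d := 5 * T / 2) (by linarith) (by
    simp only [Function.uncurry_def]
    refine Lg_cont_on (by fun_prop) ?_
    rintro ⟨θ, t⟩ ⟨-, ht⟩
    exact hne1 _ _ (by have := ht.1; dsimp only at *; linarith))
  refine ⟨?_, F2.1⟩
  have hpt : ∀ t ∈ Icc (T - 1) (2 * T + 1), ∑ ρ ∈ S, (if |t - ρ.im| ≤ √η then (zm ρ : ℝ) * (η / 9) else 0) ≤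
      (2 * π)⁻¹ * (∫ θ in (0:ℝ)..2 * π, Lg Y (circleMap (3 + I * t) (3 - σ0) θ)) + 2 * c0 := fun t ht =>
    jensen_pt hc0 hc h0 h1 hη hη1 (by linarith [ht.1]) S fun ρ hρ => ⟨(hS ρ hρ).1, (hS ρ hρ).2.1⟩
  have hsq : √η ≤ 1 := Real.sqrt_le_iff.2 ⟨by norm_num, by linarith⟩
  have hind : ∀ ρ : ℂ, (fun t : ℝ => if |t - ρ.im| ≤ √η then (zm ρ : ℝ) * (η / 9) else 0) = (Icc (ρ.im - √η) (ρ.im + √η)).indicator fun _ => (zm ρ : ℝ) * (η / 9) := by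
    intro ρ; funext t
    rw [indicator_apply]
    congr 1
    rw [abs_le, mem_Icc]
    refine propext ⟨fun h => ⟨by linarith [h.1], by linarith [h.2]⟩, fun h => ⟨by linarith [h.1], by linarith [h.2]⟩⟩
  have hii : ∀ ρ : ℂ, Integrable (fun t : ℝ => if |t - ρ.im| ≤ √η then (zm ρ : ℝ) * (η / 9) else 0) := by
    intro ρ
    rw [hind, integrable_indicator_iff measurableSet_Icc]
    exact integrableOn_const (by simp)
  have hL : ∫ t in (T - 1)..(2 * T + 1), ∑ ρ ∈ S, (if |t - ρ.im| ≤ √η then (zm ρ : ℝ) * (η / 9) else 0) = (∑ ρ ∈ S, (zm ρ : ℝ)) * (2 * η * √η / 9) := by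
    rw [intervalIntegral.integral_finsetSum (fun ρ _ => (hii ρ).intervalIntegrable), Finset.sum_mul]
    refine Finset.sum_congr rfl fun ρ hρ => ?_
    rw [hind, intervalIntegral.integral_of_le hab, ← integral_Icc_eq_integral_Ioc, setIntegral_indicator measurableSet_Icc]
    have : Icc (T - 1) (2 * T + 1) ∩ Icc (ρ.im - √η) (ρ.im + √η) = Icc (ρ.im - √η) (ρ.im + √η) := by
      refine inter_eq_self_of_subset_right (Icc_subset_Icc ?_ ?_)
      · linarith [(hS ρ hρ).2.2.1]
      · linarith [(hS ρ hρ).2.2.2]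
    rw [this, setIntegral_const, measureReal_def, Real.volume_Icc, ENNReal.toReal_ofReal (by linarith [Real.sqrt_nonneg η]), smul_eq_mul]
    ring
  rw [← hL]
  have hmono := intervalIntegral.integral_mono_on hab (f := fun t => ∑ ρ ∈ S, (if |t - ρ.im| ≤ √η then (zm ρ : ℝ) * (η / 9) else 0))
    (g := fun t => (2 * π)⁻¹ * (∫ θ in (0:ℝ)..2 * π, Lg Y (circleMap (3 + I * t) (3 - σ0) θ)) + 2 * c0)
    (integrable_finsetSum _ fun ρ _ => hii ρ).intervalIntegrable
    ((F1.1.const_mul _).add intervalIntegrable_const) hpt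
  refine hmono.trans ?_
  rw [intervalIntegral.integral_add (F1.1.const_mul _) intervalIntegrable_const, intervalIntegral.integral_const_mul, intervalIntegral.integral_const, F1.2.2, smul_eq_mul]
  refine add_le_add ?_ (le_of_eq (by ring))
  refine mul_le_mul_of_nonneg_left ?_ (by positivity)
  refine intervalIntegral.integral_mono_on hcd F1.2.1 F2.1 fun θ _ => ?_
  simp only [circ_eq]
  have := intervalIntegral.integral_comp_add_right (a := T - 1) (b := 2 * T + 1) (fun y : ℝ => Lg Y (((3 + (3 - σ0) * Real.cos θ : ℝ) : ℂ) + I * (y:ℂ))) ((3 - σ0) * Real.sin θ)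
  rw [this]
  refine intervalIntegral.integral_mono_interval (hy _ _ le_rfl) (by linarith) (hy' _ _ le_rfl) (Eventually.of_forall fun y => Lg_nonneg _ _) ?_
  refine ContinuousOn.intervalIntegrable ?_
  rw [uIcc_of_le (by linarith)]
  exact Lg_cont_on (by fun_prop) fun y hy => hne1 _ _ (by linarith [hy.1])
end FZ

namespace FZ

lemma gf_sq_int {Y T σ : ℝ} (hT : 0 < T) : IntervalIntegrable (fun t : ℝ => ‖gf Y (σ + I * t)‖ ^ 2) volume (T / 2) (5 * T / 2) := by
  refine ContinuousOn.intervalIntegrable fun t ht => ?_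
  rw [uIcc_of_le (by linarith)] at ht
  have hne : (σ + I * t : ℂ) ≠ 1 := by
    intro h
    have := congrArg Complex.im h
    simp at this; linarith [ht.1]
  have hc : ContinuousAt (fun t : ℝ => gf Y (σ + I * t)) t := by
    have := (gf_diff (Y := Y) hne).continuousAt
    exact ContinuousAt.comp (f := fun t : ℝ => (σ + I * t : ℂ)) this (by fun_prop)
  exact (hc.norm.pow 2).continuousWithinAt

lemma Lg_int {Y T σ : ℝ} (hT : 0 < T) : IntervalIntegrable (fun t : ℝ => Lg Y (σ + I * t)) volume (T / 2) (5 * T / 2) := by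
  refine ContinuousOn.intervalIntegrable ?_
  rw [uIcc_of_le (by linarith)]
  refine Lg_cont_on (by fun_prop) fun t ht h => ?_
  have := congrArg Complex.im h
  simp at this; linarith [ht.1]

lemma Lg_le (Y : ℝ) (s : ℂ) {A : ℝ} (hA : 1 ≤ A) : Lg Y s ≤ Real.log A + ‖gf Y s‖ ^ 2 / A := by
  have hA0 : 0 < A := by linarith
  have h1 : Real.log ((1 + ‖gf Y s‖ ^ 2) / A) ≤ (1 + ‖gf Y s‖ ^ 2) / A - 1 := Real.log_le_sub_one_of_pos (by positivity)
  rw [Real.log_div (by positivity) hA0.ne', add_div] at h1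
  have : 1 / A ≤ 1 := by rw [div_le_one hA0]; exact hA
  unfold Lg
  linarith

lemma gauss_cos {L R : ℝ} (hL : 0 < L) (hR : 2 ≤ R) : ∫ θ in (0:ℝ)..2 * π, Real.exp (-2 * (R * (1 + Real.cos θ)) * L) ≤ 2 / √L := by
  have hb : 0 < 8 / π ^ 2 * L := by positivity
  have hpt : ∀ θ ∈ Icc (0:ℝ) (2 * π), Real.exp (-2 * (R * (1 + Real.cos θ)) * L) ≤ Real.exp (-(8 / π ^ 2 * L) * (θ - π) ^ 2) := by
    intro θ hθ
    have h1 : Real.cos (θ - π) ≤ 1 - 2 / π ^ 2 * (θ - π) ^ 2 := Real.cos_le_one_sub_mul_cos_sq (by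
      rw [abs_le]; constructor <;> linarith [hθ.1, hθ.2])
    rw [Real.cos_sub_pi] at h1
    have h2 : 2 / π ^ 2 * (θ - π) ^ 2 ≤ 1 + Real.cos θ := by linarith
    have h3 : 2 * (2 / π ^ 2 * (θ - π) ^ 2) ≤ R * (1 + Real.cos θ) :=
      mul_le_mul hR h2 (by positivity) (by linarith)
    have h4 := mul_le_mul_of_nonneg_right h3 hL.le
    refine Real.exp_le_exp.2 ?_
    have e : 8 / π ^ 2 * L * (θ - π) ^ 2 = 2 * (2 * (2 / π ^ 2 * (θ - π) ^ 2) * L) := by ring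
    nlinarith
  have hintg : Integrable (fun θ : ℝ => Real.exp (-(8 / π ^ 2 * L) * (θ - π) ^ 2)) :=
    (integrable_exp_neg_mul_sq hb).comp_sub_right π
  calc _ ≤ ∫ θ in (0:ℝ)..2 * π, Real.exp (-(8 / π ^ 2 * L) * (θ - π) ^ 2) :=
        intervalIntegral.integral_mono_on (by positivity) (Continuous.intervalIntegrable (by fun_prop) _ _) (Continuous.intervalIntegrable (by fun_prop) _ _) hpt
    _ ≤ ∫ θ : ℝ, Real.exp (-(8 / π ^ 2 * L) * (θ - π) ^ 2) := by
        rw [intervalIntegral.integral_of_le (by positivity)]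
        exact setIntegral_le_integral hintg (Eventually.of_forall fun t => by positivity)
    _ = √(π / (8 / π ^ 2 * L)) := by
        rw [integral_sub_right_eq_self (fun θ : ℝ => Real.exp (-(8 / π ^ 2 * L) * θ ^ 2)) π, integral_gaussian]
    _ ≤ _ := by
        have e : π / (8 / π ^ 2 * L) = (π ^ 3 / 8) / L := by field_simp
        rw [e, Real.sqrt_div (by positivity)]
        gcongr
        rw [Real.sqrt_le_iff]
        refine ⟨by norm_num, ?_⟩
        have h4 := Real.pi_lt_d2
        have : π ^ 3 ≤ 3.15 ^ 3 := by gcongr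
        norm_num at this ⊢
        linarith

lemma dens_crude : ∃ C > 0, ∃ Y0 ≥ Real.exp 1, ∀ Y ≥ Y0, ∀ S : Finset ℂ,
    (∀ ρ ∈ S, 1 / 2 ≤ ρ.re ∧ ρ.re < 1 ∧ Y ^ 32 < ρ.im ∧ ρ.im ≤ 2 * Y ^ 32) →
    ∑ ρ ∈ S, (zm ρ : ℝ) ≤ C * Y ^ 32 * Real.log Y := by
  obtain ⟨C3, hC3, h3⟩ := g3
  obtain ⟨K, hK, hg⟩ := g_mean_crude
  refine ⟨36 * (138 + K), by positivity, max (Real.exp 1) (2 * C3), le_max_left _ _, fun Y hY S hS => ?_⟩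
  have hYe : Real.exp 1 ≤ Y := (le_max_left _ _).trans hY
  have hYC : 2 * C3 ≤ Y := (le_max_right _ _).trans hY
  have h2 : (2:ℝ) ≤ Real.exp 1 := by have := Real.add_one_le_exp (1:ℝ); linarith
  have hY2 : 2 ≤ Y := h2.trans hYe
  have hY0 : 0 < Y := by linarith
  have hL : 1 ≤ Real.log Y := by rw [Real.le_log_iff_exp_le hY0]; exact hYe
  have hT8 : 8 ≤ Y ^ 32 := by
    calc (8:ℝ) ≤ 2 ^ 32 := by norm_num
      _ ≤ Y ^ 32 := by gcongr
  have hc : C3 / Y ≤ 1 / 2 := by rw [div_le_iff₀ hY0]; linarith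
  obtain ⟨h, hintg⟩ := jensen_int (σ0 := 1 / 4) (η := 1 / 4) (T := Y ^ 32) (h3 Y (by linarith)) hc (by norm_num) (by norm_num) (by norm_num) (by norm_num) hT8 S
    (fun ρ hρ => ⟨by linarith [(hS ρ hρ).1], (hS ρ hρ).2⟩)
  have hsq : √(1 / 4 : ℝ) = 1 / 2 := by
    rw [show (1 / 4 : ℝ) = (1 / 2) ^ 2 by norm_num]; exact Real.sqrt_sq (by norm_num)
  have hA1 : (1:ℝ) ≤ Y ^ 68 := one_le_pow₀ (by linarith)
  have hW : ∀ θ : ℝ, ∫ t in (Y ^ 32 / 2)..(5 * Y ^ 32 / 2), Lg Y (((3 + (3 - 1 / 4) * Real.cos θ : ℝ) : ℂ) + I * t) ≤ 136 * Y ^ 32 * Real.log Y + K := by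
    intro θ
    have hc1 := Real.neg_one_le_cos θ
    have hc2 := Real.cos_le_one θ
    set σ : ℝ := 3 + (3 - 1 / 4) * Real.cos θ with hσ
    have i1 := gf_sq_int (Y := Y) (T := Y ^ 32) (σ := σ) (by positivity)
    calc _ ≤ ∫ t in (Y ^ 32 / 2)..(5 * Y ^ 32 / 2), (Real.log (Y ^ 68) + ‖gf Y (σ + I * t)‖ ^ 2 / Y ^ 68) := by
          refine intervalIntegral.integral_mono_on (by linarith) (Lg_int (by positivity)) (intervalIntegrable_const.add (i1.div_const _)) fun t _ => Lg_le Y _ hA1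
      _ = 2 * Y ^ 32 * Real.log (Y ^ 68) + (∫ t in (Y ^ 32 / 2)..(5 * Y ^ 32 / 2), ‖gf Y (σ + I * t)‖ ^ 2) / Y ^ 68 := by
          rw [intervalIntegral.integral_add intervalIntegrable_const (i1.div_const _), intervalIntegral.integral_const, intervalIntegral.integral_div, smul_eq_mul]
          ring
      _ ≤ 2 * Y ^ 32 * Real.log (Y ^ 68) + (K * Y ^ 68) / Y ^ 68 := by
          have := hg Y hYe σ (by linarith) (by linarith)
          exact add_le_add le_rfl (div_le_div_of_nonneg_right this (by positivity))
      _ = _ := by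
          rw [Real.log_pow]; push_cast; field_simp; ring
  have hI := intervalIntegral.integral_mono_on (by positivity) hintg (intervalIntegrable_const (c := 136 * Y ^ 32 * Real.log Y + K)) fun θ _ => hW θ
  rw [intervalIntegral.integral_const, smul_eq_mul, sub_zero] at hI
  have hI2 := mul_le_mul_of_nonneg_left hI (show 0 ≤ (2 * π)⁻¹ by positivity)
  rw [← mul_assoc, inv_mul_cancel₀ (by positivity), one_mul] at hI2
  rw [hsq] at h
  have hTL : Y ^ 32 ≤ Y ^ 32 * Real.log Y := le_mul_of_one_le_right (by positivity) hL
  have : K ≤ K * (Y ^ 32 * Real.log Y) := le_mul_of_one_le_right hK.le (by linarith)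
  have : (Y ^ 32 + 2) * (2 * (C3 / Y)) ≤ (Y ^ 32 + 2) * 1 := by gcongr; linarith
  nlinarith

lemma dens : ∃ C > 0, ∃ Y0 ≥ Real.exp 1, ∀ Y ≥ Y0, ∀ σ0 : ℝ, 1 / 2 + 1 / Real.log Y ≤ σ0 → σ0 ≤ 3 / 4 → ∀ S : Finset ℂ,
    (∀ ρ ∈ S, σ0 + 1 / Real.log Y ≤ ρ.re ∧ ρ.re < 1 ∧ Y ^ 32 < ρ.im ∧ ρ.im ≤ 2 * Y ^ 32) →
    ∑ ρ ∈ S, (zm ρ : ℝ) ≤ C * Y ^ 32 * Real.log Y * Real.exp (-2 * (σ0 - 1 / 2 - 1 / Real.log Y) * Real.log Y) := by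
  obtain ⟨C3, hC3, h3⟩ := g3
  obtain ⟨K, hK, hg⟩ := g_mean
  refine ⟨9 / 2 * (K + 4 * C3), by positivity, max (Real.exp 1) (2 * C3), le_max_left _ _, fun Y hY σ0 hσ1 hσ2 S hS => ?_⟩
  have hYe : Real.exp 1 ≤ Y := (le_max_left _ _).trans hY
  have hYC : 2 * C3 ≤ Y := (le_max_right _ _).trans hY
  have h2 : (2:ℝ) ≤ Real.exp 1 := by have := Real.add_one_le_exp (1:ℝ); linarith
  have hY2 : 2 ≤ Y := h2.trans hYe
  have hY0 : 0 < Y := by linarith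
  have hL : 1 ≤ Real.log Y := by rw [Real.le_log_iff_exp_le hY0]; exact hYe
  have hT8 : 8 ≤ Y ^ 32 := by
    calc (8:ℝ) ≤ 2 ^ 32 := by norm_num
      _ ≤ Y ^ 32 := by gcongr
  have hc : C3 / Y ≤ 1 / 2 := by rw [div_le_iff₀ hY0]; linarith
  have hη : 0 < 1 / Real.log Y := by positivity
  have hη1 : 1 / Real.log Y ≤ 1 := by rw [div_le_one (by linarith)]; exact hL
  obtain ⟨h, hintg⟩ := jensen_int (σ0 := σ0) (η := 1 / Real.log Y) (T := Y ^ 32) (h3 Y (by linarith)) hc (by linarith) (by linarith) hη hη1 hT8 S hS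
  set L := Real.log Y with hLdef
  have hL0 : 0 < L := by linarith
  set E := Real.exp (-2 * (σ0 - 1 / 2 - 1 / L) * L) with hE
  have hW : ∀ θ : ℝ, ∫ t in (Y ^ 32 / 2)..(5 * Y ^ 32 / 2), Lg Y (((3 + (3 - σ0) * Real.cos θ : ℝ) : ℂ) + I * t) ≤ K * Y ^ 32 * E * Real.exp (-2 * ((3 - σ0) * (1 + Real.cos θ)) * L) := by
    intro θ
    have hc1 := Real.neg_one_le_cos θ
    have hc2 := Real.cos_le_one θ
    have hs1 : σ0 ≤ 3 + (3 - σ0) * Real.cos θ := by nlinarith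
    have hs2 : 3 + (3 - σ0) * Real.cos θ ≤ 6 := by nlinarith
    have i1 := gf_sq_int (Y := Y) (T := Y ^ 32) (σ := 3 + (3 - σ0) * Real.cos θ) (by positivity)
    calc _ ≤ ∫ t in (Y ^ 32 / 2)..(5 * Y ^ 32 / 2), ‖gf Y (((3 + (3 - σ0) * Real.cos θ : ℝ) : ℂ) + I * t)‖ ^ 2 := by
          refine intervalIntegral.integral_mono_on (by linarith) (Lg_int (by positivity)) i1 fun t _ => ?_
          have := Lg_le Y (((3 + (3 - σ0) * Real.cos θ : ℝ) : ℂ) + I * t) le_rfl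
          simpa using this
      _ ≤ K * Y ^ 32 * Real.exp (-2 * (3 + (3 - σ0) * Real.cos θ - 1 / 2 - 1 / L) * L) := hg Y hYe _ (by linarith) hs2
      _ = _ := by
          rw [mul_assoc (K * Y ^ 32), hE, ← Real.exp_add]
          congr 2; ring
  have hI := intervalIntegral.integral_mono_on (by positivity) hintg (Continuous.intervalIntegrable (by fun_prop) _ _) fun θ _ => hW θ
  rw [intervalIntegral.integral_const_mul] at hI
  have hE0 : 0 < E := Real.exp_pos _
  have hI1 := hI.trans (mul_le_mul_of_nonneg_left (gauss_cos hL0 (R := 3 - σ0) (by linarith)) (by positivity))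
  have hpi : (2 * π)⁻¹ ≤ 1 / 2 := by
    rw [inv_le_iff_one_le_mul₀ (by positivity)]; linarith [Real.pi_gt_three]
  have hI2 := mul_le_mul_of_nonneg_left hI1 (show 0 ≤ (2 * π)⁻¹ by positivity)
  have hI3 := hI2.trans (mul_le_mul_of_nonneg_right hpi (show 0 ≤ K * Y ^ 32 * E * (2 / √L) by positivity))
  have hsL : 0 < √L := Real.sqrt_pos.2 hL0
  have hss : √L * √L = L := Real.mul_self_sqrt hL0.le
  have hEY : 1 / √Y ≤ E := by
    have e : 1 / √Y = Real.exp (-(1 / 2) * L) := by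
      rw [Real.sqrt_eq_rpow, Real.rpow_def_of_pos hY0, one_div, ← Real.exp_neg]; congr 1; rw [← hLdef]; ring
    rw [e, hE, Real.exp_le_exp]
    have e2 : -2 * (σ0 - 1 / 2 - 1 / L) * L = -2 * (σ0 - 1 / 2) * L + 2 := by field_simp; ring
    rw [e2]; nlinarith
  have hLY : √L * (1 / Y) ≤ E := by
    refine le_trans ?_ hEY
    have h5 : √L ≤ √Y := Real.sqrt_le_sqrt (by rw [hLdef]; linarith [Real.log_le_sub_one_of_pos hY0])
    have h6 : √Y * √Y = Y := Real.mul_self_sqrt hY0.le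
    have h7 : 0 < √Y := Real.sqrt_pos.2 hY0
    calc √L * (1 / Y) ≤ √Y * (1 / Y) := by gcongr
      _ = 1 / √Y := by rw [mul_one_div, div_eq_div_iff hY0.ne' h7.ne']; linarith
  have hsqrt : √(1 / L) = 1 / √L := by rw [Real.sqrt_div zero_le_one, Real.sqrt_one]
  rw [hsqrt] at h
  have h8 : (∑ ρ ∈ S, (zm ρ : ℝ)) * (2 * (1 / L) * (1 / √L) / 9) ≤ 1 / 2 * (K * Y ^ 32 * E * (2 / √L)) + (Y ^ 32 + 2) * (2 * (C3 / Y)) := by linarith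
  have h9 := mul_le_mul_of_nonneg_right h8 (show 0 ≤ 9 / 2 * L * √L by positivity)
  have e1 : (∑ ρ ∈ S, (zm ρ : ℝ)) * (2 * (1 / L) * (1 / √L) / 9) * (9 / 2 * L * √L) = ∑ ρ ∈ S, (zm ρ : ℝ) := by field_simp
  have e2 : (1 / 2 * (K * Y ^ 32 * E * (2 / √L)) + (Y ^ 32 + 2) * (2 * (C3 / Y))) * (9 / 2 * L * √L) = 9 / 2 * K * Y ^ 32 * L * E + 9 * C3 * L * (Y ^ 32 + 2) * (√L * (1 / Y)) := by field_simp
  rw [e1, e2] at h9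
  refine h9.trans ?_
  have : 9 * C3 * L * (Y ^ 32 + 2) * (√L * (1 / Y)) ≤ 9 * C3 * L * (2 * Y ^ 32) * E := by
    gcongr; linarith
  linarith
end FZ

namespace FZ

lemma ksum (N : ℕ) : ∑ k ∈ Finset.range N, Real.exp (-(k:ℝ)) ≤ 2 := by
  have h0 : (0:ℝ) ≤ 1/2 := by norm_num
  have h1 : ∀ k : ℕ, Real.exp (-(k:ℝ)) ≤ (1/2:ℝ)^k := by
    intro k
    have : Real.exp (-(k:ℝ)) = (Real.exp (-1))^k := by
      rw [← Real.exp_nat_mul]; ring_nf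
    rw [this]
    refine pow_le_pow_left₀ (Real.exp_pos _).le ?_ k
    rw [Real.exp_neg, one_div]
    refine inv_anti₀ (by norm_num) ?_
    have := Real.add_one_le_exp (1:ℝ)
    linarith
  calc ∑ k ∈ Finset.range N, Real.exp (-(k:ℝ)) ≤ ∑ k ∈ Finset.range N, (1/2:ℝ)^k :=
        Finset.sum_le_sum fun k _ => h1 k
    _ ≤ 2 := by
        rw [geom_sum_eq (by norm_num)]
        have : (0:ℝ) ≤ (1/2)^N := by positivity
        linarith [this, show ((1/2:ℝ)^N - 1)/(1/2-1) = 2 - 2*(1/2)^N by ring]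

lemma kexp (k : ℝ) : (k+1)^2 * Real.exp (-2*k) ≤ 4 * Real.exp (-k) ∨ k < 0 := by
  by_cases hk : k < 0
  · exact Or.inr hk
  left
  push Not at hk
  have h1 : k + 1 ≤ 2 * Real.exp (k/2) := by
    have := Real.add_one_le_exp (k/2)
    linarith
  have h2 : (k+1)^2 ≤ 4 * Real.exp k := by
    calc (k+1)^2 ≤ (2 * Real.exp (k/2))^2 := pow_le_pow_left₀ (by linarith) h1 2
      _ = 4 * Real.exp k := by
        rw [mul_pow, ← Real.exp_nat_mul]; push_cast; ring_nf
  calc (k+1)^2 * Real.exp (-2*k) ≤ 4 * Real.exp k * Real.exp (-2*k) :=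
        mul_le_mul_of_nonneg_right h2 (Real.exp_pos _).le
    _ = 4 * Real.exp (-k) := by
        rw [mul_assoc, ← Real.exp_add]; ring_nf

lemma dyadicY : ∃ C > 0, ∃ Y0 ≥ Real.exp 1, ∀ Y ≥ Y0, ∀ S : Finset ℂ,
    (∀ ρ ∈ S, 1/2 ≤ ρ.re ∧ ρ.re ≤ 5/8 ∧ Y^32 < ρ.im ∧ ρ.im ≤ 2*Y^32) →
    ∑ ρ ∈ S, (zm ρ : ℝ) * (ρ.re - 1/2)^2 ≤ C * Y^32 / Real.log Y := by
  obtain ⟨C1, hC1, Y1, hY1, H1⟩ := dens_crude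
  obtain ⟨C2, hC2, Y2, hY2, H2⟩ := dens
  set M := C1 * Real.exp 4 + C2 * Real.exp 4 with hM
  have hMp : 0 < M := by positivity
  refine ⟨8*M, by positivity, max Y1 Y2, le_max_of_le_left hY1, ?_⟩
  intro Y hY S hS
  have hYa : Y ≥ Y1 := le_trans (le_max_left _ _) hY
  have hYb : Y ≥ Y2 := le_trans (le_max_right _ _) hY
  have hYe : Real.exp 1 ≤ Y := le_trans hY1 hYa
  have hYpos : 0 < Y := lt_of_lt_of_le (Real.exp_pos 1) hYe
  set L := Real.log Y with hL
  have hL1 : 1 ≤ L := (Real.le_log_iff_exp_le hYpos).2 hYe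
  have hL0 : 0 < L := by linarith
  classical
  have key : ∀ k : ℕ, ∑ ρ ∈ S.filter (fun ρ => ⌊(ρ.re - 1/2)*L⌋₊ = k), (zm ρ : ℝ)
      ≤ M * Y^32 * L * Real.exp (-2*(k:ℝ)) := by
    intro k
    by_cases hk : k < 2
    · have h := H1 Y hYa (S.filter (fun ρ => ⌊(ρ.re - 1/2)*L⌋₊ = k)) (by
        intro ρ hρ
        have := hS ρ (Finset.mem_filter.1 hρ).1
        exact ⟨this.1, by linarith [this.2.1], this.2.2⟩)
      have hk' : (k:ℝ) ≤ 2 := by exact_mod_cast hk.le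
      have h3 : 1 ≤ Real.exp 4 * Real.exp (-2*(k:ℝ)) := by
        rw [← Real.exp_add]; exact Real.one_le_exp (by linarith)
      calc _ ≤ C1 * Y^32 * L := h
        _ ≤ C1 * Y^32 * L * (Real.exp 4 * Real.exp (-2*(k:ℝ))) :=
            le_mul_of_one_le_right (by positivity) h3
        _ = (C1 * Real.exp 4) * Y^32 * L * Real.exp (-2*(k:ℝ)) := by ring
        _ ≤ M * Y^32 * L * Real.exp (-2*(k:ℝ)) := by
            have : C1 * Real.exp 4 ≤ M := by
              have : 0 < C2 * Real.exp 4 := by positivity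
              linarith
            gcongr
    · push Not at hk
      have hk' : (2:ℝ) ≤ k := by exact_mod_cast hk
      have hMb : C2 * Real.exp 4 ≤ M := by
        have : 0 < C1 * Real.exp 4 := by positivity
        linarith
      by_cases hk3 : ((k:ℝ)-1)/L ≤ 1/4
      · have h := H2 Y hYb (1/2 + ((k:ℝ)-1)/L) (by
          have : 1/L ≤ ((k:ℝ)-1)/L := by
            apply div_le_div_of_nonneg_right _ hL0.le; linarith
          linarith) (by linarith) (S.filter (fun ρ => ⌊(ρ.re - 1/2)*L⌋₊ = k)) (by
          intro ρ hρ
          obtain ⟨hρ1, hρ2⟩ := Finset.mem_filter.1 hρ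
          have := hS ρ hρ1
          refine ⟨?_, by linarith [this.2.1], this.2.2⟩
          have h5 : (k:ℝ) ≤ (ρ.re - 1/2)*L := by
            rw [← hρ2]; exact Nat.floor_le (mul_nonneg (by linarith [this.1]) hL0.le)
          have h6 : (k:ℝ)/L ≤ ρ.re - 1/2 := (div_le_iff₀ hL0).2 h5
          have h7 : 1/2 + ((k:ℝ)-1)/L + 1/L = 1/2 + (k:ℝ)/L := by ring
          rw [← hL]
          linarith)
        rw [← hL] at h
        have h8 : -2*(1/2 + ((k:ℝ)-1)/L - 1/2 - 1/L)*L = 4 + -2*(k:ℝ) := by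
          field_simp; ring
        rw [h8, Real.exp_add] at h
        calc _ ≤ _ := h
          _ = (C2 * Real.exp 4) * Y^32 * L * Real.exp (-2*(k:ℝ)) := by ring
          _ ≤ _ := by gcongr
      · push Not at hk3
        have : S.filter (fun ρ => ⌊(ρ.re - 1/2)*L⌋₊ = k) = ∅ := by
          rw [Finset.filter_eq_empty_iff]
          intro ρ hρ1 hρ2
          have := hS ρ hρ1
          have h5 : (k:ℝ) ≤ (ρ.re - 1/2)*L := by
            rw [← hρ2]; exact Nat.floor_le (mul_nonneg (by linarith [this.1]) hL0.le)
          have h6 : (k:ℝ)/L ≤ ρ.re - 1/2 := (div_le_iff₀ hL0).2 h5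
          have h7 : ((k:ℝ)-1)/L ≤ (k:ℝ)/L := by
            apply div_le_div_of_nonneg_right _ hL0.le; linarith
          linarith [this.2.1]
        rw [this]
        simp only [Finset.sum_empty]
        positivity
  have hmaps : ∀ ρ ∈ S, ⌊(ρ.re - 1/2)*L⌋₊ ∈ Finset.range (⌊L⌋₊+1) := by
    intro ρ hρ
    rw [Finset.mem_range, Nat.lt_succ_iff]
    apply Nat.floor_mono
    have := hS ρ hρ
    nlinarith [this.2.1]
  rw [← Finset.sum_fiberwise_of_maps_to hmaps]
  calc _ ≤ ∑ k ∈ Finset.range (⌊L⌋₊+1), (8*M*Y^32/L/2) * Real.exp (-(k:ℝ)) := by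
        apply Finset.sum_le_sum
        intro k _
        calc ∑ ρ ∈ S.filter (fun ρ => ⌊(ρ.re - 1/2)*L⌋₊ = k), (zm ρ : ℝ) * (ρ.re - 1/2)^2
            ≤ ∑ ρ ∈ S.filter (fun ρ => ⌊(ρ.re - 1/2)*L⌋₊ = k), (zm ρ : ℝ) * (((k:ℝ)+1)/L)^2 := by
              apply Finset.sum_le_sum
              intro ρ hρ
              obtain ⟨hρ1, hρ2⟩ := Finset.mem_filter.1 hρ
              have := hS ρ hρ1
              have h5 : (ρ.re - 1/2)*L < (k:ℝ) + 1 := by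
                rw [← hρ2]; exact Nat.lt_floor_add_one _
              have h6 : ρ.re - 1/2 ≤ ((k:ℝ)+1)/L := (le_div_iff₀ hL0).2 h5.le
              exact mul_le_mul_of_nonneg_left
                (pow_le_pow_left₀ (by linarith [this.1]) h6 2) (Nat.cast_nonneg _)
          _ = (∑ ρ ∈ S.filter (fun ρ => ⌊(ρ.re - 1/2)*L⌋₊ = k), (zm ρ : ℝ)) * (((k:ℝ)+1)/L)^2 := by
              rw [Finset.sum_mul]
          _ ≤ (M * Y^32 * L * Real.exp (-2*(k:ℝ))) * (((k:ℝ)+1)/L)^2 :=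
              mul_le_mul_of_nonneg_right (key k) (sq_nonneg _)
          _ = (M*Y^32/L) * (((k:ℝ)+1)^2 * Real.exp (-2*(k:ℝ))) := by field_simp
          _ ≤ (M*Y^32/L) * (4 * Real.exp (-(k:ℝ))) := by
              apply mul_le_mul_of_nonneg_left _ (by positivity)
              exact (kexp k).resolve_right (not_lt.2 (Nat.cast_nonneg _))
          _ = _ := by ring
    _ = (8*M*Y^32/L/2) * ∑ k ∈ Finset.range (⌊L⌋₊+1), Real.exp (-(k:ℝ)) := by
        rw [Finset.mul_sum]
    _ ≤ (8*M*Y^32/L/2) * 2 := mul_le_mul_of_nonneg_left (ksum _) (by positivity)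
    _ = 8*M*Y^32/L := by ring

lemma dyadic : ∃ C > 0, ∃ T0 ≥ Real.exp 32, ∀ T ≥ T0, ∀ S : Finset ℂ,
    (∀ ρ ∈ S, 1/2 ≤ ρ.re ∧ ρ.re ≤ 5/8 ∧ T < ρ.im ∧ ρ.im ≤ 2*T) →
    ∑ ρ ∈ S, (zm ρ : ℝ) * (ρ.re - 1/2)^2 ≤ C * T / Real.log T := by
  obtain ⟨C, hC, Y0, hY0, H⟩ := dyadicY
  have hY0p : 0 < Y0 := lt_of_lt_of_le (Real.exp_pos 1) hY0
  refine ⟨32*C, by positivity, Y0^32, ?_, ?_⟩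
  · calc Real.exp 32 = (Real.exp 1)^32 := by rw [← Real.exp_nat_mul]; norm_num
      _ ≤ Y0^32 := pow_le_pow_left₀ (Real.exp_pos _).le hY0 32
  intro T hT S hS
  have hTp : 0 < T := lt_of_lt_of_le (by positivity) hT
  have hTY : (T^((1:ℝ)/32))^32 = T := by
    rw [← Real.rpow_natCast, ← Real.rpow_mul hTp.le]; norm_num
  have hY : T^((1:ℝ)/32) ≥ Y0 := by
    have h := hT
    rw [← hTY] at h
    exact le_of_pow_le_pow_left₀ (by norm_num) (Real.rpow_nonneg hTp.le _) h
  have h := H _ hY S (by rw [hTY]; exact hS)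
  rw [hTY, Real.log_rpow hTp] at h
  refine h.trans (le_of_eq ?_)
  rw [one_div, div_mul_eq_div_div, div_inv_eq_mul]
  ring

lemma low_finite (B : ℝ) : {ρ : ℂ | riemannZeta ρ = 0 ∧ 0 ≤ ρ.re ∧ ρ.re ≤ 1 ∧ 0 ≤ ρ.im ∧ ρ.im ≤ B}.Finite := by
  have hc : IsCompact (Set.Icc (0:ℝ) 1 ×ℂ Set.Icc (0:ℝ) B) := isCompact_Icc.reProdIm isCompact_Icc
  refine (hc.inter_riemannZetaZeros_finite).subset ?_
  intro ρ hρ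
  obtain ⟨h1, h2, h3, h4, h5⟩ := hρ
  exact ⟨⟨⟨h2, h3⟩, ⟨h4, h5⟩⟩, (mem_riemannZetaZeros).2 h1⟩

lemma second_moment : ∃ C > 0, ∃ T1 ≥ Real.exp 1, ∀ T ≥ T1, ∀ S : Finset ℂ,
    (∀ ρ ∈ S, riemannZeta ρ = 0 ∧ 1/2 ≤ ρ.re ∧ ρ.re ≤ 5/8 ∧ 0 < ρ.im ∧ ρ.im ≤ T) →
    ∑ ρ ∈ S, (zm ρ : ℝ) * (ρ.re - 1/2)^2 ≤ C * T / Real.log T := by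
  obtain ⟨C, hC, T0, hT0, H⟩ := dyadic
  have hT0p : 0 < T0 := lt_of_lt_of_le (Real.exp_pos _) hT0
  have hT016 : 33 ≤ T0 := by linarith [Real.add_one_le_exp (32:ℝ)]
  set B0 := ∑ ρ ∈ (low_finite (2*T0)).toFinset, (zm ρ : ℝ) * (ρ.re - 1/2)^2 with hB0
  have hB0n : 0 ≤ B0 := Finset.sum_nonneg fun ρ _ => by positivity
  set D := B0 + 4*C with hD
  have hlogle : ∀ T ≥ T0, 1 ≤ T / Real.log T := by
    intro T hT
    have hTp : 0 < T := by linarith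
    have : 0 < Real.log T := Real.log_pos (by linarith)
    rw [le_div_iff₀ this]
    linarith [Real.log_le_sub_one_of_pos hTp]
  refine ⟨D, by positivity, T0, le_trans (Real.exp_le_exp.2 (by norm_num)) hT0, ?_⟩
  have ind : ∀ n : ℕ, ∀ T ≥ T0, T ≤ 2^n * (2*T0) → ∀ S : Finset ℂ,
    (∀ ρ ∈ S, riemannZeta ρ = 0 ∧ 1/2 ≤ ρ.re ∧ ρ.re ≤ 5/8 ∧ 0 < ρ.im ∧ ρ.im ≤ T) →
    ∑ ρ ∈ S, (zm ρ : ℝ) * (ρ.re - 1/2)^2 ≤ D * T / Real.log T := by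
    intro n
    have base : ∀ T ≥ T0, T ≤ 2*T0 → ∀ S : Finset ℂ,
      (∀ ρ ∈ S, riemannZeta ρ = 0 ∧ 1/2 ≤ ρ.re ∧ ρ.re ≤ 5/8 ∧ 0 < ρ.im ∧ ρ.im ≤ T) →
      ∑ ρ ∈ S, (zm ρ : ℝ) * (ρ.re - 1/2)^2 ≤ D * T / Real.log T := by
      intro T hT hT2 S hS
      have h1 : ∑ ρ ∈ S, (zm ρ : ℝ) * (ρ.re - 1/2)^2 ≤ B0 := by
        apply Finset.sum_le_sum_of_subset_of_nonneg
        · intro ρ hρ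
          obtain ⟨h1, h2, h3, h4, h5⟩ := hS ρ hρ
          rw [Set.Finite.mem_toFinset]
          exact ⟨h1, by linarith, by linarith, h4.le, by linarith⟩
        · intro ρ _ _; positivity
      calc _ ≤ B0 := h1
        _ ≤ D := by linarith
        _ ≤ D * (T / Real.log T) := le_mul_of_one_le_right (by positivity) (hlogle T hT)
        _ = _ := by ring
    induction n with
    | zero => intro T hT hT2; exact base T hT (by simpa using hT2)
    | succ n ih =>
      intro T hT hT2 S hS
      by_cases hT3 : T ≤ 2*T0
      · exact base T hT hT3 S hS
      push Not at hT3
      have hTh : T/2 ≥ T0 := by linarith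
      have a1 := ih (T/2) hTh (by rw [pow_succ] at hT2; linarith) (S.filter (fun ρ => ρ.im ≤ T/2)) (by
        intro ρ hρ
        obtain ⟨hρ1, hρ2⟩ := Finset.mem_filter.1 hρ
        obtain ⟨h1, h2, h3, h4, h5⟩ := hS ρ hρ1
        exact ⟨h1, h2, h3, h4, hρ2⟩)
      have a2 := H (T/2) hTh (S.filter (fun ρ => ¬ ρ.im ≤ T/2)) (by
        intro ρ hρ
        obtain ⟨hρ1, hρ2⟩ := Finset.mem_filter.1 hρ
        obtain ⟨h1, h2, h3, h4, h5⟩ := hS ρ hρ1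
        exact ⟨h2, h3, not_le.1 hρ2, by linarith⟩)
      rw [← Finset.sum_filter_add_sum_filter_not S (fun ρ => ρ.im ≤ T/2)]
      have hTp : 0 < T := by linarith
      set l := Real.log T with hl
      have hl32 : 32 ≤ l := (Real.le_log_iff_exp_le hTp).2 (by linarith)
      have hlh : Real.log (T/2) = l - Real.log 2 := Real.log_div hTp.ne' (by norm_num)
      have hlog2 : Real.log 2 ≤ 1 := by linarith [Real.log_two_lt_d9]
      have hlb : 3/4 * l ≤ Real.log (T/2) := by rw [hlh]; linarith
      have hd : T/2/Real.log (T/2) ≤ (2/3) * (T/l) := by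
        have : T/2/Real.log (T/2) ≤ T/2/(3/4*l) :=
          div_le_div_of_nonneg_left (by positivity) (by linarith) hlb
        refine this.trans (le_of_eq ?_)
        field_simp; norm_num
      have hDC : (D + C) * (2/3) ≤ D := by linarith
      calc _ ≤ D * (T/2) / Real.log (T/2) + C * (T/2) / Real.log (T/2) := add_le_add a1 a2
        _ = (D + C) * (T/2/Real.log (T/2)) := by ring
        _ ≤ (D + C) * ((2/3) * (T/l)) := mul_le_mul_of_nonneg_left hd (by positivity)
        _ = ((D + C) * (2/3)) * (T/l) := by ring
        _ ≤ D * (T/l) := mul_le_mul_of_nonneg_right hDC (by positivity)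
        _ = _ := by ring
  intro T hT S hS
  obtain ⟨n, hn⟩ := pow_unbounded_of_one_lt (T/(2*T0)) (by norm_num : (1:ℝ) < 2)
  refine ind n T hT ?_ S hS
  exact ((div_lt_iff₀ (by positivity)).1 hn).le

end FZ

namespace FZ

lemma conj_ord_le (ρ : ℂ) (hρ : ρ ≠ 1) (n : ℕ) (h : (n:ℕ∞) ≤ analyticOrderAt riemannZeta ρ) :
    (n:ℕ∞) ≤ analyticOrderAt riemannZeta ((starRingEnd ℂ) ρ) := by
  have hρ' : (starRingEnd ℂ) ρ ≠ 1 := by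
    intro h1
    apply hρ
    have := congrArg (starRingEnd ℂ) h1
    simpa using this
  obtain ⟨g, hg, he⟩ := (natCast_le_analyticOrderAt (zeta_an hρ)).1 h
  refine (natCast_le_analyticOrderAt (zeta_an hρ')).2
    ⟨(starRingEnd ℂ) ∘ g ∘ (starRingEnd ℂ), ?_, ?_⟩
  · have ht : Tendsto (starRingEnd ℂ) (nhds ((starRingEnd ℂ) ρ)) (nhds ρ) := by
      have := (Complex.continuous_conj.tendsto ((starRingEnd ℂ) ρ))
      simpa using this
    rw [analyticAt_iff_eventually_differentiableAt] at hg ⊢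
    filter_upwards [ht.eventually hg] with z hz
    exact differentiableAt_conj_conj_iff.2 hz
  · have ht : Tendsto (starRingEnd ℂ) (nhds ((starRingEnd ℂ) ρ)) (nhds ρ) := by
      have := (Complex.continuous_conj.tendsto ((starRingEnd ℂ) ρ))
      simpa using this
    filter_upwards [ht.eventually he] with z hz
    rw [riemannZeta_conj] at hz
    have := congrArg (starRingEnd ℂ) hz
    simpa using this

lemma conj_ord (ρ : ℂ) (hρ : ρ ≠ 1) :
    analyticOrderAt riemannZeta ((starRingEnd ℂ) ρ) = analyticOrderAt riemannZeta ρ := by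
  have hρ' : (starRingEnd ℂ) ρ ≠ 1 := by
    intro h1
    apply hρ
    have := congrArg (starRingEnd ℂ) h1
    simpa using this
  refine ENat.eq_of_forall_natCast_le_iff fun n => ⟨fun h => ?_, conj_ord_le ρ hρ n⟩
  simpa using conj_ord_le _ hρ' n h

lemma one_sub_ord (ρ : ℂ) (hρ : ρ.im ≠ 0) :
    analyticOrderAt riemannZeta (1 - ρ) = analyticOrderAt riemannZeta ρ := by
  have hn : ∀ s : ℂ, s.im ≠ 0 → ∀ n : ℕ, s ≠ -n := by
    intro s hs n h
    apply hs; rw [h]; simp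
  have h1 : ∀ s : ℂ, s.im ≠ 0 → s ≠ 1 := by
    intro s hs h
    apply hs; rw [h]; simp
  set u : ℂ → ℂ := fun s => 2 * (2 * (π:ℂ)) ^ (-s) * Complex.Gamma s * Complex.cos (π * s / 2) with hu
  have hopen : ∀ᶠ s : ℂ in nhds ρ, s.im ≠ 0 :=
    (Complex.continuous_im.continuousAt).eventually_ne hρ
  have hpi : (2 * (π:ℂ)) ≠ 0 := by
    simp [Real.pi_ne_zero]
  have hua : AnalyticAt ℂ u ρ := by
    rw [analyticAt_iff_eventually_differentiableAt]
    filter_upwards [hopen] with s hs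
    have hG := Complex.differentiableAt_Gamma s (hn s hs)
    have hp : DifferentiableAt ℂ (fun s : ℂ => (2 * (π:ℂ)) ^ (-s)) s :=
      (differentiableAt_id.neg).const_cpow (Or.inl hpi)
    have hc : DifferentiableAt ℂ (fun s : ℂ => Complex.cos (π * s / 2)) s := by fun_prop
    exact ((hp.const_mul 2).mul hG).mul hc
  have hu0 : u ρ ≠ 0 := by
    have hG := Complex.Gamma_ne_zero (hn ρ hρ)
    have hc : Complex.cos (π * ρ / 2) ≠ 0 := by
      intro h
      obtain ⟨k, hk⟩ := Complex.cos_eq_zero_iff.1 h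
      apply hρ
      have h3 : ρ = ((2*k+1 : ℝ) : ℂ) := by
        have hpi' : (π:ℂ) ≠ 0 := by simp [Real.pi_ne_zero]
        have : (π:ℂ) * ρ = π * (2*k+1) := by linear_combination 2 * hk
        have := mul_left_cancel₀ hpi' this
        rw [this]; push_cast; ring
      rw [h3, Complex.ofReal_im]
    have hp : (2 * (π:ℂ)) ^ (-ρ) ≠ 0 := by
      rw [Ne, Complex.cpow_eq_zero_iff]; tauto
    exact mul_ne_zero (mul_ne_zero (mul_ne_zero two_ne_zero hp) hG) hc
  have hd : HasDerivAt (fun s : ℂ => 1 - s) (-1) ρ := by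
    simpa using (hasDerivAt_id ρ).const_sub 1
  have e1 : analyticOrderAt (riemannZeta ∘ (fun s : ℂ => 1 - s)) ρ
      = analyticOrderAt riemannZeta (1 - ρ) :=
    analyticOrderAt_comp_of_deriv_ne_zero (by fun_prop) (by rw [hd.deriv]; norm_num)
  have e2 : (riemannZeta ∘ (fun s : ℂ => 1 - s)) =ᶠ[nhds ρ] (u * riemannZeta) := by
    filter_upwards [hopen] with s hs
    exact riemannZeta_one_sub (hn s hs) (h1 s hs)
  rw [← e1, analyticOrderAt_congr e2, analyticOrderAt_mul hua (zeta_an (h1 ρ hρ)),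
    hua.analyticOrderAt_eq_zero.2 hu0, zero_add]

/-- reflection across the critical line -/
def rfl1 (ρ : ℂ) : ℂ := 1 - (starRingEnd ℂ) ρ

lemma rfl1_re (ρ : ℂ) : (rfl1 ρ).re = 1 - ρ.re := by simp [rfl1]
lemma rfl1_im (ρ : ℂ) : (rfl1 ρ).im = ρ.im := by simp [rfl1]
lemma rfl1_rfl1 (ρ : ℂ) : rfl1 (rfl1 ρ) = ρ := by simp [rfl1]

lemma zm_rfl1 (ρ : ℂ) (hρ : ρ.im ≠ 0) : zm (rfl1 ρ) = zm ρ := by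
  have h1 : ρ ≠ 1 := by rintro rfl; simp at hρ
  unfold zm rfl1
  rw [one_sub_ord _ (by simpa using hρ), conj_ord ρ h1]

lemma zeta_rfl1 (ρ : ℂ) (hρ : ρ.im ≠ 0) (h0 : riemannZeta ρ = 0) : riemannZeta (rfl1 ρ) = 0 := by
  have h1 : ρ ≠ 1 := by rintro rfl; simp at hρ
  have h2 : rfl1 ρ ≠ 1 := by
    intro h; apply hρ; rw [← rfl1_im, h]; simp
  rw [← (zeta_an h2).analyticOrderAt_ne_zero]
  unfold rfl1
  rw [one_sub_ord _ (by simpa using hρ), conj_ord ρ h1, (zeta_an h1).analyticOrderAt_ne_zero]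
  exact h0

lemma cosh_bd (y : ℝ) (hy : |y| ≤ 1) : |2 - Real.exp y - Real.exp (-y)| ≤ 2 * y^2 := by
  have hc : Real.cosh y = (Real.exp y + Real.exp (-y))/2 := Real.cosh_eq y
  have h1 := Real.cosh_le_exp_half_sq y
  have hy2 : y^2 ≤ 1 := by
    rw [← sq_abs]; exact pow_le_one₀ (abs_nonneg _) hy
  have h2 : Real.exp (y^2/2) ≤ 1 + y^2/2 + (y^2/2)^2 := by
    have := Real.abs_exp_sub_one_sub_id_le (x := y^2/2) (by rw [abs_of_nonneg (by positivity)]; linarith)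
    have := (abs_le.1 this).2
    linarith
  have h3 := Real.one_le_cosh y
  rw [abs_le]
  constructor <;> nlinarith [sq_nonneg y]

lemma near : ∃ C T₀ : ℝ, 0 < C ∧ ∀ T : ℝ, T₀ ≤ T → ∀ x : ℝ, 1 < x →
    (50 * Real.log (Real.log T) / Real.log T) * Real.log x < 1 →
    ∀ A : Finset ℂ, (∀ ρ, ρ ∈ A ↔ (riemannZeta ρ = 0 ∧ 0 < ρ.re ∧ ρ.re < 1 ∧ 0 < ρ.im ∧ ρ.im ≤ T ∧
            |ρ.re - 1 / 2| < 50 * Real.log (Real.log T) / Real.log T)) →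
      ‖∑ ρ ∈ A, (zm ρ : ℂ) * ((x : ℂ) ^ (Complex.I * (ρ.im : ℂ)) *
            (1 - ((x ^ (ρ.re - 1 / 2) : ℝ) : ℂ)))‖ ≤ C * T * Real.log x ^ 2 / Real.log T := by
  obtain ⟨C, hC, T1, hT1, H⟩ := second_moment
  have hlim : Tendsto (fun T : ℝ => 50 * Real.log (Real.log T) / Real.log T) atTop (nhds 0) := by
    have h1 : Tendsto (fun L : ℝ => Real.log L / L) atTop (nhds 0) := by
      simpa using Real.isLittleO_log_id_atTop.tendsto_div_nhds_zero
    have h2 := (h1.comp Real.tendsto_log_atTop).const_mul 50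
    simp only [mul_zero] at h2
    refine h2.congr fun T => ?_
    simp [mul_div_assoc]
  obtain ⟨T2, hT2⟩ := eventually_atTop.1 (hlim.eventually (gt_mem_nhds (show (0:ℝ) < 1/8 by norm_num)))
  refine ⟨2*C, max T1 T2, by positivity, ?_⟩
  intro T hT x hx hxT A hA
  have hTa : T ≥ T1 := le_trans (le_max_left _ _) hT
  have hδ := hT2 T (le_trans (le_max_right _ _) hT)
  set δ := 50 * Real.log (Real.log T) / Real.log T with hδd
  have hx0 : 0 < x := by linarith
  have hlx : 0 < Real.log x := Real.log_pos hx
  have hmem : ∀ ρ ∈ A, rfl1 ρ ∈ A := by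
    intro ρ hρ
    obtain ⟨h1, h2, h3, h4, h5, h6⟩ := (hA ρ).1 hρ
    refine (hA _).2 ⟨zeta_rfl1 ρ h4.ne' h1, ?_, ?_, ?_, ?_, ?_⟩
    · rw [rfl1_re]; linarith
    · rw [rfl1_re]; linarith
    · rwa [rfl1_im]
    · rwa [rfl1_im]
    · rw [rfl1_re, abs_sub_comm]
      have : 1/2 - (1 - ρ.re) = ρ.re - 1/2 := by ring
      rwa [this]
  have him : ∀ ρ ∈ A, ρ.im ≠ 0 := fun ρ hρ => ((hA ρ).1 hρ).2.2.2.1.ne'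
  set F : ℂ → ℂ := fun ρ => (zm ρ : ℂ) * ((x : ℂ) ^ (Complex.I * (ρ.im : ℂ)) *
            (1 - ((x ^ (ρ.re - 1 / 2) : ℝ) : ℂ))) with hF
  have hsym : ∑ ρ ∈ A, F ρ = ∑ ρ ∈ A, F (rfl1 ρ) :=
    Finset.sum_bij' (fun ρ _ => rfl1 ρ) (fun ρ _ => rfl1 ρ) hmem hmem
      (fun ρ _ => rfl1_rfl1 ρ) (fun ρ _ => rfl1_rfl1 ρ) (fun ρ _ => by rw [rfl1_rfl1])
  have hpt : ∀ ρ ∈ A, ‖F ρ + F (rfl1 ρ)‖ ≤ 2 * Real.log x ^ 2 * ((zm ρ : ℝ) * (ρ.re - 1/2)^2) := by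
    intro ρ hρ
    obtain ⟨h1, h2, h3, h4, h5, h6⟩ := (hA ρ).1 hρ
    have e : F ρ + F (rfl1 ρ) = (zm ρ : ℂ) * ((x : ℂ) ^ (Complex.I * (ρ.im : ℂ)) *
        ((2 - Real.exp (Real.log x * (ρ.re - 1/2)) - Real.exp (-(Real.log x * (ρ.re - 1/2))) : ℝ) : ℂ)) := by
      simp only [hF]
      rw [zm_rfl1 ρ (him ρ hρ), rfl1_im, rfl1_re, Real.rpow_def_of_pos hx0, Real.rpow_def_of_pos hx0,
        show Real.log x * (1 - ρ.re - 1/2) = -(Real.log x * (ρ.re - 1/2)) by ring]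
      push_cast
      ring
    have hn : ‖(x : ℂ) ^ (Complex.I * (ρ.im : ℂ))‖ = 1 := by
      rw [Complex.norm_cpow_eq_rpow_re_of_pos hx0]; simp
    rw [e, norm_mul, norm_mul, hn, one_mul, Complex.norm_natCast, Complex.norm_real, Real.norm_eq_abs]
    have hb : |Real.log x * (ρ.re - 1/2)| ≤ 1 := by
      rw [abs_mul, abs_of_pos hlx]
      have := mul_le_mul_of_nonneg_left h6.le hlx.le
      linarith
    calc _ ≤ (zm ρ : ℝ) * (2 * (Real.log x * (ρ.re - 1/2))^2) :=
          mul_le_mul_of_nonneg_left (cosh_bd _ hb) (Nat.cast_nonneg _)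
      _ = _ := by ring
  classical
  have hb : ∀ ρ ∈ A, ρ.re ≤ 5/8 := by
    intro ρ hρ
    have := (abs_lt.1 ((hA ρ).1 hρ).2.2.2.2.2).2
    linarith
  set G : ℂ → ℝ := fun ρ => (zm ρ : ℝ) * (ρ.re - 1/2)^2 with hG
  have s1 : ∑ ρ ∈ A.filter (fun ρ => 1/2 ≤ ρ.re), G ρ ≤ C * T / Real.log T := by
    apply H T hTa
    intro ρ hρ
    obtain ⟨hρ1, hρ2⟩ := Finset.mem_filter.1 hρ
    obtain ⟨h1, h2, h3, h4, h5, h6⟩ := (hA ρ).1 hρ1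
    exact ⟨h1, hρ2, hb ρ hρ1, h4, h5⟩
  have s2 : ∑ ρ ∈ A.filter (fun ρ => ¬ 1/2 ≤ ρ.re), G ρ ≤ C * T / Real.log T := by
    have e : ∑ ρ ∈ A.filter (fun ρ => ¬ 1/2 ≤ ρ.re), G ρ
        = ∑ ρ ∈ (A.filter (fun ρ => ¬ 1/2 ≤ ρ.re)).image rfl1, G ρ := by
      rw [Finset.sum_image (fun a _ b _ hab => by
        have := congrArg rfl1 hab
        rwa [rfl1_rfl1, rfl1_rfl1] at this)]
      refine Finset.sum_congr rfl fun ρ hρ => ?_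
      simp only [hG]
      rw [zm_rfl1 ρ (him ρ (Finset.mem_filter.1 hρ).1), rfl1_re]
      ring
    rw [e]
    apply H T hTa
    intro ρ' hρ'
    obtain ⟨ρ, hρ, rfl⟩ := Finset.mem_image.1 hρ'
    obtain ⟨hρ1, hρ2⟩ := Finset.mem_filter.1 hρ
    have hm := hmem ρ hρ1
    obtain ⟨h1, h2, h3, h4, h5, h6⟩ := (hA _).1 hm
    refine ⟨h1, ?_, hb _ hm, h4, h5⟩
    rw [rfl1_re]; push Not at hρ2; linarith
  have s3 : ∑ ρ ∈ A, G ρ ≤ 2 * (C * T / Real.log T) := by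
    rw [← Finset.sum_filter_add_sum_filter_not A (fun ρ => 1/2 ≤ ρ.re)]
    linarith
  have e2 : (2:ℂ) * ∑ ρ ∈ A, F ρ = ∑ ρ ∈ A, (F ρ + F (rfl1 ρ)) := by
    rw [Finset.sum_add_distrib, ← hsym]; ring
  have h2 : 2 * ‖∑ ρ ∈ A, F ρ‖ ≤ 2 * Real.log x ^ 2 * (2 * (C * T / Real.log T)) := by
    calc 2 * ‖∑ ρ ∈ A, F ρ‖ = ‖(2:ℂ) * ∑ ρ ∈ A, F ρ‖ := by rw [norm_mul]; simp
      _ ≤ ∑ ρ ∈ A, 2 * Real.log x ^ 2 * G ρ := by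
          rw [e2]; exact norm_sum_le_of_le _ hpt
      _ = 2 * Real.log x ^ 2 * ∑ ρ ∈ A, G ρ := by rw [Finset.mul_sum]
      _ ≤ _ := mul_le_mul_of_nonneg_left s3 (by positivity)
  calc ‖∑ ρ ∈ A, F ρ‖ ≤ Real.log x ^ 2 * (2 * (C * T / Real.log T)) := by linarith
    _ = _ := by ring

end FZ

/-- Second zero-sum estimate in Section 3 of Ford–Zaharescu (zeros near the critical
line). -/
theorem ford_zaharescu_near_zeros :
    ∃ C T₀ : ℝ, 0 < C ∧ ∀ T : ℝ, T₀ ≤ T → ∀ x : ℝ, 1 < x →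
      (50 * Real.log (Real.log T) / Real.log T) * Real.log x < 1 →
      ‖∑ᶠ ρ ∈ {ρ : ℂ | riemannZeta ρ = 0 ∧ 0 < ρ.re ∧ ρ.re < 1 ∧ 0 < ρ.im ∧ ρ.im ≤ T ∧
            |ρ.re - 1 / 2| < 50 * Real.log (Real.log T) / Real.log T},
          (zetaZeroMult ρ : ℂ) * ((x : ℂ) ^ (Complex.I * (ρ.im : ℂ)) *
            (1 - ((x ^ (ρ.re - 1 / 2) : ℝ) : ℂ)))‖ ≤
        C * T * Real.log x ^ 2 / Real.log T := by
  obtain ⟨C, T₀, hC, H⟩ := FZ.near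
  refine ⟨C, T₀, hC, fun T hT x hx hxT => ?_⟩
  have hfin : {ρ : ℂ | riemannZeta ρ = 0 ∧ 0 < ρ.re ∧ ρ.re < 1 ∧ 0 < ρ.im ∧ ρ.im ≤ T ∧
            |ρ.re - 1 / 2| < 50 * Real.log (Real.log T) / Real.log T}.Finite :=
    (FZ.low_finite T).subset (fun ρ hρ =>
      ⟨hρ.1, hρ.2.1.le, hρ.2.2.1.le, hρ.2.2.2.1.le, hρ.2.2.2.2.1⟩)
  rw [finsum_mem_eq_finite_toFinset_sum _ hfin]
  have h := H T hT x hx hxT hfin.toFinset (fun ρ => by rw [Set.Finite.mem_toFinset]; rfl)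
  refine le_trans (le_of_eq ?_) h
  congr 1
  refine Finset.sum_congr rfl fun ρ hρ => ?_
  have hρ1 : ρ ≠ 1 := by
    rintro rfl
    have := ((Set.Finite.mem_toFinset hfin).1 hρ).2.2.1
    simp at this
  have e : zetaZeroMult ρ = FZ.zm ρ := by
    unfold zetaZeroMult FZ.zm
    rw [dif_pos (FZ.zeta_an hρ1)]
  rw [e]
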